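/- Let 1 ≤ p < ∞, m ∈ ℕ, 0 ≤ ℓ < d and a ∈ ℝ. Assume that W^m_p(ℝ^d) is an algebra with respect to pointwise multiplication (i.e. either 1 < p < ∞ and m > d/p, or p = 1 and m ≥ d). Then there exists a constant c such that ‖u·v | 𝒦^m_{2a−d/p, p}(ℝ^d,ℝ^ℓ_*)‖ ≤ c ‖u | 𝒦^m_{a,p}(ℝ^d,ℝ^ℓ_*)‖ · ‖v | 𝒦^m_{a,p}(ℝ^d,ℝ^ℓ_*)‖ for all u, v ∈ 𝒦^m_{a,p}(ℝ^d,ℝ^ℓ_*). -/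

import Mathlib

open MeasureTheory Metric Set Filter
open scoped Topology ENNReal NNReal

noncomputable section

/-- `d`-dimensional Euclidean space. -/
abbrev Ed (d : ℕ) : Type := EuclideanSpace ℝ (Fin d)

/-- The finite set of all multi-indices `α : Fin d → ℕ` with `|α| = ∑ i, α i ≤ m`. -/
def multiIdx (d m : ℕ) : Finset (Fin d → ℕ) :=
  (Fintype.piFinset fun _ : Fin d => Finset.range (m + 1)).filter fun α => ∑ i, α i ≤ m

/-- First-order partial derivative in the `i`-th coordinate direction. -/
def pderivI (d : ℕ) (i : Fin d) (f : Ed d → ℝ) : Ed d → ℝ :=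
  fun x => fderiv ℝ f x (EuclideanSpace.single i 1)

/-- Iterated partial derivative `∂^α`. -/
def pderivA (d : ℕ) (α : Fin d → ℕ) (f : Ed d → ℝ) : Ed d → ℝ :=
  ((List.finRange d).foldr (fun i g => (pderivI d i)^[α i] ∘ g) id) f

/-- Smooth compactly supported test functions with support inside `Ω`. -/
def IsTestFun (d : ℕ) (Ω : Set (Ed d)) (φ : Ed d → ℝ) : Prop :=
  ContDiff ℝ (⊤ : ℕ∞) φ ∧ HasCompactSupport φ ∧ tsupport φ ⊆ Ω

/-- `v` is the `α`-th weak (distributional) derivative of `u` on `Ω`. -/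
def HasWeakDerivOn (d : ℕ) (Ω : Set (Ed d)) (α : Fin d → ℕ) (u v : Ed d → ℝ) : Prop :=
  LocallyIntegrableOn u Ω volume ∧ LocallyIntegrableOn v Ω volume ∧
    ∀ φ : Ed d → ℝ, IsTestFun d Ω φ →
      ∫ x in Ω, u x * pderivA d α φ x = (-1 : ℝ) ^ (∑ i, α i) * ∫ x in Ω, v x * φ x

/-- `D` is a family of weak derivatives of `u` on `Ω` for all multi-indices of order `≤ m`. -/
def IsWeakDerivFamily (d : ℕ) (Ω : Set (Ed d)) (m : ℕ) (u : Ed d → ℝ)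
    (D : (Fin d → ℕ) → Ed d → ℝ) : Prop :=
  ∀ α ∈ multiIdx d m, HasWeakDerivOn d Ω α u (D α)

/-- `x ↦ (ρ(x)^(|α|-a) |v(x)|)^p`, the integrand in the Kondratiev norm. -/
def kIntegrand (d : ℕ) (ρ : Ed d → ℝ) (a p : ℝ) (α : Fin d → ℕ) (v : Ed d → ℝ) : Ed d → ℝ :=
  fun x => (ρ x ^ (((∑ i, α i : ℕ) : ℝ) - a) * |v x|) ^ p

/-- The Kondratiev norm computed from a family `D` of weak derivatives. -/
def KnormP (d : ℕ) (Ω : Set (Ed d)) (ρ : Ed d → ℝ) (m : ℕ) (a p : ℝ)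
    (D : (Fin d → ℕ) → Ed d → ℝ) : ℝ :=
  (∑ α ∈ multiIdx d m, ∫ x in Ω, kIntegrand d ρ a p α (D α) x) ^ (1 / p)

/-- `D` witnesses membership of `u` in the Kondratiev space `𝒦^m_{a,p}(Ω, M)`
    (with weight function `ρ`). -/
def KMemData (d : ℕ) (Ω : Set (Ed d)) (ρ : Ed d → ℝ) (m : ℕ) (a p : ℝ)
    (u : Ed d → ℝ) (D : (Fin d → ℕ) → Ed d → ℝ) : Prop :=
  IsWeakDerivFamily d Ω m u D ∧
    ∀ α ∈ multiIdx d m, IntegrableOn (kIntegrand d ρ a p α (D α)) Ω volume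

/-- Membership in the Kondratiev space `𝒦^m_{a,p}(Ω, M)` with weight `ρ`, `p < ∞`. -/
def MemK (d : ℕ) (Ω : Set (Ed d)) (ρ : Ed d → ℝ) (m : ℕ) (a p : ℝ) (u : Ed d → ℝ) : Prop :=
  ∃ D, KMemData d Ω ρ m a p u D

open Classical in
/-- The Kondratiev norm of `u` (computed from a choice of weak derivative family;
    it is a.e. independent of this choice). -/
def Knorm (d : ℕ) (Ω : Set (Ed d)) (ρ : Ed d → ℝ) (m : ℕ) (a p : ℝ) (u : Ed d → ℝ) : ℝ :=
  if h : MemK d Ω ρ m a p u then KnormP d Ω ρ m a p h.choose else 0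

/-- `x ↦ ρ(x)^(|α|-a) v(x)`, the function whose `L_∞` norm enters the norm for `p = ∞`. -/
def kIntegrandInf (d : ℕ) (ρ : Ed d → ℝ) (a : ℝ) (α : Fin d → ℕ) (v : Ed d → ℝ) : Ed d → ℝ :=
  fun x => ρ x ^ (((∑ i, α i : ℕ) : ℝ) - a) * v x

/-- `D` witnesses membership of `u` in `𝒦^m_{a,∞}(Ω, M)`. -/
def KMemDataInf (d : ℕ) (Ω : Set (Ed d)) (ρ : Ed d → ℝ) (m : ℕ) (a : ℝ)
    (u : Ed d → ℝ) (D : (Fin d → ℕ) → Ed d → ℝ) : Prop :=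
  IsWeakDerivFamily d Ω m u D ∧
    ∀ α ∈ multiIdx d m,
      eLpNorm (kIntegrandInf d ρ a α (D α)) ⊤ (volume.restrict Ω) < ⊤

/-- Membership in `𝒦^m_{a,∞}(Ω, M)`. -/
def MemKInf (d : ℕ) (Ω : Set (Ed d)) (ρ : Ed d → ℝ) (m : ℕ) (a : ℝ) (u : Ed d → ℝ) : Prop :=
  ∃ D, KMemDataInf d Ω ρ m a u D

/-- The `𝒦^m_{a,∞}` norm computed from a family `D` of weak derivatives. -/
def KnormInfP (d : ℕ) (Ω : Set (Ed d)) (ρ : Ed d → ℝ) (m : ℕ) (a : ℝ)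
    (D : (Fin d → ℕ) → Ed d → ℝ) : ℝ :=
  ∑ α ∈ multiIdx d m, (eLpNorm (kIntegrandInf d ρ a α (D α)) ⊤ (volume.restrict Ω)).toReal

open Classical in
/-- The `𝒦^m_{a,∞}(Ω, M)` norm of `u`. -/
def KnormInf (d : ℕ) (Ω : Set (Ed d)) (ρ : Ed d → ℝ) (m : ℕ) (a : ℝ) (u : Ed d → ℝ) : ℝ :=
  if h : MemKInf d Ω ρ m a u then KnormInfP d Ω ρ m a h.choose else 0

/-- The subspace `ℝ^ℓ_* = {x : x₁ = ⋯ = x_{d-ℓ} = 0}` of `ℝ^d`. -/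
def RStar (d ℓ : ℕ) : Set (Ed d) := {x | ∀ i : Fin d, (i : ℕ) < d - ℓ → x i = 0}

/-- The weight `ρ(x) = min(1, |x'|)` for the model case `(ℝ^d, ℝ^ℓ_*)`. -/
def rhoModel (d ℓ : ℕ) (x : Ed d) : ℝ :=
  min 1 (Real.sqrt (∑ i ∈ Finset.univ.filter (fun i : Fin d => (i : ℕ) < d - ℓ), (x i) ^ 2))

/-- The model domain `ℝ^d ∖ ℝ^ℓ_*`. -/
def ModelDomain (d ℓ : ℕ) : Set (Ed d) := (RStar d ℓ)ᶜ

/-- Membership in the model Kondratiev space `𝒦^m_{a,p}(ℝ^d, ℝ^ℓ_*)`, `p < ∞`. -/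
def MemKM (d ℓ m : ℕ) (a p : ℝ) (u : Ed d → ℝ) : Prop :=
  MemK d (ModelDomain d ℓ) (rhoModel d ℓ) m a p u

/-- The norm of the model Kondratiev space `𝒦^m_{a,p}(ℝ^d, ℝ^ℓ_*)`, `p < ∞`. -/
def KnormM (d ℓ m : ℕ) (a p : ℝ) (u : Ed d → ℝ) : ℝ :=
  Knorm d (ModelDomain d ℓ) (rhoModel d ℓ) m a p u

/-- Membership in the model Kondratiev space `𝒦^m_{a,∞}(ℝ^d, ℝ^ℓ_*)`. -/
def MemKMInf (d ℓ m : ℕ) (a : ℝ) (u : Ed d → ℝ) : Prop :=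
  MemKInf d (ModelDomain d ℓ) (rhoModel d ℓ) m a u

/-- The norm of the model Kondratiev space `𝒦^m_{a,∞}(ℝ^d, ℝ^ℓ_*)`. -/
def KnormMInf (d ℓ m : ℕ) (a : ℝ) (u : Ed d → ℝ) : ℝ :=
  KnormInf d (ModelDomain d ℓ) (rhoModel d ℓ) m a u

/-- Smooth real functions on `Ed d`. -/
def Sm (d : ℕ) (f : Ed d → ℝ) : Prop := ContDiff ℝ (⊤ : ℕ∞) f

lemma Sm.pI {d : ℕ} {f : Ed d → ℝ} (hf : Sm d f) (i : Fin d) : Sm d (pderivI d i f) := by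
  unfold Sm pderivI at *
  exact (hf.fderiv_right (m := (⊤ : ℕ∞)) (by simp)).clm_apply contDiff_const

lemma Sm.differentiable {d : ℕ} {f : Ed d → ℝ} (hf : Sm d f) : Differentiable ℝ f :=
  ContDiff.differentiable hf (by simp)

lemma Sm.continuous {d : ℕ} {f : Ed d → ℝ} (hf : Sm d f) : Continuous f :=
  ContDiff.continuous hf

lemma pderivI_comm {d : ℕ} {f : Ed d → ℝ} (hf : Sm d f) (i j : Fin d) :
    pderivI d i (pderivI d j f) = pderivI d j (pderivI d i f) := by
  have h2 : Differentiable ℝ (fderiv ℝ f) :=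
    ContDiff.differentiable (n := (⊤ : ℕ∞)) (ContDiff.fderiv_right (m := (⊤ : ℕ∞)) hf (by simp)) (by simp)
  have key : ∀ (k l : Fin d) x, pderivI d k (pderivI d l f) x =
      fderiv ℝ (fderiv ℝ f) x (EuclideanSpace.single k 1) (EuclideanSpace.single l 1) := by
    intro k l x
    unfold pderivI
    rw [fderiv_clm_apply (h2 x) (by fun_prop)]
    simp
  funext x
  rw [key, key]
  have := (ContDiff.contDiffAt hf (x := x)).isSymmSndFDerivAt (by simp; exact WithTop.coe_le_coe.2 (le_top : (2 : ℕ∞) ≤ ⊤))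
  exact this _ _

lemma Sm.iterI {d : ℕ} {f : Ed d → ℝ} (hf : Sm d f) (i : Fin d) (n : ℕ) :
    Sm d ((pderivI d i)^[n] f) := by
  induction n with
  | zero => exact hf
  | succ n ih => rw [Function.iterate_succ_apply']; exact ih.pI i

lemma pderivI_iter_comm {d : ℕ} {f : Ed d → ℝ} (hf : Sm d f) (i j : Fin d) (n : ℕ) :
    pderivI d i ((pderivI d j)^[n] f) = (pderivI d j)^[n] (pderivI d i f) := by
  induction n with
  | zero => rfl
  | succ n ih =>
    rw [Function.iterate_succ_apply', Function.iterate_succ_apply', pderivI_comm (hf.iterI j n), ih]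

/-- Auxiliary: iterated derivative along a list of coordinates. -/
def opL (d : ℕ) (l : List (Fin d)) (α : Fin d → ℕ) (f : Ed d → ℝ) : Ed d → ℝ :=
  (l.foldr (fun i g => (pderivI d i)^[α i] ∘ g) id) f

lemma opL_cons {d : ℕ} (j : Fin d) (l : List (Fin d)) (α : Fin d → ℕ) (f : Ed d → ℝ) :
    opL d (j :: l) α f = (pderivI d j)^[α j] (opL d l α f) := by
  simp [opL]

lemma Sm.oL {d : ℕ} {f : Ed d → ℝ} (hf : Sm d f) (l : List (Fin d)) (α : Fin d → ℕ) :
    Sm d (opL d l α f) := by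
  induction l with
  | nil => exact hf
  | cons j l ih => rw [opL_cons]; exact ih.iterI _ _

lemma opL_congr {d : ℕ} (l : List (Fin d)) (α β : Fin d → ℕ) (h : ∀ i ∈ l, α i = β i)
    (f : Ed d → ℝ) : opL d l α f = opL d l β f := by
  induction l with
  | nil => rfl
  | cons j l ih =>
    rw [opL_cons, opL_cons, ih (fun i hi => h i (by simp [hi])), h j (by simp)]

lemma pderivI_opL {d : ℕ} {f : Ed d → ℝ} (hf : Sm d f) (l : List (Fin d)) (hl : l.Nodup)
    (α : Fin d → ℕ) (i : Fin d) (hi : i ∈ l) :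
    pderivI d i (opL d l α f) = opL d l (α + Pi.single i 1) f := by
  induction l with
  | nil => simp at hi
  | cons j l ih =>
    rw [opL_cons, opL_cons]
    rw [List.nodup_cons] at hl
    by_cases hij : i = j
    · subst hij
      rw [← Function.iterate_succ_apply' (pderivI d i)]
      rw [opL_congr l α (α + Pi.single i 1)]
      · simp
      · intro k hk
        have : k ≠ i := by rintro rfl; exact hl.1 hk
        simp [this]
    · have hil : i ∈ l := by simpa [hij] using hi
      rw [pderivI_iter_comm (hf.oL l α), ih hl.2 hil]
      simp [Ne.symm hij]

lemma Sm.pA {d : ℕ} {f : Ed d → ℝ} (hf : Sm d f) (α : Fin d → ℕ) : Sm d (pderivA d α f) :=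
  hf.oL _ _

lemma pderivI_pderivA {d : ℕ} {f : Ed d → ℝ} (hf : Sm d f) (α : Fin d → ℕ) (i : Fin d) :
    pderivI d i (pderivA d α f) = pderivA d (α + Pi.single i 1) f :=
  pderivI_opL hf _ (List.nodup_finRange d) α i (List.mem_finRange i)

lemma pderivA_zero {d : ℕ} (f : Ed d → ℝ) : pderivA d 0 f = f := by
  change opL d _ 0 f = f
  induction (List.finRange d) with
  | nil => rfl
  | cons j l ih => rw [opL_cons, ih]; rfl

lemma mi_ind {d : ℕ} {P : (Fin d → ℕ) → Prop} (h0 : P 0)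
    (hs : ∀ α i, P α → P (α + Pi.single i 1)) (α : Fin d → ℕ) : P α := by
  suffices H : ∀ n (α : Fin d → ℕ), ∑ i, α i = n → P α from H _ α rfl
  intro n
  induction n with
  | zero =>
    intro α hα
    have : α = 0 := by
      funext i
      have := (Finset.sum_eq_zero_iff.1 hα) i (Finset.mem_univ i)
      simpa using this
    rw [this]; exact h0
  | succ n ih =>
    intro α hα
    obtain ⟨i, -, hi⟩ : ∃ i ∈ Finset.univ, α i ≠ 0 := by
      apply Finset.exists_ne_zero_of_sum_ne_zero
      omega
    have e : α = (α - Pi.single i 1) + Pi.single i 1 := by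
      funext j
      by_cases hj : j = i
      · subst hj; simp; omega
      · simp [hj]
    rw [e]
    apply hs
    apply ih
    have h2 : ∑ j, α j = ∑ j, (α - Pi.single i 1 : Fin d → ℕ) j + ∑ j, (Pi.single i 1 : Fin d → ℕ) j := by
      rw [← Finset.sum_add_distrib]
      conv_lhs => rw [e]
      rfl
    simp at h2
    simp
    omega

lemma sum_add_single {d : ℕ} (α : Fin d → ℕ) (i : Fin d) :
    ∑ j, (α + Pi.single i 1 : Fin d → ℕ) j = ∑ j, α j + 1 := by
  simp [Finset.sum_add_distrib]

lemma Sm.comp_affine {d : ℕ} {f : Ed d → ℝ} (hf : Sm d f) (x0 : Ed d) (r : ℝ) :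
    Sm d (fun x => f (x0 + r • x)) := by
  unfold Sm at *
  exact hf.comp (by fun_prop)

lemma pderivI_comp_affine {d : ℕ} {f : Ed d → ℝ} (hf : Differentiable ℝ f) (x0 : Ed d) (r : ℝ)
    (i : Fin d) : pderivI d i (fun x => f (x0 + r • x)) = fun x => r * pderivI d i f (x0 + r • x) := by
  funext x
  unfold pderivI
  have h1 : HasFDerivAt (fun x : Ed d => x0 + r • x) (r • ContinuousLinearMap.id ℝ (Ed d)) x :=
    ((hasFDerivAt_id x).const_smul r).const_add x0
  have := ((hf (x0 + r • x)).hasFDerivAt.comp x h1).fderiv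
  rw [Function.comp_def] at this
  rw [this]
  simp

lemma pderivI_const_mul {d : ℕ} {f : Ed d → ℝ} (hf : Differentiable ℝ f) (c : ℝ)
    (i : Fin d) : pderivI d i (fun x => c * f x) = fun x => c * pderivI d i f x := by
  funext x
  unfold pderivI
  rw [fderiv_const_mul (hf x)]
  simp

lemma pderivA_comp_affine {d : ℕ} {f : Ed d → ℝ} (hf : Sm d f) (x0 : Ed d) (r : ℝ)
    (α : Fin d → ℕ) : pderivA d α (fun x => f (x0 + r • x)) =
      fun x => r ^ (∑ i, α i) * pderivA d α f (x0 + r • x) := by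
  induction α using mi_ind with
  | h0 => simp [pderivA_zero]
  | hs α i ih =>
    rw [← pderivI_pderivA (hf.comp_affine x0 r), ih, sum_add_single, ← pderivI_pderivA hf,
      pderivI_const_mul ((hf.pA α).comp_affine x0 r).differentiable,
      pderivI_comp_affine (hf.pA α).differentiable]
    funext x; ring

lemma pderivI_tsupport {d : ℕ} (f : Ed d → ℝ) (i : Fin d) :
    tsupport (pderivI d i f) ⊆ tsupport f :=
  tsupport_fderiv_apply_subset ℝ _

lemma pderivA_tsupport {d : ℕ} {f : Ed d → ℝ} (hf : Sm d f) (α : Fin d → ℕ) :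
    tsupport (pderivA d α f) ⊆ tsupport f := by
  induction α using mi_ind with
  | h0 => simp [pderivA_zero]
  | hs α i ih =>
    rw [← pderivI_pderivA hf]
    exact (pderivI_tsupport _ i).trans ih

lemma pderivA_hasCompactSupport {d : ℕ} {f : Ed d → ℝ} (hf : Sm d f) (hc : HasCompactSupport f)
    (α : Fin d → ℕ) : HasCompactSupport (pderivA d α f) :=
  hc.of_isClosed_subset (isClosed_tsupport _) (pderivA_tsupport hf α)

lemma ibp_I {d : ℕ} {f φ : Ed d → ℝ} (hf : Sm d f) (hφ : Sm d φ) (hc : HasCompactSupport φ)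
    (i : Fin d) : ∫ x, f x * pderivI d i φ x = - ∫ x, pderivI d i f x * φ x := by
  unfold pderivI
  have hc' : HasCompactSupport (pderivI d i φ) :=
    hc.of_isClosed_subset (isClosed_tsupport _) (pderivI_tsupport φ i)
  apply integral_mul_fderiv_eq_neg_fderiv_mul_of_integrable
  · exact ((hf.pI i).continuous.mul hφ.continuous).integrable_of_hasCompactSupport hc.mul_left
  · exact (hf.continuous.mul (hφ.pI i).continuous).integrable_of_hasCompactSupport hc'.mul_left
  · exact (hf.continuous.mul hφ.continuous).integrable_of_hasCompactSupport hc.mul_left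
  · exact fun x _ => hf.differentiable x
  · exact fun x _ => hφ.differentiable x

lemma ibp_A {d : ℕ} {f φ : Ed d → ℝ} (hf : Sm d f) (hφ : Sm d φ) (hc : HasCompactSupport φ)
    (α : Fin d → ℕ) :
    ∫ x, f x * pderivA d α φ x = (-1) ^ (∑ i, α i) * ∫ x, pderivA d α f x * φ x := by
  induction α using mi_ind generalizing f with
  | h0 => simp [pderivA_zero]
  | hs α i ih =>
    rw [← pderivI_pderivA hφ, ibp_I hf (hφ.pA α) (pderivA_hasCompactSupport hφ hc α),
      ih (hf.pI i), sum_add_single]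
    have : pderivA d α (pderivI d i f) = pderivA d (α + Pi.single i 1) f := by
      clear ih
      rw [← pderivI_pderivA hf]
      induction α using mi_ind with
      | h0 => simp [pderivA_zero]
      | hs α j ih => rw [← pderivI_pderivA (hf.pI i), ih, pderivI_comm (hf.pA α),
          pderivI_pderivA hf]
    rw [this]; ring

lemma pderivI_conv {d : ℕ} {φ w : Ed d → ℝ} (hφ : Sm d φ) (hc : HasCompactSupport φ)
    (hw : LocallyIntegrable w volume) (i : Fin d) :
    pderivI d i (fun x => ∫ y, φ (x - y) * w y) = fun x => ∫ y, pderivI d i φ (x - y) * w y := by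
  have e : ∀ ψ : Ed d → ℝ, (fun x => ∫ y, ψ (x - y) * w y) =
      convolution w ψ (ContinuousLinearMap.mul ℝ ℝ) volume := by
    intro ψ; funext x
    simp [convolution_def, mul_comm]
  rw [e, e]
  funext x
  unfold pderivI
  rw [(hc.hasFDerivAt_convolution_right (ContinuousLinearMap.mul ℝ ℝ) hw
    (ContDiff.of_le hφ (by simp)) x).fderiv]
  rw [convolution_precompR_apply _ hw (hc.fderiv ℝ) (ContDiff.continuous_fderiv hφ (by simp))]

lemma Sm.conv {d : ℕ} {φ w : Ed d → ℝ} (hφ : Sm d φ) (hc : HasCompactSupport φ)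
    (hw : LocallyIntegrable w volume) : Sm d (fun x => ∫ y, φ (x - y) * w y) := by
  have e : ∀ ψ : Ed d → ℝ, (fun x => ∫ y, ψ (x - y) * w y) =
      convolution w ψ (ContinuousLinearMap.mul ℝ ℝ) volume := by
    intro ψ; funext x
    simp [convolution_def, mul_comm]
  rw [e]
  exact hc.contDiff_convolution_right _ hw hφ

lemma pderivA_conv {d : ℕ} {φ w : Ed d → ℝ} (hφ : Sm d φ) (hc : HasCompactSupport φ)
    (hw : LocallyIntegrable w volume) (α : Fin d → ℕ) :
    pderivA d α (fun x => ∫ y, φ (x - y) * w y) = fun x => ∫ y, pderivA d α φ (x - y) * w y := by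
  induction α using mi_ind with
  | h0 => simp [pderivA_zero]
  | hs α i ih =>
    rw [← pderivI_pderivA (hφ.conv hc hw), ih, pderivI_conv (hφ.pA α)
      (pderivA_hasCompactSupport hφ hc α) hw, pderivI_pderivA hφ]

lemma mem_multiIdx {d m : ℕ} {α : Fin d → ℕ} : α ∈ multiIdx d m ↔ ∑ i, α i ≤ m := by
  unfold multiIdx
  simp only [Finset.mem_filter, Fintype.mem_piFinset, Finset.mem_range, and_iff_right_iff_imp]
  intro h i
  have := Finset.single_le_sum (f := α) (fun j _ => Nat.zero_le _) (Finset.mem_univ i)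
  omega

lemma pderivI_mul {d : ℕ} {f g : Ed d → ℝ} (hf : Sm d f) (hg : Sm d g) (i : Fin d) :
    pderivI d i (fun x => f x * g x) = fun x => pderivI d i f x * g x + f x * pderivI d i g x := by
  funext x
  unfold pderivI
  rw [fderiv_fun_mul (hf.differentiable x) (hg.differentiable x)]
  simp; ring

lemma Sm.mul {d : ℕ} {f g : Ed d → ℝ} (hf : Sm d f) (hg : Sm d g) : Sm d (fun x => f x * g x) :=
  ContDiff.mul hf hg

/-- Leibniz rule: a list of pairs of multi-indices. -/
lemma leibniz (d : ℕ) (α : Fin d → ℕ) : ∃ L : List ((Fin d → ℕ) × (Fin d → ℕ)),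
    (∀ b ∈ L, ∑ i, b.1 i + ∑ i, b.2 i = ∑ i, α i) ∧
    ∀ f g : Ed d → ℝ, Sm d f → Sm d g → pderivA d α (fun x => f x * g x) =
      fun x => (L.map (fun b => pderivA d b.1 f x * pderivA d b.2 g x)).sum := by
  induction α using mi_ind with
  | h0 => exact ⟨[(0, 0)], by simp, by intro f g _ _; simp [pderivA_zero]⟩
  | hs α i ih =>
    obtain ⟨L, hL, h⟩ := ih
    refine ⟨L.map (fun b => (b.1 + Pi.single i 1, b.2)) ++ L.map (fun b => (b.1, b.2 + Pi.single i 1)),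
      ?_, ?_⟩
    · intro b hb
      rw [sum_add_single]
      simp only [List.mem_append, List.mem_map] at hb
      rcases hb with ⟨c, hc, rfl⟩ | ⟨c, hc, rfl⟩
      · have := hL c hc; simp only [sum_add_single]; omega
      · have := hL c hc; simp only [sum_add_single]; omega
    · intro f g hf hg
      rw [← pderivI_pderivA (hf.mul hg), h f g hf hg]
      clear h hL
      induction L with
      | nil => funext x; simp [pderivI]
      | cons b L ih =>
        have hsm : Sm d (fun x => (L.map (fun b => pderivA d b.1 f x * pderivA d b.2 g x)).sum) := by
          clear ih
          induction L with
          | nil => exact contDiff_const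
          | cons c L ih => simpa [Sm] using ContDiff.add ((hf.pA c.1).mul (hg.pA c.2)) ih
        have : pderivI d i (fun x => ((b :: L).map (fun b => pderivA d b.1 f x * pderivA d b.2 g x)).sum)
          = fun x => pderivI d i (fun x => pderivA d b.1 f x * pderivA d b.2 g x) x +
            pderivI d i (fun x => (L.map (fun b => pderivA d b.1 f x * pderivA d b.2 g x)).sum) x := by
          funext x
          simp only [List.map_cons, List.sum_cons]
          unfold pderivI
          rw [fderiv_fun_add (((hf.pA b.1).mul (hg.pA b.2)).differentiable x)
            (hsm.differentiable x)]
          simp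
        rw [this, ih, pderivI_mul (hf.pA b.1) (hg.pA b.2), pderivI_pderivA hf,
          pderivI_pderivA hg]
        funext x
        simp only [List.map_append, List.map_map, List.sum_append, List.map_cons, List.sum_cons,
          Function.comp_def]
        ring

lemma pderivA_add {d : ℕ} {f : Ed d → ℝ} (hf : Sm d f) (α β : Fin d → ℕ) :
    pderivA d α (pderivA d β f) = pderivA d (α + β) f := by
  induction α using mi_ind with
  | h0 => simp [pderivA_zero]
  | hs α i ih =>
    rw [← pderivI_pderivA (hf.pA β), ih, pderivI_pderivA hf]
    congr 1; abel

lemma pderivA_single {d : ℕ} {f : Ed d → ℝ} (hf : Sm d f) (i : Fin d) :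
    pderivA d (Pi.single i 1) f = pderivI d i f := by
  have := pderivI_pderivA hf 0 i
  rw [pderivA_zero] at this
  rw [this]; simp

lemma pderivI_eq_deriv {d : ℕ} {f : Ed d → ℝ} (hf : Sm d f) (i : Fin d) (x : Fin d → ℝ) (t : ℝ) :
    HasDerivAt (fun s => f (WithLp.toLp 2 (Function.update x i s)))
      (pderivI d i f (WithLp.toLp 2 (Function.update x i t))) t := by
  have h1 : HasDerivAt (fun s => (WithLp.toLp 2 (Function.update x i s) : Ed d))
      (EuclideanSpace.single i 1) t := by
    have : (fun s => (WithLp.toLp 2 (Function.update x i s) : Ed d)) =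
        fun s => WithLp.toLp 2 (Function.update x i 0) + s • EuclideanSpace.single i (1 : ℝ) := by
      funext s
      ext j
      by_cases h : j = i
      · subst h; simp
      · simp [h]
    rw [this]
    simpa using ((hasDerivAt_id t).smul_const (EuclideanSpace.single i (1 : ℝ) : Ed d)).const_add
      (WithLp.toLp 2 (Function.update x i 0))
  exact (hf.differentiable _).hasFDerivAt.comp_hasDerivAt t h1

lemma ftc_enorm {h h' : ℝ → ℝ} (hd : ∀ t, HasDerivAt h (h' t) t) (hc : Continuous h') (a b : ℝ) :
    ‖h a‖ₑ ≤ ‖h b‖ₑ + ∫⁻ s in Set.uIoc a b, ‖h' s‖ₑ := by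
  have e := intervalIntegral.integral_eq_sub_of_hasDerivAt (a := a) (b := b) (fun t _ => hd t)
    (hc.intervalIntegrable _ _)
  have e2 : h a = h b - ∫ s in a..b, h' s := by rw [e]; ring
  rw [e2]
  refine (enorm_sub_le).trans ?_
  gcongr
  rw [← enorm_norm, intervalIntegral.norm_intervalIntegral_eq, enorm_norm]
  exact enorm_integral_le_lintegral_enorm _

/-- Uniform measure on the unit interval. -/
abbrev mu1 (d : ℕ) : ∀ _ : Fin d, Measure ℝ := fun _ => volume.restrict (Icc (0:ℝ) 1)

/-- Sum of absolute values of derivatives up to order `k`. -/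
def NN (d k : ℕ) (f : Ed d → ℝ) (y : Fin d → ℝ) : ℝ≥0∞ :=
  ∑ δ ∈ multiIdx d k, ‖pderivA d δ f (WithLp.toLp 2 y)‖ₑ

lemma NN_meas {d : ℕ} {f : Ed d → ℝ} (hf : Sm d f) (k : ℕ) : Measurable (NN d k f) := by
  unfold NN
  have := fun δ => (hf.pA δ).continuous
  refine Finset.measurable_sum _ fun δ _ => Continuous.measurable ?_
  have h1 := this δ
  fun_prop

lemma sum_shift_le {d k n : ℕ} (β : Fin d → ℕ) (h : k + ∑ i, β i ≤ n) (G : (Fin d → ℕ) → ℝ≥0∞) :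
    ∑ δ ∈ multiIdx d k, G (δ + β) ≤ ∑ δ ∈ multiIdx d n, G δ := by
  rw [← Finset.sum_image (f := G) (g := fun δ => δ + β) (by intro a _ b _ hab; simpa using hab)]
  apply Finset.sum_le_sum_of_subset
  intro δ hδ
  simp only [Finset.mem_image] at hδ
  obtain ⟨c, hc, rfl⟩ := hδ
  rw [mem_multiIdx] at *
  simp only [Pi.add_apply, Finset.sum_add_distrib]
  omega

lemma NN_pderivA_le {d : ℕ} {f : Ed d → ℝ} (hf : Sm d f) (k n : ℕ) (β : Fin d → ℕ)
    (h : k + ∑ i, β i ≤ n) : NN d k (pderivA d β f) ≤ NN d n f := by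
  intro y
  unfold NN
  simp_rw [pderivA_add hf]
  exact sum_shift_le β h (fun δ => ‖pderivA d δ f (WithLp.toLp 2 y)‖ₑ)

lemma aniso {d : ℕ} (S : Finset (Fin d)) : ∀ (f : Ed d → ℝ), Sm d f → ∀ x : Fin d → ℝ,
    (∀ i, x i ∈ Icc (0:ℝ) 1) →
    ‖f (WithLp.toLp 2 x)‖ₑ ≤ 2 ^ S.card * (lmarginal (mu1 d) S (NN d S.card f)) x := by
  induction S using Finset.induction_on with
  | empty =>
    intro f hf x hx
    simp only [Finset.card_empty, pow_zero, one_mul, lmarginal_empty]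
    unfold NN
    have : (0 : Fin d → ℕ) ∈ multiIdx d 0 := by rw [mem_multiIdx]; simp
    refine le_trans ?_ (Finset.single_le_sum (fun _ _ => zero_le) this)
    rw [pderivA_zero]
  | insert i S hi ih =>
    intro f hf x hx
    rw [lmarginal_insert _ (NN_meas hf _) hi, Finset.card_insert_of_notMem hi]
    have h1 : ∀ t ∈ Icc (0:ℝ) 1, ‖f (WithLp.toLp 2 x)‖ₑ ≤
        ‖f (WithLp.toLp 2 (Function.update x i t))‖ₑ +
        ∫⁻ s in Icc (0:ℝ) 1, ‖pderivI d i f (WithLp.toLp 2 (Function.update x i s))‖ₑ := by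
      intro t ht
      have hcont : Continuous fun s => pderivI d i f (WithLp.toLp 2 (Function.update x i s)) := by
        have := (hf.pI i).continuous
        fun_prop
      have := ftc_enorm (fun t => pderivI_eq_deriv hf i x t) hcont (x i) t
      rw [Function.update_eq_self] at this
      refine this.trans ?_
      gcongr
      refine (Set.uIoc_subset_uIcc).trans ?_
      exact (Set.uIcc_subset_Icc (hx i) ht)
    have h2 : ‖f (WithLp.toLp 2 x)‖ₑ ≤
        ∫⁻ t in Icc (0:ℝ) 1, (‖f (WithLp.toLp 2 (Function.update x i t))‖ₑ +
          ‖pderivI d i f (WithLp.toLp 2 (Function.update x i t))‖ₑ) := by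
      have hm : Measurable fun s => ‖f (WithLp.toLp 2 (Function.update x i s))‖ₑ := by
        have := hf.continuous
        apply Continuous.measurable
        fun_prop
      calc ‖f (WithLp.toLp 2 x)‖ₑ = ∫⁻ t in Icc (0:ℝ) 1, ‖f (WithLp.toLp 2 x)‖ₑ := by simp
        _ ≤ ∫⁻ t in Icc (0:ℝ) 1, (‖f (WithLp.toLp 2 (Function.update x i t))‖ₑ +
            ∫⁻ s in Icc (0:ℝ) 1, ‖pderivI d i f (WithLp.toLp 2 (Function.update x i s))‖ₑ) :=
          setLIntegral_mono' measurableSet_Icc h1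
        _ = _ := by
          rw [lintegral_add_left hm, lintegral_add_left hm]; simp
    refine h2.trans ?_
    rw [← lintegral_const_mul']
    swap
    · simp
    refine setLIntegral_mono' measurableSet_Icc fun t ht => ?_
    have hx' : ∀ j, Function.update x i t j ∈ Icc (0:ℝ) 1 := by
      intro j
      by_cases hj : j = i
      · subst hj; simpa using ht
      · simpa [hj] using hx j
    have a1 := ih f hf _ hx'
    have a2 := ih (pderivI d i f) (hf.pI i) _ hx'
    have b1 : NN d S.card f ≤ NN d (S.card + 1) f := by
      have := NN_pderivA_le hf S.card (S.card + 1) 0 (by simp)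
      rwa [pderivA_zero] at this
    have b2 : NN d S.card (pderivI d i f) ≤ NN d (S.card + 1) f := by
      have := NN_pderivA_le hf S.card (S.card + 1) (Pi.single i 1) (by simp)
      rwa [pderivA_single hf] at this
    calc _ ≤ 2 ^ S.card * (lmarginal (mu1 d) S (NN d (S.card + 1) f)) (Function.update x i t) +
          2 ^ S.card * (lmarginal (mu1 d) S (NN d (S.card + 1) f)) (Function.update x i t) := by
          refine add_le_add (a1.trans ?_) (a2.trans ?_)
          · gcongr; exact lmarginal_mono b1 _
          · gcongr; exact lmarginal_mono b2 _
      _ = _ := by ring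

/-- The unit cube. -/
def cube0 (d : ℕ) : Set (Ed d) := {x | ∀ i, x i ∈ Icc (0:ℝ) 1}

lemma lintegral_cube0 {d : ℕ} (G : Ed d → ℝ≥0∞) (hG : Measurable G) :
    ∫⁻ x in cube0 d, G x = ∫⁻ y, G (WithLp.toLp 2 y) ∂(Measure.pi (mu1 d)) := by
  have h := PiLp.volume_preserving_toLp (Fin d)
  have hc : (WithLp.toLp 2 : (Fin d → ℝ) → Ed d) ⁻¹' (cube0 d) = Set.pi univ fun _ => Icc (0:ℝ) 1 := by
    ext y; exact ⟨fun h i _ => h i, fun h i => h i (mem_univ i)⟩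
  have hm : MeasurableSet (cube0 d) := by
    have : cube0 d = ⋂ i, (fun x : Ed d => x i) ⁻¹' (Icc (0:ℝ) 1) := by
      ext x; simp [cube0]
    rw [this]
    refine MeasurableSet.iInter fun i => measurableSet_Icc.preimage ?_
    exact Continuous.measurable (by fun_prop)
  have h2 := h.setLIntegral_comp_preimage hm hG
  rw [← h2, hc]
  congr 1
  rw [volume_pi, Measure.restrict_pi_pi]

lemma marg_mul {d : ℕ} (S : Finset (Fin d)) (A B : (Fin d → ℝ) → ℝ≥0∞) (hA : Measurable A)
    (hB : Measurable B) :
    ∫⁻ x, lmarginal (mu1 d) S A x * lmarginal (mu1 d) Sᶜ B x ∂(Measure.pi (mu1 d)) =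
      (∫⁻ x, A x ∂(Measure.pi (mu1 d))) * ∫⁻ x, B x ∂(Measure.pi (mu1 d)) := by
  have hAm : Measurable (lmarginal (mu1 d) S A) := hA.lmarginal _
  have hBm : Measurable (lmarginal (mu1 d) Sᶜ B) := hB.lmarginal _
  have hun : (Finset.univ : Finset (Fin d)) = S ∪ Sᶜ := by simp
  have e0 : ∀ (G : (Fin d → ℝ) → ℝ≥0∞), Measurable G → ∀ x, ∫⁻ x, G x ∂(Measure.pi (mu1 d)) =
      lmarginal (mu1 d) S (lmarginal (mu1 d) Sᶜ G) x := by
    intro G hG x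
    rw [lintegral_eq_lmarginal_univ x, hun, lmarginal_union _ _ hG disjoint_compl_right]
  have e1 : ∀ (G : (Fin d → ℝ) → ℝ≥0∞), Measurable G → ∀ x, ∫⁻ x, G x ∂(Measure.pi (mu1 d)) =
      lmarginal (mu1 d) Sᶜ (lmarginal (mu1 d) S G) x := by
    intro G hG x
    rw [lintegral_eq_lmarginal_univ x, hun, lmarginal_union' _ _ hG disjoint_compl_right]
  have e2 : lmarginal (mu1 d) Sᶜ (fun x => lmarginal (mu1 d) S A x * lmarginal (mu1 d) Sᶜ B x) =
      fun x => (∫⁻ x, A x ∂(Measure.pi (mu1 d))) * lmarginal (mu1 d) Sᶜ B x := by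
    funext x
    rw [e1 A hA x]
    conv_lhs => unfold lmarginal
    have : ∀ y, lmarginal (mu1 d) Sᶜ B (Function.updateFinset x Sᶜ y) = lmarginal (mu1 d) Sᶜ B x := by
      intro y
      apply lmarginal_congr
      intro i hi
      simp [Function.updateFinset_def, hi]
    change ∫⁻ y, lmarginal (mu1 d) S A (Function.updateFinset x Sᶜ y) *
      lmarginal (mu1 d) Sᶜ B (Function.updateFinset x Sᶜ y) ∂_ = _
    simp_rw [this]
    rw [lintegral_mul_const]
    · rfl
    · exact hAm.comp measurable_updateFinset
  rw [e0 (fun x => lmarginal (mu1 d) S A x * lmarginal (mu1 d) Sᶜ B x) (hAm.mul hBm) 0, e0 B hB 0, e2]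
  conv_lhs => unfold lmarginal
  rw [lintegral_const_mul]
  · rfl
  · exact hBm.comp measurable_updateFinset

lemma lbe0_one {d m : ℕ} (hdm : d ≤ m) (β γ : Fin d → ℕ) (h : ∑ i, β i + ∑ i, γ i ≤ m)
    (f g : Ed d → ℝ) (hf : Sm d f) (hg : Sm d g) :
    ∫⁻ x in cube0 d, ‖pderivA d β f x‖ₑ * ‖pderivA d γ g x‖ₑ ≤
      2 ^ d * (∑ δ ∈ multiIdx d m, ∫⁻ x in cube0 d, ‖pderivA d δ f x‖ₑ) *
        (∑ δ ∈ multiIdx d m, ∫⁻ x in cube0 d, ‖pderivA d δ g x‖ₑ) := by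
  have hme : ∀ (f : Ed d → ℝ), Sm d f → ∀ δ, Measurable fun x => ‖pderivA d δ f x‖ₑ :=
    fun f hf δ => (hf.pA δ).continuous.enorm.measurable
  have hsum : ∀ (f : Ed d → ℝ), Sm d f → (∑ δ ∈ multiIdx d m, ∫⁻ x in cube0 d, ‖pderivA d δ f x‖ₑ) =
      ∫⁻ y, NN d m f y ∂(Measure.pi (mu1 d)) := by
    intro f hf
    unfold NN
    rw [lintegral_finsetSum]
    · exact Finset.sum_congr rfl fun δ _ => lintegral_cube0 _ (hme f hf δ)
    · intro δ _; exact (hme f hf δ).comp (by fun_prop)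
  rw [hsum f hf, hsum g hg, lintegral_cube0 (fun x => ‖pderivA d β f x‖ₑ * ‖pderivA d γ g x‖ₑ)
    ((hme f hf β).mul (hme g hg γ))]
  obtain ⟨S, -, hS⟩ := Finset.exists_subset_card_eq (s := (Finset.univ : Finset (Fin d)))
    (n := min d (m - ∑ i, β i)) (by simp)
  have hSc : Sᶜ.card = d - S.card := by rw [Finset.card_compl]; simp
  have hc1 : S.card + ∑ i, β i ≤ m := by omega
  have hc2 : Sᶜ.card + ∑ i, γ i ≤ m := by omega
  have hcd : S.card + Sᶜ.card = d := by omega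
  have hae : ∀ᵐ y ∂(Measure.pi (mu1 d)), ∀ i, y i ∈ Icc (0:ℝ) 1 := by
    have : Measure.pi (mu1 d) = (volume : Measure (Fin d → ℝ)).restrict (Set.pi univ fun _ => Icc (0:ℝ) 1) := by
      rw [volume_pi, Measure.restrict_pi_pi]
    rw [this]
    filter_upwards [ae_restrict_mem (MeasurableSet.univ_pi fun _ => measurableSet_Icc)] with y hy i
    exact hy i (mem_univ i)
  calc _ ≤ ∫⁻ y, 2 ^ d * (lmarginal (mu1 d) S (NN d m f) y * lmarginal (mu1 d) Sᶜ (NN d m g) y)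
        ∂(Measure.pi (mu1 d)) := by
        apply lintegral_mono_ae
        filter_upwards [hae] with y hy
        have a1 := aniso S _ (hf.pA β) y hy
        have a2 := aniso Sᶜ _ (hg.pA γ) y hy
        calc _ ≤ (2 ^ S.card * (lmarginal (mu1 d) S (NN d m f)) y) *
              (2 ^ Sᶜ.card * (lmarginal (mu1 d) Sᶜ (NN d m g)) y) := by
              refine mul_le_mul' (a1.trans ?_) (a2.trans ?_)
              · gcongr; exact lmarginal_mono (NN_pderivA_le hf _ _ _ hc1) _
              · gcongr; exact lmarginal_mono (NN_pderivA_le hg _ _ _ hc2) _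
          _ = 2 ^ (S.card + Sᶜ.card) * (lmarginal (mu1 d) S (NN d m f) y *
              lmarginal (mu1 d) Sᶜ (NN d m g) y) := by rw [pow_add]; ring
          _ = _ := by rw [hcd]
    _ = _ := by
      rw [lintegral_const_mul, marg_mul S _ _ (NN_meas hf m) (NN_meas hg m), mul_assoc]
      exact ((NN_meas hf m).lmarginal _).mul ((NN_meas hg m).lmarginal _)

lemma cube0_meas (d : ℕ) : MeasurableSet (cube0 d) := by
  have : cube0 d = ⋂ i, (fun x : Ed d => x i) ⁻¹' (Icc (0:ℝ) 1) := by
    ext x; simp [cube0]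
  rw [this]
  refine MeasurableSet.iInter fun i => measurableSet_Icc.preimage ?_
  exact Continuous.measurable (by fun_prop)

lemma cube0_vol (d : ℕ) : volume (cube0 d) = 1 := by
  have := lintegral_cube0 (d := d) (fun _ => 1) measurable_const
  simpa [Measure.pi_univ] using this

lemma cube0_conv {d : ℕ} {x y : Ed d} (hx : x ∈ cube0 d) (hy : y ∈ cube0 d) {t : ℝ} (h0 : 0 ≤ t)
    (h1 : t ≤ 1) : x + t • (y - x) ∈ cube0 d := by
  intro i
  have a := hx i
  have b := hy i
  simp only [PiLp.add_apply, PiLp.smul_apply, PiLp.sub_apply, smul_eq_mul, mem_Icc] at *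
  constructor <;> nlinarith

lemma lint_affine {d : ℕ} (F : Ed d → ℝ≥0∞) (b : Ed d) {c : ℝ} (hc : 0 < c) :
    ∫⁻ x, F (b + c • x) = ((ENNReal.ofReal c) ^ d)⁻¹ * ∫⁻ x, F x := by
  rw [← lintegral_add_left_eq_self F b]
  have hm := Measure.map_addHaar_smul (volume : Measure (Ed d)) hc.ne'
  have he : MeasurableEmbedding (fun x : Ed d => c • x) :=
    (Homeomorph.smulOfNeZero c hc.ne').measurableEmbedding
  have := he.lintegral_map (μ := volume) (fun x => F (b + x))
  rw [← this, hm, lintegral_smul_measure]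
  congr 1
  rw [finrank_euclideanSpace_fin, abs_of_pos (by positivity), ENNReal.ofReal_inv_of_pos (by positivity),
    ENNReal.ofReal_pow hc.le]

lemma lint_cv {d : ℕ} (P : Ed d → ℝ≥0∞) (b : Ed d) {c : ℝ} (hc : 0 < c)
    (h : ∀ x ∈ cube0 d, b + c • x ∈ cube0 d) :
    ∫⁻ x in cube0 d, P (b + c • x) ≤ ((ENNReal.ofReal c) ^ d)⁻¹ * ∫⁻ x in cube0 d, P x := by
  rw [← lintegral_indicator (cube0_meas d) P, ← lint_affine _ b hc, ← lintegral_indicator (cube0_meas d)]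
  apply lintegral_mono
  intro x
  by_cases hx : x ∈ cube0 d
  · simp [hx, h x hx]
  · simp [hx]

/-- Average over contracted cubes. -/
def AvT (d : ℕ) (P : Ed d → ℝ≥0∞) (t : ℝ) (x : Ed d) : ℝ≥0∞ :=
  ∫⁻ y in cube0 d, P (x + t • (y - x))

lemma AvT_meas {d : ℕ} {P : Ed d → ℝ≥0∞} (hP : Measurable P) :
    Measurable fun q : ℝ × Ed d => AvT d P q.1 q.2 := by
  unfold AvT
  apply Measurable.lintegral_prod_right' (f := fun z : (ℝ × Ed d) × Ed d => P (z.1.2 + z.1.1 • (z.2 - z.1.2)))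
  exact hP.comp (by fun_prop)

lemma AvT_one {d : ℕ} (P : Ed d → ℝ≥0∞) (x : Ed d) : AvT d P 1 x = ∫⁻ y in cube0 d, P y := by
  simp [AvT]

lemma AvT_zero {d : ℕ} (P : Ed d → ℝ≥0∞) (x : Ed d) : AvT d P 0 x = P x := by
  simp [AvT, cube0_vol]

lemma AvT_sup {d : ℕ} (P : Ed d → ℝ≥0∞) {t : ℝ} (h0 : 0 < t) (h1 : t ≤ 1) {x : Ed d}
    (hx : x ∈ cube0 d) : AvT d P t x ≤ ((ENNReal.ofReal t) ^ d)⁻¹ * ∫⁻ x in cube0 d, P x := by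
  have e : ∀ y : Ed d, x + t • (y - x) = (x - t • x) + t • y := by
    intro y; rw [smul_sub]; abel
  unfold AvT
  simp_rw [e]
  apply lint_cv _ _ h0
  intro y hy
  rw [← e]
  exact cube0_conv hx hy h0.le h1

lemma AvT_L1 {d : ℕ} (P : Ed d → ℝ≥0∞) (hP : Measurable P) {t : ℝ} (h0 : 0 ≤ t) (h1 : t ≤ 1) :
    ∫⁻ x in cube0 d, AvT d P t x ≤ 2 ^ d * ∫⁻ x in cube0 d, P x := by
  have key : ∀ c : ℝ, 1/2 ≤ c → ((ENNReal.ofReal c) ^ d)⁻¹ ≤ 2 ^ d := by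
    intro c hc
    rw [ENNReal.inv_pow]
    gcongr
    rw [ENNReal.inv_le_iff_inv_le]
    rw [show (2:ℝ≥0∞)⁻¹ = ENNReal.ofReal (1/2) by
      rw [one_div, ENNReal.ofReal_inv_of_pos (by norm_num)]; norm_num]
    exact ENNReal.ofReal_le_ofReal hc
  rcases le_total (1/2) t with h | h
  · calc _ ≤ ∫⁻ x in cube0 d, 2 ^ d * ∫⁻ x in cube0 d, P x := by
          refine setLIntegral_mono' (cube0_meas d) fun x hx => ?_
          refine (AvT_sup P (by linarith) h1 hx).trans ?_
          gcongr
          exact key t h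
      _ = _ := by simp [cube0_vol]
  · unfold AvT
    rw [lintegral_lintegral_swap]
    swap
    · apply Measurable.aemeasurable
      exact hP.comp (by fun_prop)
    calc _ ≤ ∫⁻ y in cube0 d, 2 ^ d * ∫⁻ x in cube0 d, P x := by
          refine setLIntegral_mono' (cube0_meas d) fun y hy => ?_
          have e : ∀ x : Ed d, x + t • (y - x) = t • y + (1 - t) • x := by
            intro x; rw [smul_sub, sub_smul, one_smul]; abel
          have hh : ∀ x ∈ cube0 d, t • y + (1 - t) • x ∈ cube0 d := fun x hx => by
            rw [← e]; exact cube0_conv hx hy h0 h1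
          simp_rw [e]
          refine (lint_cv P _ (by linarith) hh).trans ?_
          gcongr
          exact key _ (by linarith)
      _ = _ := by simp [cube0_vol]

/-- Combined bound. -/
lemma AvT_prod {d : ℕ} (P R : Ed d → ℝ≥0∞) (hP : Measurable P) (hR : Measurable R) {t τ : ℝ}
    (h0 : 0 ≤ t) (h1 : t ≤ 1) (k0 : 0 ≤ τ) (k1 : τ ≤ 1) (hpos : 0 < t ∨ 0 < τ) {e1 e2 : ℝ}
    (he1 : 0 ≤ e1) (he2 : 0 ≤ e2) (he : e1 + e2 = d) :
    ∫⁻ x in cube0 d, AvT d P t x * AvT d R τ x ≤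
      (ENNReal.ofReal t) ^ (-e1) * (ENNReal.ofReal τ) ^ (-e2) *
        (2 ^ d * (∫⁻ x in cube0 d, P x) * (∫⁻ x in cube0 d, R x)) := by
  wlog hle : τ ≤ t generalizing P R t τ e1 e2
  · have := this R P hR hP k0 k1 h0 h1 hpos.symm he2 he1 (by linarith) (by linarith)
    simp_rw [mul_comm (AvT d P t _)]
    refine this.trans (le_of_eq ?_)
    ring
  have ht : 0 < t := by rcases hpos with h | h <;> linarith
  have hmR : Measurable fun x => AvT d R τ x := (AvT_meas hR).comp (by fun_prop : Measurable fun x : Ed d => (τ, x))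
  calc _ ≤ ∫⁻ x in cube0 d, (((ENNReal.ofReal t) ^ d)⁻¹ * ∫⁻ x in cube0 d, P x) * AvT d R τ x := by
        refine setLIntegral_mono' (cube0_meas d) fun x hx => ?_
        gcongr
        exact AvT_sup P ht h1 hx
    _ = (((ENNReal.ofReal t) ^ d)⁻¹ * ∫⁻ x in cube0 d, P x) * ∫⁻ x in cube0 d, AvT d R τ x := by
        rw [lintegral_const_mul _ hmR]
    _ ≤ ((ENNReal.ofReal t) ^ (-e1) * (ENNReal.ofReal τ) ^ (-e2) * ∫⁻ x in cube0 d, P x) *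
          (2 ^ d * ∫⁻ x in cube0 d, R x) := by
        gcongr
        · have : ((ENNReal.ofReal t) ^ d)⁻¹ = (ENNReal.ofReal t) ^ (-e1) * (ENNReal.ofReal t) ^ (-e2) := by
            rw [← ENNReal.rpow_add _ _ (by simpa using ht) (by simp), ← ENNReal.rpow_natCast, ← ENNReal.rpow_neg]
            congr 1; linarith
          rw [this]
          refine mul_le_mul' le_rfl ?_
          rw [ENNReal.rpow_neg, ENNReal.rpow_neg]
          gcongr
        · exact AvT_L1 R hR k0 k1
    _ = _ := by ring

/-- Iterated sums of absolute values of derivatives. -/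
def MM (d : ℕ) : ℕ → (Ed d → ℝ) → Ed d → ℝ≥0∞
  | 0, F, x => ‖F x‖ₑ
  | k + 1, F, x => ∑ i, MM d k (pderivI d i F) x

lemma MM_cont {d : ℕ} (k : ℕ) : ∀ {F : Ed d → ℝ}, Sm d F → Continuous (MM d k F) := by
  induction k with
  | zero => intro F hF; exact hF.continuous.enorm
  | succ k ih =>
    intro F hF
    have : MM d (k+1) F = fun x => ∑ i, MM d k (pderivI d i F) x := by funext x; rfl
    rw [this]
    exact continuous_finsetSum _ fun i _ => ih (hF.pI i)

lemma line_deriv {d : ℕ} {F : Ed d → ℝ} (hF : Sm d F) (x y : Ed d) (t : ℝ) :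
    HasDerivAt (fun s : ℝ => F (x + s • (y - x))) (∑ i, (y i - x i) * pderivI d i F (x + t • (y - x))) t := by
  have h1 : HasDerivAt (fun s : ℝ => x + s • (y - x)) (y - x) t := by
    simpa using ((hasDerivAt_id t).smul_const (y - x)).const_add x
  have h2 := (hF.differentiable (x + t • (y - x))).hasFDerivAt.comp_hasDerivAt t h1
  have : y - x = ∑ i, (y i - x i) • (EuclideanSpace.single i (1:ℝ) : Ed d) := by
    ext j
    simp [Finset.sum_apply, Pi.single_apply]
  have h3 : (fderiv ℝ F (x + t • (y - x))) (y - x) =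
      ∑ i, (y i - x i) * pderivI d i F (x + t • (y - x)) := by
    generalize x + t • (y - x) = w
    rw [this, map_sum]
    simp [pderivI]
  rw [h3] at h2
  exact h2

lemma MM_basic {d : ℕ} (k : ℕ) : ∀ {F : Ed d → ℝ}, Sm d F → ∀ {x y : Ed d}, x ∈ cube0 d → y ∈ cube0 d →
    ∀ {a : ℝ}, a ≤ 1 → MM d k F (x + a • (y - x)) ≤
      MM d k F y + ∫⁻ s in Ioc a 1, MM d (k+1) F (x + s • (y - x)) := by
  induction k with
  | zero =>
    intro F hF x y hx hy a ha
    have hc : Continuous fun t : ℝ => ∑ i, (y i - x i) * pderivI d i F (x + t • (y - x)) := by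
      have := fun i => (hF.pI i).continuous
      fun_prop
    have := ftc_enorm (fun t => line_deriv hF x y t) hc a 1
    rw [Set.uIoc_of_le ha] at this
    simp only [one_smul, add_sub_cancel] at this
    refine this.trans ?_
    simp only [MM]
    gcongr with s
    refine (enorm_sum_le _ _).trans ?_
    gcongr with i
    rw [enorm_mul]
    have h1 : ‖y i - x i‖ₑ ≤ 1 := by
      have a := hx i
      have b := hy i
      rw [Real.enorm_eq_ofReal_abs]
      rw [← ENNReal.ofReal_one]
      apply ENNReal.ofReal_le_ofReal
      rw [abs_le]; constructor <;> linarith [a.1, a.2, b.1, b.2]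
    calc _ ≤ 1 * _ := mul_le_mul' h1 le_rfl
      _ = _ := one_mul _
  | succ k ih =>
    intro F hF x y hx hy a ha
    have e : ∀ z, MM d (k+2) F z = ∑ i, MM d (k+1) (pderivI d i F) z := fun z => rfl
    have e1 : ∀ z, MM d (k+1) F z = ∑ i, MM d k (pderivI d i F) z := fun z => rfl
    simp_rw [e]
    rw [e1, e1, lintegral_finsetSum, ← Finset.sum_add_distrib]
    · exact Finset.sum_le_sum fun i _ => ih (hF.pI i) hx hy ha
    · intro i _
      have := MM_cont (k+1) (hF.pI i)
      exact Continuous.measurable (by fun_prop)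

lemma taylor {d : ℕ} (K : ℕ) {F : Ed d → ℝ} (hF : Sm d F) {x y : Ed d} (hx : x ∈ cube0 d)
    (hy : y ∈ cube0 d) : ‖F x‖ₑ ≤ ∑ j ∈ Finset.range (K+1), MM d j F y +
      ∫⁻ t in Ioc (0:ℝ) 1, (ENNReal.ofReal t) ^ K * MM d (K+1) F (x + t • (y - x)) := by
  induction K with
  | zero =>
    have := MM_basic 0 hF hx hy (a := 0) (by norm_num)
    simpa [MM] using this
  | succ K ih =>
    refine ih.trans ?_
    rw [Finset.sum_range_succ _ (K+1), add_assoc]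
    gcongr
    set H : ℝ → ℝ≥0∞ := fun s => MM d (K+2) F (x + s • (y - x)) with hH
    have hHm : Measurable H := by
      have := MM_cont (K+2) hF
      exact Continuous.measurable (by fun_prop)
    calc _ ≤ ∫⁻ t in Ioc (0:ℝ) 1, ((MM d (K+1) F y) + (ENNReal.ofReal t) ^ K * ∫⁻ s in Ioc t 1, H s) := by
          refine setLIntegral_mono' measurableSet_Ioc fun t ht => ?_
          calc _ ≤ (ENNReal.ofReal t) ^ K * (MM d (K+1) F y + ∫⁻ s in Ioc t 1, H s) := by
                gcongr; exact MM_basic (K+1) hF hx hy ht.2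
            _ ≤ _ := by
              rw [mul_add]
              gcongr
              calc _ ≤ 1 * MM d (K+1) F y := by
                    gcongr
                    apply pow_le_one'
                    rw [← ENNReal.ofReal_one]
                    exact ENNReal.ofReal_le_ofReal ht.2
                _ = _ := one_mul _
      _ = MM d (K+1) F y + ∫⁻ t in Ioc (0:ℝ) 1, (ENNReal.ofReal t) ^ K * ∫⁻ s in Ioc t 1, H s := by
          rw [lintegral_add_left measurable_const]; simp
      _ ≤ _ := by
        refine add_le_add le_rfl ?_
        have e : ∀ t ∈ Ioc (0:ℝ) 1, (ENNReal.ofReal t) ^ K * ∫⁻ s in Ioc t 1, H s =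
            ∫⁻ s in Ioc (0:ℝ) 1, (Iio s).indicator (fun t => (ENNReal.ofReal t) ^ K) t * H s := by
          intro t ht
          rw [← lintegral_const_mul _ hHm, ← lintegral_indicator measurableSet_Ioc, ← lintegral_indicator measurableSet_Ioc]
          congr 1
          funext s
          by_cases h1 : s ∈ Ioc t 1
          · have : s ∈ Ioc (0:ℝ) 1 := ⟨ht.1.trans h1.1, h1.2⟩
            simp [h1, this, h1.1]
          · by_cases h2 : s ∈ Ioc (0:ℝ) 1
            · have : ¬ t < s := fun h => h1 ⟨h, h2.2⟩
              simp [h1, h2, this]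
            · simp [h1, h2]
        rw [setLIntegral_congr_fun measurableSet_Ioc e, lintegral_lintegral_swap]
        · refine setLIntegral_mono' measurableSet_Ioc fun s hs => ?_
          rw [lintegral_mul_const'']
          · change _ ≤ _ * H s
            gcongr
            calc ∫⁻ t in Ioc (0:ℝ) 1, (Iio s).indicator (fun t => (ENNReal.ofReal t) ^ K) t
                ≤ ∫⁻ t, (Ioo 0 s).indicator (fun t => (ENNReal.ofReal s) ^ K) t := by
                  rw [← lintegral_indicator measurableSet_Ioc]
                  apply lintegral_mono
                  intro t
                  by_cases h1 : t ∈ Ioc (0:ℝ) 1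
                  · by_cases h2 : t < s
                    · simp only [h1, indicator_of_mem, mem_Iio, h2, mem_Ioo, h1.1, and_self]
                      gcongr
                    · simp [h1, h2]
                  · simp [h1]
              _ = _ := by
                rw [lintegral_indicator measurableSet_Ioo]
                simp [pow_succ]
          · apply Measurable.aemeasurable
            exact Measurable.indicator (by fun_prop) measurableSet_Iio
        · apply Measurable.aemeasurable
          have : (Function.uncurry fun t s => (Iio s).indicator (fun t => (ENNReal.ofReal t) ^ K) t * H s) =
            fun q : ℝ × ℝ => {q : ℝ × ℝ | q.1 < q.2}.indicator (fun q => (ENNReal.ofReal q.1) ^ K) q * H q.2 := by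
            funext q
            rcases q with ⟨t, s⟩
            simp only [Function.uncurry]
            congr 1
          rw [this]
          refine Measurable.mul (Measurable.indicator (by fun_prop) ?_) (hHm.comp measurable_snd)
          exact measurableSet_lt measurable_fst measurable_snd

/-- Sum of `p`-th powers of derivatives. -/
def PP (d m : ℕ) (p : ℝ) (f : Ed d → ℝ) (x : Ed d) : ℝ≥0∞ := ∑ δ ∈ multiIdx d m, ‖pderivA d δ f x‖ₑ ^ p

lemma PP_meas {d : ℕ} {f : Ed d → ℝ} (hf : Sm d f) (m : ℕ) (p : ℝ) : Measurable (PP d m p f) := by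
  unfold PP
  exact Finset.measurable_sum _ fun δ _ => ((hf.pA δ).continuous.enorm.measurable).pow_const p

lemma MM_le_NN {d : ℕ} (j : ℕ) : ∀ {F : Ed d → ℝ}, Sm d F → ∀ z, MM d j F z ≤ d ^ j * NN d j F z.ofLp := by
  induction j with
  | zero =>
    intro F hF z
    simp only [MM, pow_zero, one_mul, NN]
    have : (0 : Fin d → ℕ) ∈ multiIdx d 0 := by rw [mem_multiIdx]; simp
    refine le_trans ?_ (Finset.single_le_sum (fun _ _ => zero_le) this)
    rw [pderivA_zero]
  | succ j ih =>
    intro F hF z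
    simp only [MM]
    calc _ ≤ ∑ i : Fin d, (d:ℝ≥0∞) ^ j * NN d (j+1) F z.ofLp := by
          refine Finset.sum_le_sum fun i _ => (ih (hF.pI i) z).trans ?_
          gcongr
          have := NN_pderivA_le hF j (j + 1) (Pi.single i 1) (by simp)
          rw [pderivA_single hF] at this
          exact this _
      _ = _ := by simp [pow_succ]; ring

lemma MM_pow_le {d : ℕ} (p : ℝ) (hp : 1 ≤ p) (j k : ℕ) (hjk : j ≤ k) : ∃ C : ℝ≥0∞, C ≠ ⊤ ∧
    ∀ {F : Ed d → ℝ}, Sm d F → ∀ z, MM d j F z ^ p ≤ C * PP d k p F z := by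
  refine ⟨(d ^ j : ℝ≥0∞) ^ p * ((multiIdx d k).card : ℝ≥0∞) ^ (p - 1), ?_, ?_⟩
  · refine ENNReal.mul_ne_top (ENNReal.rpow_ne_top_of_nonneg (by linarith) (by finiteness))
      (ENNReal.rpow_ne_top_of_nonneg (by linarith) (by finiteness))
  · intro F hF z
    have h1 : MM d j F z ≤ d ^ j * NN d k F z.ofLp := by
      refine (MM_le_NN j hF z).trans ?_
      gcongr
      have := NN_pderivA_le hF j k 0 (by simpa using hjk)
      rw [pderivA_zero] at this
      exact this _
    calc _ ≤ (d ^ j * NN d k F z.ofLp) ^ p := by gcongr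
      _ = (d ^ j : ℝ≥0∞) ^ p * (NN d k F z.ofLp) ^ p := ENNReal.mul_rpow_of_nonneg _ _ (by linarith)
      _ ≤ _ := by
        rw [mul_assoc]
        gcongr
        exact ENNReal.rpow_sum_le_const_mul_sum_rpow _ _ hp

lemma lint_pow_fin {r : ℝ} (hr : -1 < r) : ∫⁻ t in Ioc (0:ℝ) 1, (ENNReal.ofReal t) ^ r ≠ ⊤ := by
  have h := intervalIntegral.intervalIntegrable_rpow' (a := 0) (b := 1) hr
  rw [intervalIntegrable_iff_integrableOn_Ioc_of_le (by norm_num)] at h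
  have h2 := h.lintegral_lt_top
  have : ∫⁻ t in Ioc (0:ℝ) 1, (ENNReal.ofReal t) ^ r = ∫⁻ t in Ioc (0:ℝ) 1, ENNReal.ofReal (t ^ r) := by
    refine setLIntegral_congr_fun measurableSet_Ioc fun t ht => ?_
    exact ENNReal.ofReal_rpow_of_pos ht.1
  rw [this]
  exact h2.ne

lemma holder_pow {p : ℝ} (hp : 1 < p) (K : ℕ) {s : ℝ} (hs : s < (K + 1) * p) : ∃ C : ℝ≥0∞, C ≠ ⊤ ∧
    ∀ H : ℝ → ℝ≥0∞, Measurable H →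
      (∫⁻ t in Ioc (0:ℝ) 1, (ENNReal.ofReal t) ^ K * H t) ^ p ≤
        C * ∫⁻ t in Ioc (0:ℝ) 1, (ENNReal.ofReal t) ^ (s - 1) * H t ^ p := by
  have hc := Real.HolderConjugate.conjExponent hp
  set q := p.conjExponent with hq
  have hp0 : (0:ℝ) < p := by linarith
  have hq0 : (0:ℝ) < q := hc.symm.pos
  refine ⟨(∫⁻ t in Ioc (0:ℝ) 1, (ENNReal.ofReal t) ^ ((K - (s - 1) / p) * q)) ^ (p / q), ?_, ?_⟩
  · apply ENNReal.rpow_ne_top_of_nonneg (by positivity)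
    apply lint_pow_fin
    have h1 : 1 / p + 1 / q = 1 := by simpa using hc.inv_add_inv_eq_one
    have h2 : q * (1 / p) + 1 = q := by
      have : q * (1/p + 1/q) = q := by rw [h1, mul_one]
      rw [mul_add] at this
      rwa [mul_one_div_cancel hq0.ne'] at this
    have h3 : s / p < K + 1 := by rw [div_lt_iff₀ hp0]; exact hs
    have h4 : (K - (s - 1) / p) * q = (K + 1 - s / p) * q - 1 := by
      rw [sub_div]; linear_combination h2
    rw [h4]
    nlinarith
  · intro H hH
    have e : ∀ t ∈ Ioc (0:ℝ) 1, (ENNReal.ofReal t) ^ K * H t =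
      (ENNReal.ofReal t) ^ ((K:ℝ) - (s - 1) / p) * ((ENNReal.ofReal t) ^ ((s - 1) / p) * H t) := by
      intro t ht
      rw [← mul_assoc, ← ENNReal.rpow_add _ _ (by simpa using ht.1) (by simp), sub_add_cancel, ENNReal.rpow_natCast]
    rw [setLIntegral_congr_fun measurableSet_Ioc e]
    have hA : Measurable fun t : ℝ => (ENNReal.ofReal t) ^ ((K:ℝ) - (s - 1) / p) :=
      ENNReal.measurable_ofReal.pow_const _
    have hB : Measurable fun t : ℝ => (ENNReal.ofReal t) ^ ((s - 1) / p) * H t :=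
      (ENNReal.measurable_ofReal.pow_const _).mul hH
    have := ENNReal.lintegral_mul_le_Lp_mul_Lq (volume.restrict (Ioc (0:ℝ) 1)) hc.symm hA.aemeasurable hB.aemeasurable
    simp only [Pi.mul_apply] at this
    calc _ ≤ _ := ENNReal.rpow_le_rpow this hp0.le
      _ = _ := by
        rw [ENNReal.mul_rpow_of_nonneg _ _ hp0.le, ← ENNReal.rpow_mul, ← ENNReal.rpow_mul]
        rw [one_div_mul_cancel hp0.ne', ENNReal.rpow_one]
        simp_rw [← ENNReal.rpow_mul, ENNReal.mul_rpow_of_nonneg _ _ hp0.le, ← ENNReal.rpow_mul]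
        rw [div_mul_cancel₀ _ hp0.ne']
        congr 2
        ring

lemma AvT_meas_t {d : ℕ} {P : Ed d → ℝ≥0∞} (hP : Measurable P) (x : Ed d) :
    Measurable fun t => AvT d P t x :=
  (AvT_meas hP).comp (by fun_prop : Measurable fun t : ℝ => (t, x))

lemma AvT_meas_2 {d : ℕ} {P R : Ed d → ℝ≥0∞} (hP : Measurable P) (hR : Measurable R) :
    Measurable fun q : Ed d × ℝ × ℝ => AvT d P q.2.1 q.1 * AvT d R q.2.2 q.1 :=
  ((AvT_meas hP).comp (f := fun q : Ed d × ℝ × ℝ => (q.2.1, q.1)) (by fun_prop)).mul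
      ((AvT_meas hR).comp (f := fun q : Ed d × ℝ × ℝ => (q.2.2, q.1)) (by fun_prop))

lemma PP_shift {d m k : ℕ} {p : ℝ} {f : Ed d → ℝ} (hf : Sm d f) (β : Fin d → ℕ)
    (h : k + ∑ i, β i ≤ m) (x : Ed d) : PP d k p (pderivA d β f) x ≤ PP d m p f x := by
  unfold PP
  simp_rw [pderivA_add hf]
  exact sum_shift_le β h (fun δ => ‖pderivA d δ f x‖ₑ ^ p)

lemma le_PP {d m : ℕ} {p : ℝ} (f : Ed d → ℝ) (β : Fin d → ℕ)
    (h : ∑ i, β i ≤ m) (x : Ed d) : ‖pderivA d β f x‖ₑ ^ p ≤ PP d m p f x := by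
  unfold PP
  exact Finset.single_le_sum (f := fun δ => ‖pderivA d δ f x‖ₑ ^ p) (fun _ _ => zero_le)
    (mem_multiIdx.2 h)

lemma rep_pt {d : ℕ} {p : ℝ} (hp : 1 < p) (K : ℕ) {s : ℝ} (hs : s < (K + 1) * p) :
    ∃ C : ℝ≥0∞, C ≠ ⊤ ∧ ∀ F : Ed d → ℝ, Sm d F → ∀ x ∈ cube0 d, ∀ y ∈ cube0 d,
      ‖F x‖ₑ ^ p ≤ C * (PP d (K+1) p F y + ∫⁻ t in Ioc (0:ℝ) 1, (ENNReal.ofReal t) ^ (s - 1) *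
        PP d (K+1) p F (x + t • (y - x))) := by
  have hp0 : 0 ≤ p := by linarith
  choose! c hc1 hc2 using fun j (hj : j ≤ K + 1) => MM_pow_le (d := d) p hp.le j (K+1) hj
  obtain ⟨C2, hC2, hH⟩ := holder_pow hp K hs
  set A : ℝ≥0∞ := ((Finset.range (K+1)).card : ℝ≥0∞) ^ (p - 1) * ∑ j ∈ Finset.range (K+1), c j with hA
  set B : ℝ≥0∞ := C2 * c (K+1) with hB
  have hAt : A ≠ ⊤ := by
    refine ENNReal.mul_ne_top (ENNReal.rpow_ne_top_of_nonneg (by linarith) (by finiteness)) ?_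
    rw [ENNReal.sum_ne_top]
    intro j hj
    exact hc1 j (by simp at hj; omega)
  have hBt : B ≠ ⊤ := ENNReal.mul_ne_top hC2 (hc1 _ le_rfl)
  have h2t : (2:ℝ≥0∞) ^ (p-1) ≠ ⊤ := ENNReal.rpow_ne_top_of_nonneg (by linarith) (by finiteness)
  refine ⟨2 ^ (p-1) * (A + B), ENNReal.mul_ne_top h2t (by simp [hAt, hBt]), ?_⟩
  intro F hF x hx y hy
  have hline : Measurable fun t : ℝ => PP d (K+1) p F (x + t • (y - x)) :=
    (PP_meas hF _ _).comp (Continuous.measurable (by fun_prop))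
  have h1 : (∑ j ∈ Finset.range (K+1), MM d j F y) ^ p ≤ A * PP d (K+1) p F y := by
    refine (ENNReal.rpow_sum_le_const_mul_sum_rpow _ _ hp.le).trans ?_
    rw [hA, mul_assoc, Finset.sum_mul]
    gcongr with j hj
    exact hc2 j (by simp at hj; omega) hF y
  have h2 : (∫⁻ t in Ioc (0:ℝ) 1, (ENNReal.ofReal t) ^ K * MM d (K+1) F (x + t • (y - x))) ^ p ≤
      B * ∫⁻ t in Ioc (0:ℝ) 1, (ENNReal.ofReal t) ^ (s - 1) * PP d (K+1) p F (x + t • (y - x)) := by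
    have hm : Measurable fun t : ℝ => MM d (K+1) F (x + t • (y - x)) := by
      have := MM_cont (K+1) hF
      exact Continuous.measurable (by fun_prop)
    refine (hH _ hm).trans ?_
    rw [hB, mul_assoc, ← lintegral_const_mul' (c (K+1)) _ (hc1 _ le_rfl)]
    · refine mul_le_mul' le_rfl (lintegral_mono fun t => ?_)
      calc _ ≤ ENNReal.ofReal t ^ (s-1) * (c (K+1) * PP d (K+1) p F (x + t • (y - x))) := by
            gcongr
            exact hc2 _ le_rfl hF _
        _ = _ := by ring
  calc _ ≤ _ := ENNReal.rpow_le_rpow (taylor K hF hx hy) hp0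
    _ ≤ _ := ENNReal.rpow_add_le_mul_rpow_add_rpow _ _ hp.le
    _ ≤ 2 ^ (p-1) * (A * PP d (K+1) p F y + B * ∫⁻ t in Ioc (0:ℝ) 1, (ENNReal.ofReal t) ^ (s - 1) *
        PP d (K+1) p F (x + t • (y - x))) := by gcongr
    _ ≤ 2 ^ (p-1) * ((A + B) * PP d (K+1) p F y + (A + B) * ∫⁻ t in Ioc (0:ℝ) 1, (ENNReal.ofReal t) ^ (s - 1) *
        PP d (K+1) p F (x + t • (y - x))) := by
        gcongr
        · exact le_self_add
        · exact le_add_self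
    _ = _ := by ring

lemma rep {d m : ℕ} {p : ℝ} (hp : 1 < p) (β : Fin d → ℕ) {e : ℝ} (he : 0 ≤ e) (k : ℕ)
    (hk : k + ∑ i, β i = m) (hk0 : k = 0 → e = 0) (hk1 : 0 < k → e < k * p) :
    ∃ ν : Measure ℝ, SFinite ν ∧ (∀ᵐ t ∂ν, t ∈ Icc (0:ℝ) 1 ∧ (0 < k → 0 < t)) ∧
      ∫⁻ t, (ENNReal.ofReal t) ^ (-e) ∂ν ≠ ⊤ ∧ ∃ C : ℝ≥0∞, C ≠ ⊤ ∧ ∀ f, Sm d f → ∀ x ∈ cube0 d,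
        ‖pderivA d β f x‖ₑ ^ p ≤ C * ∫⁻ t, AvT d (PP d m p f) t x ∂ν := by
  rcases k with _ | K
  · refine ⟨Measure.dirac 0, inferInstance, ?_, ?_, 1, by simp, ?_⟩
    · rw [ae_dirac_eq]; simp
    · rw [lintegral_dirac]; simp [hk0 rfl]
    · intro f hf x hx
      rw [lintegral_dirac, AvT_zero, one_mul]
      exact le_PP f β (by omega) x
  · have hKp := hk1 (by omega)
    set s : ℝ := (e + (K+1) * p) / 2 with hs
    push_cast at hKp
    have hs1 : s < (K+1) * p := by rw [hs]; linarith
    have hs2 : e < s := by rw [hs]; linarith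
    obtain ⟨C, hC, hrep⟩ := rep_pt (d := d) hp K hs1
    have hw : Measurable fun t : ℝ => (ENNReal.ofReal t) ^ (s - 1) := ENNReal.measurable_ofReal.pow_const _
    set ν1 := (volume.restrict (Ioc (0:ℝ) 1)).withDensity (fun t : ℝ => (ENNReal.ofReal t) ^ (s - 1)) with hν1
    have hsf : SFinite ν1 := by rw [hν1]; infer_instance
    have hν : ∀ G : ℝ → ℝ≥0∞, Measurable G → ∫⁻ t, G t ∂ν1 =
        ∫⁻ t in Ioc (0:ℝ) 1, (ENNReal.ofReal t) ^ (s - 1) * G t := by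
      intro G hG
      rw [hν1, lintegral_withDensity_eq_lintegral_mul _ hw hG]
      rfl
    have hνae : ∀ᵐ t ∂ν1, t ∈ Ioc (0:ℝ) 1 := by
      apply withDensity_absolutelyContinuous _ _
      exact ae_restrict_mem measurableSet_Ioc
    clear_value ν1
    refine ⟨ν1 + Measure.dirac 1, inferInstance, ?_, ?_, C, hC, ?_⟩
    · rw [ae_add_measure_iff]
      constructor
      · filter_upwards [hνae] with t ht
        exact ⟨⟨ht.1.le, ht.2⟩, fun _ => ht.1⟩
      · rw [ae_dirac_eq]; simp
    · rw [lintegral_add_measure, lintegral_dirac, hν _ (ENNReal.measurable_ofReal.pow_const _)]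
      simp only [ENNReal.ofReal_one, ENNReal.one_rpow]
      rw [ENNReal.add_ne_top]
      refine ⟨?_, by simp⟩
      have : ∫⁻ t in Ioc (0:ℝ) 1, (ENNReal.ofReal t) ^ (s - 1) * (ENNReal.ofReal t) ^ (-e) =
          ∫⁻ t in Ioc (0:ℝ) 1, (ENNReal.ofReal t) ^ (s - 1 + -e) := by
        refine setLIntegral_congr_fun measurableSet_Ioc fun t ht => ?_
        exact (ENNReal.rpow_add _ _ (by simpa using ht.1) (by simp)).symm
      rw [this]
      exact lint_pow_fin (by linarith)
    · intro f hf x hx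
      have hPm := PP_meas hf m p
      have hAm : Measurable fun t : ℝ => AvT d (PP d m p f) t x :=
        AvT_meas_t hPm x
      rw [lintegral_add_measure, lintegral_dirac, hν _ hAm, AvT_one, add_comm]
      have hJ : Measurable fun q : Ed d × ℝ => (ENNReal.ofReal q.2) ^ (s - 1) *
            PP d m p f (x + q.2 • (q.1 - x)) := by
        refine (hw.comp measurable_snd).mul (hPm.comp ?_)
        exact Continuous.measurable (by fun_prop)
      calc _ = ∫⁻ y in cube0 d, ‖pderivA d β f x‖ₑ ^ p := by simp [cube0_vol]
        _ ≤ ∫⁻ y in cube0 d, C * (PP d m p f y + ∫⁻ t in Ioc (0:ℝ) 1, (ENNReal.ofReal t) ^ (s - 1) *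
            PP d m p f (x + t • (y - x))) := by
            refine setLIntegral_mono' (cube0_meas d) fun y hy => (hrep _ (hf.pA β) x hx y hy).trans ?_
            gcongr
            · exact PP_shift hf β (by omega) _
            · exact PP_shift hf β (by omega) _
        _ = _ := by
            rw [lintegral_const_mul' _ _ hC, lintegral_add_left hPm, lintegral_lintegral_swap]
            · congr 2
              refine lintegral_congr fun t => ?_
              unfold AvT
              rw [lintegral_const_mul]
              exact hPm.comp (Continuous.measurable (by fun_prop))
            · exact hJ.aemeasurable

set_option maxHeartbeats 1000000 in
lemma lbe0_gt {d m : ℕ} {p : ℝ} (hm : 1 ≤ m) (hp : 1 < p) (hdm : (d : ℝ) / p < m) (β γ : Fin d → ℕ)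
    (h : ∑ i, β i + ∑ i, γ i ≤ m) : ∃ C : ℝ≥0∞, C ≠ ⊤ ∧ ∀ f g : Ed d → ℝ, Sm d f → Sm d g →
    ∫⁻ x in cube0 d, ‖pderivA d β f x‖ₑ ^ p * ‖pderivA d γ g x‖ₑ ^ p ≤
      C * (∫⁻ x in cube0 d, PP d m p f x) * (∫⁻ x in cube0 d, PP d m p g x) := by
  obtain ⟨k1, hk1⟩ : ∃ k, k + ∑ i, β i = m := ⟨m - ∑ i, β i, by omega⟩
  obtain ⟨k2, hk2⟩ : ∃ k, k + ∑ i, γ i = m := ⟨m - ∑ i, γ i, by omega⟩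
  have hkk : m ≤ k1 + k2 := by omega
  have hp0 : 0 < p := by linarith
  have hmp : (d:ℝ) < m * p := by rwa [div_lt_iff₀ hp0] at hdm
  have hkkR : (m:ℝ) ≤ k1 + k2 := by exact_mod_cast hkk
  have hm1 : (1:ℝ) ≤ m := by exact_mod_cast hm
  have hkp : (0:ℝ) < k1 + k2 := by linarith
  have hq : (d:ℝ) / (k1 + k2) < p := by
    rw [div_lt_iff₀ hkp]
    nlinarith
  have hq0 : 0 ≤ (d:ℝ) / (k1 + k2) := by positivity
  have hek : ∀ k : ℕ, 0 < k → k * ((d:ℝ) / (k1 + k2)) < k * p := fun k hk => by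
    have : (0:ℝ) < k := by exact_mod_cast hk
    exact mul_lt_mul_of_pos_left hq this
  set e1 : ℝ := k1 * ((d:ℝ) / (k1 + k2)) with he1
  set e2 : ℝ := k2 * ((d:ℝ) / (k1 + k2)) with he2
  have he10 : 0 ≤ e1 := by positivity
  have he20 : 0 ≤ e2 := by positivity
  have hsum : e1 + e2 = d := by rw [he1, he2]; field_simp
  obtain ⟨ν1, hs1, ha1, hi1, C1, hC1, hr1⟩ := rep hp β he10 k1 hk1 (fun h => by simp [he1, h]) (hek k1)
  obtain ⟨ν2, hs2, ha2, hi2, C2, hC2, hr2⟩ := rep hp γ he20 k2 hk2 (fun h => by simp [he2, h]) (hek k2)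
  set I1 := ∫⁻ t, (ENNReal.ofReal t) ^ (-e1) ∂ν1 with hI1
  set I2 := ∫⁻ t, (ENNReal.ofReal t) ^ (-e2) ∂ν2 with hI2
  refine ⟨C1 * C2 * (I1 * I2 * 2 ^ d), by finiteness, ?_⟩
  intro f g hf hg
  have hP := PP_meas hf m p
  have hR := PP_meas hg m p
  have hr1 := hr1 f hf
  have hr2 := hr2 g hg
  generalize PP d m p f = P at *
  generalize PP d m p g = R at *
  set J := 2 ^ d * (∫⁻ x in cube0 d, P x) * (∫⁻ x in cube0 d, R x) with hJ
  have hAP := AvT_meas_t hP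
  have hAR := AvT_meas_t hR
  have hw : ∀ e : ℝ, Measurable fun t : ℝ => (ENNReal.ofReal t) ^ e := fun e =>
    ENNReal.measurable_ofReal.pow_const _
  have m1 : Measurable fun q : Ed d × ℝ × ℝ => AvT d P q.2.1 q.1 * AvT d R q.2.2 q.1 := AvT_meas_2 hP hR
  calc _ ≤ ∫⁻ x in cube0 d, (C1 * C2) * ∫⁻ q, AvT d P q.1 x * AvT d R q.2 x ∂(ν1.prod ν2) := by
        refine setLIntegral_mono' (cube0_meas d) fun x hx => ?_
        rw [lintegral_prod_mul (hAP x).aemeasurable (hAR x).aemeasurable]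
        calc _ ≤ _ := mul_le_mul' (hr1 x hx) (hr2 x hx)
          _ = _ := by ring
    _ = (C1 * C2) * ∫⁻ q, (∫⁻ x in cube0 d, AvT d P q.1 x * AvT d R q.2 x) ∂(ν1.prod ν2) := by
        rw [lintegral_const_mul' _ _ (by finiteness), lintegral_lintegral_swap]
        exact m1.aemeasurable
    _ ≤ (C1 * C2) * ∫⁻ q, (ENNReal.ofReal q.1) ^ (-e1) * (ENNReal.ofReal q.2) ^ (-e2) * J ∂(ν1.prod ν2) := by
        refine mul_le_mul' le_rfl ?_
        apply lintegral_mono_ae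
        have b1 : ∀ᵐ q ∂(ν1.prod ν2), q.1 ∈ Icc (0:ℝ) 1 ∧ (0 < k1 → 0 < q.1) :=
          Measure.quasiMeasurePreserving_fst.ae ha1
        have b2 : ∀ᵐ q ∂(ν1.prod ν2), q.2 ∈ Icc (0:ℝ) 1 ∧ (0 < k2 → 0 < q.2) :=
          Measure.quasiMeasurePreserving_snd.ae ha2
        filter_upwards [b1, b2] with q h1 h2
        refine AvT_prod P R hP hR h1.1.1 h1.1.2 h2.1.1 h2.1.2 ?_ he10 he20 hsum
        rcases Nat.eq_zero_or_pos k1 with hz | hz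
        · exact Or.inr (h2.2 (by omega))
        · exact Or.inl (h1.2 hz)
    _ = (C1 * C2) * (I1 * I2 * J) := by
        rw [lintegral_mul_const, lintegral_prod_mul (hw _).aemeasurable (hw _).aemeasurable]
        exact ((hw _).comp measurable_fst).mul ((hw _).comp measurable_snd)
    _ = _ := by rw [hJ]; ring

/-- The hypothesis that the Sobolev space is an algebra. -/
def Alg (d m : ℕ) (p : ℝ) : Prop := (1 < p ∧ (d : ℝ) / p < m) ∨ (p = 1 ∧ d ≤ m)

lemma PP_int {d m : ℕ} {p : ℝ} {f : Ed d → ℝ} (hf : Sm d f) (S : Set (Ed d)) :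
    ∫⁻ x in S, PP d m p f x = ∑ δ ∈ multiIdx d m, ∫⁻ x in S, ‖pderivA d δ f x‖ₑ ^ p := by
  unfold PP
  rw [lintegral_finsetSum]
  exact fun δ _ => ((hf.pA δ).continuous.enorm.measurable).pow_const p

lemma lbe0 {d m : ℕ} {p : ℝ} (hm : 1 ≤ m) (halg : Alg d m p) : ∃ C : ℝ≥0∞, C ≠ ⊤ ∧
    ∀ β γ : Fin d → ℕ, ∑ i, β i + ∑ i, γ i ≤ m → ∀ f g : Ed d → ℝ, Sm d f → Sm d g →
    ∫⁻ x in cube0 d, ‖pderivA d β f x‖ₑ ^ p * ‖pderivA d γ g x‖ₑ ^ p ≤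
      C * (∑ δ ∈ multiIdx d m, ∫⁻ x in cube0 d, ‖pderivA d δ f x‖ₑ ^ p) *
        (∑ δ ∈ multiIdx d m, ∫⁻ x in cube0 d, ‖pderivA d δ g x‖ₑ ^ p) := by
  rcases halg with ⟨hp, hdm⟩ | ⟨rfl, hdm⟩
  · choose! c hc hcc using fun β (γ : Fin d → ℕ) => lbe0_gt hm hp hdm (β := β) (γ := γ)
    refine ⟨∑ b ∈ (multiIdx d m ×ˢ multiIdx d m).filter
      (fun b => ∑ i, b.1 i + ∑ i, b.2 i ≤ m), c b.1 b.2, ?_, ?_⟩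
    · rw [ENNReal.sum_ne_top]
      intro b hb
      exact hc _ _ (Finset.mem_filter.1 hb).2
    · intro β γ h f g hf hg
      have := hcc β γ h f g hf hg
      rw [PP_int hf, PP_int hg] at this
      refine this.trans ?_
      gcongr
      have hmem : (β, γ) ∈ (multiIdx d m ×ˢ multiIdx d m).filter
          (fun b => ∑ i, b.1 i + ∑ i, b.2 i ≤ m) := by
        simp only [Finset.mem_filter, Finset.mem_product, mem_multiIdx]
        omega
      exact Finset.single_le_sum (f := fun b : (Fin d → ℕ) × (Fin d → ℕ) => c b.1 b.2) (fun _ _ => zero_le) hmem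
  · refine ⟨2 ^ d, by finiteness, ?_⟩
    intro β γ h f g hf hg
    simp only [ENNReal.rpow_one]
    exact lbe0_one hdm β γ h f g hf hg

lemma trans_cont {d : ℕ} {P : ℝ≥0∞} (hP1 : 1 ≤ P) (hPt : P ≠ ⊤) {w : Ed d → ℝ} (hw : MemLp w P volume) :
    Tendsto (fun y : Ed d => eLpNorm (fun x => w (x - y) - w x) P volume) (𝓝 0) (𝓝 0) := by
  haveI : Fact (1 ≤ P) := ⟨hP1⟩
  let g : Ed d → C(Ed d, Ed d) := fun y => ⟨fun x => x - y, by fun_prop⟩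
  have hg : Continuous g := by
    apply ContinuousMap.continuous_of_continuous_uncurry
    change Continuous fun q : Ed d × Ed d => q.2 - q.1
    fun_prop
  have hgm : ∀ y, MeasurePreserving (g y) volume volume := fun y => measurePreserving_sub_right volume y
  have hc : Continuous fun y => Lp.compMeasurePreserving (g y) (hgm y) (hw.toLp w) :=
    Continuous.compMeasurePreservingLp continuous_const hg hgm hPt
  have h0 := hc.tendsto 0
  have h1 := tendsto_iff_edist_tendsto_0.1 h0
  refine h1.congr fun y => ?_
  rw [Lp.edist_def]
  apply eLpNorm_congr_ae
  have a1 := Lp.coeFn_compMeasurePreserving (hw.toLp w) (hgm y)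
  have a2 := Lp.coeFn_compMeasurePreserving (hw.toLp w) (hgm 0)
  have b := hw.coeFn_toLp
  have b1 := (hgm y).quasiMeasurePreserving.ae_eq_comp b
  have b2 := (hgm 0).quasiMeasurePreserving.ae_eq_comp b
  filter_upwards [a1, a2, b1, b2] with x h1 h2 h3 h4
  simp only [Pi.sub_apply]
  rw [h1, h2, h3, h4]
  simp [g]

lemma jensen_conv {d : ℕ} {p : ℝ} (hp : 1 ≤ p) {φ h : Ed d → ℝ} (hφ0 : ∀ y, 0 ≤ φ y) (hφi : Integrable φ)
    (hφm : Measurable φ)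
    (hφ1 : ∫ y, φ y = 1) (hh : Measurable h) :
    ‖∫ y, φ y * h y‖ₑ ^ p ≤ ∫⁻ y, ‖φ y‖ₑ * ‖h y‖ₑ ^ p := by
  have hp0 : 0 < p := by linarith
  set μ : Measure (Ed d) := volume.withDensity (fun y => ‖φ y‖ₑ) with hμ
  have hme : Measurable fun y => ‖φ y‖ₑ := hφm.enorm
  have hprob : IsProbabilityMeasure μ := by
    constructor
    rw [hμ, withDensity_apply _ MeasurableSet.univ, Measure.restrict_univ]
    have := ofReal_integral_eq_lintegral_ofReal hφi (Eventually.of_forall hφ0)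
    rw [hφ1] at this
    rw [← ENNReal.ofReal_one, this]
    refine lintegral_congr fun y => ?_
    exact Real.enorm_of_nonneg (hφ0 y)
  have key := eLpNorm'_le_eLpNorm'_of_exponent_le (μ := μ) (f := h) one_pos hp hh.aestronglyMeasurable
  simp only [eLpNorm', ENNReal.rpow_one, one_div, inv_one] at key
  have key2 := ENNReal.rpow_le_rpow key hp0.le
  rw [← ENNReal.rpow_mul, inv_mul_cancel₀ hp0.ne', ENNReal.rpow_one] at key2
  rw [hμ, lintegral_withDensity_eq_lintegral_mul _ hme hh.enorm,
    lintegral_withDensity_eq_lintegral_mul _ hme (hh.enorm.pow_const p)] at key2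
  refine le_trans ?_ key2
  gcongr
  refine (enorm_integral_le_lintegral_enorm _).trans (le_of_eq ?_)
  refine lintegral_congr fun y => ?_
  simp [enorm_mul]

lemma eLpNorm_pow {d : ℕ} {p : ℝ} (hp : 1 ≤ p) (h : Ed d → ℝ) (μ : Measure (Ed d)) :
    eLpNorm h (ENNReal.ofReal p) μ ^ p = ∫⁻ x, ‖h x‖ₑ ^ p ∂μ := by
  have hp0 : 0 < p := by linarith
  rw [eLpNorm_eq_lintegral_rpow_enorm_toReal (by simpa using hp0) (by simp), ENNReal.toReal_ofReal hp0.le,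
    ← ENNReal.rpow_mul, one_div, inv_mul_cancel₀ hp0.ne', ENNReal.rpow_one]

lemma moll {d : ℕ} {p : ℝ} (hp : 1 ≤ p) {w : Ed d → ℝ} (hw : MemLp w (ENNReal.ofReal p) volume)
    (φ : ℕ → ContDiffBump (0 : Ed d)) (hφ : Tendsto (fun n => (φ n).rOut) atTop (𝓝 0)) :
    Tendsto (fun n => eLpNorm (fun x => (∫ y, (φ n).normed volume (x - y) * w y) - w x)
      (ENNReal.ofReal p) volume) atTop (𝓝 0) := by
  have hp0 : 0 < p := by linarith
  have hP1 : 1 ≤ ENNReal.ofReal p := by rw [← ENNReal.ofReal_one]; exact ENNReal.ofReal_le_ofReal hp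
  wlog hm : Measurable w generalizing w
  · obtain ⟨w', hw', hww⟩ := hw.1
    have h2 := this ((memLp_congr_ae hww).1 hw) hw'.measurable
    refine h2.congr fun n => ?_
    apply eLpNorm_congr_ae
    filter_upwards [hww] with x hx
    rw [hx]
    congr 1
    apply integral_congr_ae
    filter_upwards [hww] with y hy
    rw [hy]
  rw [ENNReal.tendsto_nhds_zero]
  intro ε hε
  have h1 := (ENNReal.tendsto_nhds_zero.1 (trans_cont hP1 (by simp) hw)) ε hε
  obtain ⟨δ, hδ, hball⟩ := Metric.eventually_nhds_iff_ball.1 h1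
  filter_upwards [hφ.eventually (gt_mem_nhds hδ)] with n hn
  set ψ := (φ n).normed volume with hψ
  have ψ0 : ∀ y, 0 ≤ ψ y := (φ n).nonneg_normed
  have ψc : Continuous ψ := (φ n).continuous_normed
  have ψi : Integrable ψ := (φ n).integrable_normed
  have ψ1 : ∫ y, ψ y = 1 := (φ n).integral_normed
  have hloc : LocallyIntegrable w := hw.locallyIntegrable hP1
  have e : ∀ x, (∫ y, ψ (x - y) * w y) - w x = ∫ y, ψ y * (w (x - y) - w x) := by
    intro x
    have e1 : ∫ y, ψ (x - y) * w y = ∫ y, ψ y * w (x - y) := by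
      rw [← integral_sub_left_eq_self (fun y => ψ (x - y) * w y) volume x]
      simp
    have hintg : Integrable fun y => ψ (x - y) * w y := by
      have hcs : HasCompactSupport fun y => ψ (x - y) :=
        (φ n).hasCompactSupport_normed.comp_homeomorph (Homeomorph.subLeft x)
      have := hloc.integrable_smul_left_of_hasCompactSupport (ψc.comp (continuous_const.sub continuous_id) : Continuous fun y => ψ (x - y)) hcs
      simpa using this
    have hint2 : Integrable fun y => ψ y * w (x - y) := by
      have := hintg.comp_sub_left x
      simpa using this
    simp_rw [mul_sub]
    rw [integral_sub hint2 (ψi.mul_const _), integral_mul_const, ψ1, one_mul, e1]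
  rw [← ENNReal.rpow_le_rpow_iff hp0, eLpNorm_pow hp]
  have hmeas2 : Measurable fun q : Ed d × Ed d => w (q.1 - q.2) - w q.1 :=
    (hm.comp (measurable_fst.sub measurable_snd)).sub (hm.comp measurable_fst)
  calc _ ≤ ∫⁻ x, ∫⁻ y, ‖ψ y‖ₑ * ‖w (x - y) - w x‖ₑ ^ p := by
        refine lintegral_mono fun x => ?_
        rw [e x]
        exact jensen_conv hp ψ0 ψi ψc.measurable ψ1 (hmeas2.comp (by fun_prop : Measurable fun y : Ed d => (x, y)))
    _ = ∫⁻ y, ‖ψ y‖ₑ * ∫⁻ x, ‖w (x - y) - w x‖ₑ ^ p := by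
        rw [lintegral_lintegral_swap]
        · refine lintegral_congr fun y => ?_
          rw [lintegral_const_mul]
          exact (hmeas2.comp (by fun_prop : Measurable fun x : Ed d => (x, y))).enorm.pow_const p
        · apply Measurable.aemeasurable
          exact (ψc.measurable.comp measurable_snd).enorm.mul (hmeas2.enorm.pow_const p)
    _ ≤ ∫⁻ y, ‖ψ y‖ₑ * ε ^ p := by
        refine lintegral_mono fun y => ?_
        by_cases hy : y ∈ ball (0 : Ed d) δ
        · have := hball y hy
          gcongr
          rw [← eLpNorm_pow hp]
          gcongr
        · have : ψ y = 0 := by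
            by_contra h
            have : y ∈ Function.support ψ := h
            rw [hψ, (φ n).support_normed_eq] at this
            exact hy (ball_subset_ball hn.le this)
          simp [this]
    _ = ε ^ p := by
        rw [lintegral_mul_const _ ψc.measurable.enorm]
        have := ofReal_integral_eq_lintegral_ofReal ψi (Eventually.of_forall ψ0)
        rw [ψ1] at this
        have h3 : ∫⁻ y, ‖ψ y‖ₑ = 1 := by
          rw [← ENNReal.ofReal_one, this]
          refine lintegral_congr fun y => ?_
          exact Real.enorm_of_nonneg (ψ0 y)
        rw [h3, one_mul]

/-- `D` is approximable by derivatives of smooth functions on `K`. -/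
def Appr (d m : ℕ) (p : ℝ) (K : Set (Ed d)) (D : (Fin d → ℕ) → Ed d → ℝ) (f : ℕ → Ed d → ℝ) : Prop :=
  (∀ n, Sm d (f n)) ∧ ∀ β ∈ multiIdx d m,
    Tendsto (fun n => eLpNorm (fun x => pderivA d β (f n) x - D β x) (ENNReal.ofReal p)
      (volume.restrict K)) atTop (𝓝 0) ∧
    ∀ᵐ x ∂(volume.restrict K), Tendsto (fun n => pderivA d β (f n) x) atTop (𝓝 (D β x))

/-- locally in L_p -/
def LocLp (d m : ℕ) (p : ℝ) (Ω : Set (Ed d)) (D : (Fin d → ℕ) → Ed d → ℝ) : Prop :=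
  ∀ K ⊆ Ω, IsCompact K → ∀ β ∈ multiIdx d m, MemLp (D β) (ENNReal.ofReal p) (volume.restrict K)

lemma appr {d m : ℕ} {p : ℝ} (hp : 1 ≤ p) {Ω K : Set (Ed d)} (hΩ : IsOpen Ω) (hK : IsCompact K)
    (hKΩ : K ⊆ Ω) {u : Ed d → ℝ} {D : (Fin d → ℕ) → Ed d → ℝ} (hD : IsWeakDerivFamily d Ω m u D)
    (hL : LocLp d m p Ω D) : ∃ f, Appr d m p K D f := by
  have hP1 : 1 ≤ ENNReal.ofReal p := by rw [← ENNReal.ofReal_one]; exact ENNReal.ofReal_le_ofReal hp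
  obtain ⟨δ, hδ, hδΩ⟩ := hK.exists_cthickening_subset_open hΩ hKΩ
  set K' := cthickening δ K with hK'
  have hK'c : IsCompact K' := hK.cthickening
  have hK'm : MeasurableSet K' := hK'c.measurableSet
  let φ : ℕ → ContDiffBump (0 : Ed d) := fun n =>
    ⟨δ / (n + 1) / 2, δ / (n + 1), by positivity, half_lt_self (by positivity)⟩
  have hφr : Tendsto (fun n => (φ n).rOut) atTop (𝓝 0) := by
    change Tendsto (fun n : ℕ => δ / (n + 1)) atTop (𝓝 0)
    have := (tendsto_one_div_add_atTop_nhds_zero_nat (𝕜 := ℝ)).const_mul δ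
    simpa [div_eq_mul_inv] using this
  have hφle : ∀ n, (φ n).rOut ≤ δ := by
    intro n
    change δ / (n + 1) ≤ δ
    apply div_le_self hδ.le
    have : (0:ℝ) ≤ n := Nat.cast_nonneg n
    linarith
  have ψsm : ∀ n, Sm d ((φ n).normed volume) := fun n => (φ n).contDiff_normed
  have ψc : ∀ n, HasCompactSupport ((φ n).normed volume) := fun n => (φ n).hasCompactSupport_normed
  have hu0 : LocallyIntegrableOn u Ω := (hD 0 (by rw [mem_multiIdx]; simp)).1
  have huK : IntegrableOn u K' := hu0.integrableOn_compact_subset hδΩ hK'c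
  have hwi : Integrable (K'.indicator u) := (integrable_indicator_iff hK'm).2 huK
  let f : ℕ → Ed d → ℝ := fun n x => ∫ y, (φ n).normed volume (x - y) * K'.indicator u y
  have hfs : ∀ n, Sm d (f n) := fun n => Sm.conv (ψsm n) (ψc n) hwi.locallyIntegrable
  have hfd : ∀ n, ∀ β ∈ multiIdx d m, ∀ x ∈ K, pderivA d β (f n) x =
      ∫ y, (φ n).normed volume (x - y) * K'.indicator (D β) y := by
    intro n β hβ x hx
    have h1 := congrFun (pderivA_conv (ψsm n) (ψc n) hwi.locallyIntegrable β) x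
    change pderivA d β (f n) x = _ at h1
    rw [h1]
    set ψ := (φ n).normed volume with hψ
    have eaff : ∀ y, x - y = x + (-1 : ℝ) • y := fun y => by simp [sub_eq_add_neg]
    have htest : IsTestFun d Ω (fun y => ψ (x - y)) := by
      refine ⟨?_, ?_, ?_⟩
      · have := (ψsm n).comp_affine x (-1)
        simp_rw [eaff]; exact this
      · exact (ψc n).comp_homeomorph (Homeomorph.subLeft x)
      · refine (?_ : tsupport (fun y => ψ (x - y)) ⊆ K').trans hδΩ
        apply closure_minimal _ hK'c.isClosed
        intro y hy
        have hy : x - y ∈ Function.support ψ := hy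
        rw [hψ, (φ n).support_normed_eq, mem_ball, dist_zero_right] at hy
        apply mem_cthickening_of_dist_le y x δ K hx
        rw [dist_comm, dist_eq_norm]
        exact hy.le.trans (hφle n)
    have hsupp0 : ∀ y ∉ K', ψ (x - y) = 0 := by
      intro y hy
      by_contra h
      have hy2 : x - y ∈ Function.support ψ := h
      rw [hψ, (φ n).support_normed_eq, mem_ball, dist_zero_right] at hy2
      apply hy
      apply mem_cthickening_of_dist_le y x δ K hx
      rw [dist_comm, dist_eq_norm]
      exact hy2.le.trans (hφle n)
    have hsupp1 : ∀ y ∉ K', pderivA d β ψ (x - y) = 0 := by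
      intro y hy
      by_contra h
      have hy2 : x - y ∈ tsupport (pderivA d β ψ) := subset_tsupport _ h
      have hy2 := pderivA_tsupport (ψsm n) β hy2
      rw [(φ n).tsupport_normed_eq, mem_closedBall, dist_zero_right] at hy2
      apply hy
      apply mem_cthickening_of_dist_le y x δ K hx
      rw [dist_comm, dist_eq_norm]
      exact hy2.trans (hφle n)
    have h2 := (hD β hβ).2.2 _ htest
    have e2 : pderivA d β (fun y => ψ (x - y)) = fun y => (-1 : ℝ) ^ (∑ i, β i) * pderivA d β ψ (x - y) := by
      have := pderivA_comp_affine (ψsm n) x (-1) β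
      simp_rw [eaff]; exact this
    rw [e2] at h2
    have e3 : ∀ y, u y * ((-1 : ℝ) ^ (∑ i, β i) * pderivA d β ψ (x - y)) =
      (-1 : ℝ) ^ (∑ i, β i) * (u y * pderivA d β ψ (x - y)) := fun y => by ring
    simp_rw [e3] at h2
    rw [integral_const_mul] at h2
    have h3 := mul_left_cancel₀ (pow_ne_zero _ (by norm_num)) h2
    have tr : ∀ (A B : Ed d → ℝ), (∀ y ∉ K', A y = 0) → ∫ y, A y * K'.indicator B y = ∫ y in Ω, B y * A y := by
      intro A B hA
      have q1 : (fun y => A y * K'.indicator B y) = K'.indicator (fun y => B y * A y) := by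
        funext y
        by_cases hy : y ∈ K'
        · simp [hy, mul_comm]
        · simp [hy]
      rw [q1, integral_indicator hK'm]
      refine (setIntegral_eq_of_subset_of_forall_sdiff_eq_zero hΩ.measurableSet hδΩ ?_).symm
      intro y hy
      rw [hA y hy.2, mul_zero]
    rw [tr _ _ hsupp1, tr _ _ hsupp0, h3]
  refine ⟨f, hfs, fun β hβ => ?_⟩
  have hwL : MemLp (K'.indicator (D β)) (ENNReal.ofReal p) volume :=
    (memLp_indicator_iff_restrict hK'm).2 (hL K' hδΩ hK'c β hβ)
  have hin : ∀ x ∈ K, K'.indicator (D β) x = D β x := fun x hx =>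
    indicator_of_mem (self_subset_cthickening K hx) _
  constructor
  · have hm := moll hp hwL φ hφr
    refine tendsto_of_tendsto_of_tendsto_of_le_of_le tendsto_const_nhds hm (fun _ => zero_le) fun n => ?_
    refine le_trans (le_of_eq ?_) (eLpNorm_mono_measure _ (Measure.restrict_le_self (s := K)))
    apply eLpNorm_congr_ae
    filter_upwards [ae_restrict_mem hK.measurableSet] with x hx
    rw [hfd n β hβ x hx, hin x hx]
  · have h := ContDiffBump.ae_convolution_tendsto_right_of_locallyIntegrable (μ := volume) (φ := φ) (K := 2) hφr
      (Eventually.of_forall fun n => by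
        change δ / (n + 1) ≤ 2 * (δ / (n + 1) / 2)
        linarith) (hwL.locallyIntegrable hP1)
    filter_upwards [ae_restrict_of_ae h, ae_restrict_mem hK.measurableSet] with x h1 hx
    rw [hin x hx] at h1
    refine h1.congr fun n => ?_
    rw [hfd n β hβ x hx, convolution_eq_swap]
    simp

/-- The closed cube with corner `x0` and side `r`. -/
def cubeQ (d : ℕ) (x0 : Ed d) (r : ℝ) : Set (Ed d) := {x | ∀ i, x i ∈ Icc (x0 i) (x0 i + r)}

lemma cubeQ_closed (d : ℕ) (x0 : Ed d) (r : ℝ) : IsClosed (cubeQ d x0 r) := by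
  have : cubeQ d x0 r = ⋂ i, (fun x : Ed d => x i) ⁻¹' (Icc (x0 i) (x0 i + r)) := by
    ext x; simp [cubeQ]
  rw [this]
  refine isClosed_iInter fun i => isClosed_Icc.preimage ?_
  fun_prop

lemma cubeQ_meas (d : ℕ) (x0 : Ed d) (r : ℝ) : MeasurableSet (cubeQ d x0 r) :=
  (cubeQ_closed d x0 r).measurableSet

lemma cubeQ_dist {d : ℕ} {x0 x : Ed d} {r : ℝ} (h : x ∈ cubeQ d x0 r) : dist x x0 ≤ d * r := by
  rw [EuclideanSpace.dist_eq]
  by_cases hd : d = 0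
  · subst hd; simp
  have hr : 0 ≤ r := by
    have := h ⟨0, Nat.pos_of_ne_zero hd⟩
    have := this.1.trans this.2
    linarith
  have h1 : ∑ i, dist (x i) (x0 i) ^ 2 ≤ ∑ i : Fin d, r ^ 2 := by
    refine Finset.sum_le_sum fun i _ => ?_
    have hi := h i
    have : dist (x i) (x0 i) ≤ r := by
      rw [Real.dist_eq, abs_le]; constructor <;> linarith [hi.1, hi.2]
    exact pow_le_pow_left₀ dist_nonneg this 2
  refine (Real.sqrt_le_sqrt h1).trans ?_
  refine Real.sqrt_le_iff.2 ⟨by positivity, ?_⟩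
  simp only [Finset.sum_const, Finset.card_univ, Fintype.card_fin, nsmul_eq_mul]
  have : (1:ℝ) ≤ d := by exact_mod_cast Nat.pos_of_ne_zero hd
  nlinarith [sq_nonneg r, mul_nonneg (sub_nonneg.2 this) (sq_nonneg r)]

lemma cubeQ_compact (d : ℕ) (x0 : Ed d) (r : ℝ) : IsCompact (cubeQ d x0 r) := by
  refine isCompact_of_isClosed_isBounded (cubeQ_closed d x0 r) ?_
  refine (Metric.isBounded_closedBall (x := x0) (r := d * r)).subset fun x hx => cubeQ_dist hx

lemma lint_cubeQ {d : ℕ} (F : Ed d → ℝ≥0∞) (x0 : Ed d) {r : ℝ} (hr : 0 < r) :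
    ∫⁻ x in cube0 d, F (x0 + r • x) = ((ENNReal.ofReal r) ^ d)⁻¹ * ∫⁻ x in cubeQ d x0 r, F x := by
  rw [← lintegral_indicator (cube0_meas d), ← lintegral_indicator (cubeQ_meas d x0 r),
    ← lint_affine _ x0 hr]
  congr 1
  funext x
  have : x ∈ cube0 d ↔ x0 + r • x ∈ cubeQ d x0 r := by
    simp only [cube0, cubeQ, mem_ofPred_eq, mem_Icc, PiLp.add_apply, PiLp.smul_apply, smul_eq_mul]
    refine forall_congr' fun i => ?_
    constructor
    · rintro ⟨h1, h2⟩; constructor <;> nlinarith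
    · rintro ⟨h1, h2⟩; constructor
      · by_contra h; nlinarith
      · by_contra h; nlinarith
  by_cases hx : x ∈ cube0 d
  · rw [indicator_of_mem hx, indicator_of_mem (this.1 hx)]
  · rw [indicator_of_notMem hx, indicator_of_notMem (fun h => hx (this.2 h))]

lemma cubeQ_vol {d : ℕ} (x0 : Ed d) {r : ℝ} (hr : 0 < r) :
    volume (cubeQ d x0 r) = ENNReal.ofReal r ^ d := by
  have h := lint_cubeQ (fun _ => 1) x0 hr
  simp only [lintegral_one, Measure.restrict_apply_univ, cube0_vol] at h
  have h0 : ENNReal.ofReal r ^ d ≠ 0 := pow_ne_zero _ (by simpa using hr)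
  have ht : ENNReal.ofReal r ^ d ≠ ⊤ := ENNReal.pow_ne_top ENNReal.ofReal_ne_top
  calc _ = ENNReal.ofReal r ^ d * ((ENNReal.ofReal r ^ d)⁻¹ * volume (cubeQ d x0 r)) := by
        rw [← mul_assoc, ENNReal.mul_inv_cancel h0 ht, one_mul]
    _ = _ := by rw [← h, mul_one]

lemma lbeQ {d m : ℕ} {p : ℝ} (hp : 1 ≤ p) (hm : 1 ≤ m) (halg : Alg d m p) :
    ∃ C : ℝ≥0∞, C ≠ ⊤ ∧ ∀ β γ : Fin d → ℕ, ∑ i, β i + ∑ i, γ i ≤ m →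
      ∀ f g, Sm d f → Sm d g → ∀ (x0 : Ed d) (r : ℝ), 0 < r →
      ENNReal.ofReal r ^ (((∑ i, β i + ∑ i, γ i : ℕ) : ℝ) * p + d) *
        ∫⁻ x in cubeQ d x0 r, ‖pderivA d β f x‖ₑ ^ p * ‖pderivA d γ g x‖ₑ ^ p ≤
      C * (∑ δ ∈ multiIdx d m, ENNReal.ofReal r ^ (((∑ i, δ i : ℕ) : ℝ) * p) *
            ∫⁻ x in cubeQ d x0 r, ‖pderivA d δ f x‖ₑ ^ p) *
          (∑ δ ∈ multiIdx d m, ENNReal.ofReal r ^ (((∑ i, δ i : ℕ) : ℝ) * p) *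
            ∫⁻ x in cubeQ d x0 r, ‖pderivA d δ g x‖ₑ ^ p) := by
  obtain ⟨C, hC, h⟩ := lbe0 hm halg
  refine ⟨C, hC, fun β γ hβγ f g hf hg x0 r hr => ?_⟩
  have h1 := h β γ hβγ _ _ (hf.comp_affine x0 r) (hg.comp_affine x0 r)
  have hp0 : 0 ≤ p := by linarith
  set w := ENNReal.ofReal r with hw
  have w0 : w ≠ 0 := by simpa [hw] using hr
  have wt : w ≠ ⊤ := ENNReal.ofReal_ne_top
  have key : ∀ (δ : Fin d → ℕ) (f : Ed d → ℝ), Sm d f → ∀ x,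
      ‖pderivA d δ (fun x => f (x0 + r • x)) x‖ₑ ^ p =
        w ^ (((∑ i, δ i : ℕ) : ℝ) * p) * ‖pderivA d δ f (x0 + r • x)‖ₑ ^ p := by
    intro δ f hf x
    rw [pderivA_comp_affine hf x0 r δ]
    simp only [enorm_mul, enorm_pow]
    rw [ENNReal.mul_rpow_of_nonneg _ _ hp0, ← ENNReal.rpow_natCast, ← ENNReal.rpow_mul,
      Real.enorm_eq_ofReal hr.le]
  have wr : ∀ s : ℝ, w ^ s ≠ ⊤ := fun s => ENNReal.rpow_ne_top_of_ne_zero w0 wt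
  have key2 : ∀ (δ : Fin d → ℕ) (f : Ed d → ℝ), Sm d f →
      ∫⁻ x in cube0 d, ‖pderivA d δ (fun x => f (x0 + r • x)) x‖ₑ ^ p =
        (w ^ d)⁻¹ * (w ^ (((∑ i, δ i : ℕ) : ℝ) * p) * ∫⁻ x in cubeQ d x0 r, ‖pderivA d δ f x‖ₑ ^ p) := by
    intro δ f hf
    simp_rw [key δ f hf]
    rw [lintegral_const_mul' _ _ (wr _), lint_cubeQ (fun y => ‖pderivA d δ f y‖ₑ ^ p) x0 hr]
    ring
  simp_rw [key2 _ _ hf, key2 _ _ hg, ← Finset.mul_sum, key β f hf, key γ g hg] at h1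
  have h2 : ∫⁻ x in cube0 d, (w ^ (((∑ i, β i : ℕ) : ℝ) * p) * ‖pderivA d β f (x0 + r • x)‖ₑ ^ p) *
      (w ^ (((∑ i, γ i : ℕ) : ℝ) * p) * ‖pderivA d γ g (x0 + r • x)‖ₑ ^ p) =
      w ^ (((∑ i, β i + ∑ i, γ i : ℕ) : ℝ) * p) * ((w ^ d)⁻¹ *
      ∫⁻ x in cubeQ d x0 r, ‖pderivA d β f x‖ₑ ^ p * ‖pderivA d γ g x‖ₑ ^ p) := by
    rw [← lint_cubeQ (fun x => ‖pderivA d β f x‖ₑ ^ p * ‖pderivA d γ g x‖ₑ ^ p) x0 hr,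
      ← lintegral_const_mul' _ _ (wr _)]
    refine lintegral_congr fun x => ?_
    rw [Nat.cast_add, add_mul, ENNReal.rpow_add _ _ w0 wt]
    ring
  rw [h2] at h1
  have hd0 : w ^ d ≠ 0 := pow_ne_zero _ w0
  have hdt : w ^ d ≠ ⊤ := ENNReal.pow_ne_top wt
  have e1 : w ^ d * (w ^ d)⁻¹ = 1 := ENNReal.mul_inv_cancel hd0 hdt
  rw [ENNReal.rpow_add _ _ w0 wt, ENNReal.rpow_natCast]
  generalize ∫⁻ x in cubeQ d x0 r, ‖pderivA d β f x‖ₑ ^ p * ‖pderivA d γ g x‖ₑ ^ p = I at *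
  generalize (∑ δ ∈ multiIdx d m, w ^ (((∑ i, δ i : ℕ) : ℝ) * p) *
            ∫⁻ x in cubeQ d x0 r, ‖pderivA d δ f x‖ₑ ^ p) = A at *
  generalize (∑ δ ∈ multiIdx d m, w ^ (((∑ i, δ i : ℕ) : ℝ) * p) *
            ∫⁻ x in cubeQ d x0 r, ‖pderivA d δ g x‖ₑ ^ p) = B at *
  generalize w ^ (((∑ i, β i + ∑ i, γ i : ℕ) : ℝ) * p) = s at *
  have h3 := mul_le_mul' (le_refl (w ^ d * w ^ d)) h1
  calc s * w ^ d * I = (w ^ d * (w ^ d)⁻¹) * (s * w ^ d * I) := by rw [e1, one_mul]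
    _ = w ^ d * w ^ d * (s * ((w ^ d)⁻¹ * I)) := by ring
    _ ≤ _ := h3
    _ = (w ^ d * (w ^ d)⁻¹) * (w ^ d * (w ^ d)⁻¹) * (C * A * B) := by ring
    _ = _ := by rw [e1, one_mul, one_mul]

lemma Sm.sub {d : ℕ} {f g : Ed d → ℝ} (hf : Sm d f) (hg : Sm d g) : Sm d (fun x => f x - g x) :=
  ContDiff.sub hf hg

lemma pderivA_sub {d : ℕ} {f g : Ed d → ℝ} (hf : Sm d f) (hg : Sm d g) (α : Fin d → ℕ) :
    pderivA d α (fun x => f x - g x) = fun x => pderivA d α f x - pderivA d α g x := by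
  induction α using mi_ind with
  | h0 => simp [pderivA_zero]
  | hs α i ih =>
    rw [← pderivI_pderivA (hf.sub hg), ih, ← pderivI_pderivA hf, ← pderivI_pderivA hg]
    funext x
    unfold pderivI
    rw [fderiv_fun_sub ((hf.pA α).differentiable x) ((hg.pA α).differentiable x)]
    simp

lemma cont_memLp {d : ℕ} {p : ℝ} {f : Ed d → ℝ} (hf : Continuous f) {K : Set (Ed d)}
    (hK : IsCompact K) : MemLp f (ENNReal.ofReal p) (volume.restrict K) := by
  obtain ⟨C, hC⟩ := hK.exists_bound_of_continuousOn hf.continuousOn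
  have : IsFiniteMeasure (volume.restrict K) := ⟨by simpa using hK.measure_lt_top⟩
  refine MemLp.of_bound hf.aestronglyMeasurable C ?_
  filter_upwards [ae_restrict_mem hK.measurableSet] with x hx using hC x hx

/-- The scaled local norm (to the power `p`). -/
def NQ (d m : ℕ) (p : ℝ) (x0 : Ed d) (r : ℝ) (D : (Fin d → ℕ) → Ed d → ℝ) : ℝ≥0∞ :=
  ∑ δ ∈ multiIdx d m, ENNReal.ofReal r ^ (((∑ i, δ i : ℕ) : ℝ) * p) *
            ∫⁻ x in cubeQ d x0 r, ‖D δ x‖ₑ ^ p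

/-- all components in `L_p` -/
def AllLp (d m : ℕ) (p : ℝ) (K : Set (Ed d)) (D : (Fin d → ℕ) → Ed d → ℝ) : Prop :=
  ∀ β ∈ multiIdx d m, MemLp (D β) (ENNReal.ofReal p) (volume.restrict K)

lemma w_ne_top {r : ℝ} (hr : 0 < r) (s : ℝ) : ENNReal.ofReal r ^ s ≠ ⊤ :=
  ENNReal.rpow_ne_top_of_ne_zero (by simpa using hr) ENNReal.ofReal_ne_top

lemma NQ_ne_top {d m : ℕ} {p : ℝ} (hp : 1 ≤ p) {x0 : Ed d} {r : ℝ} (hr : 0 < r)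
    {D : (Fin d → ℕ) → Ed d → ℝ} (hD : AllLp d m p (cubeQ d x0 r) D) : NQ d m p x0 r D ≠ ⊤ := by
  unfold NQ
  refine ENNReal.sum_ne_top.2 fun δ hδ => ENNReal.mul_ne_top (w_ne_top hr _) ?_
  rw [← eLpNorm_pow hp]
  exact ENNReal.rpow_ne_top_of_nonneg (by linarith) (hD δ hδ).2.ne

lemma NQ_up {d m : ℕ} {p : ℝ} (hp : 1 ≤ p) {x0 : Ed d} {r : ℝ} (hr : 0 < r)
    {D : (Fin d → ℕ) → Ed d → ℝ} (hD : AllLp d m p (cubeQ d x0 r) D) {f : ℕ → Ed d → ℝ}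
    (hf : Appr d m p (cubeQ d x0 r) D f) :
    ∃ U : ℕ → ℝ≥0∞, Tendsto U atTop (𝓝 (NQ d m p x0 r D)) ∧
      ∀ n, NQ d m p x0 r (fun δ => pderivA d δ (f n)) ≤ U n := by
  have hp0 : 0 ≤ p := by linarith
  refine ⟨fun n => ∑ δ ∈ multiIdx d m, ENNReal.ofReal r ^ (((∑ i, δ i : ℕ) : ℝ) * p) *
    (eLpNorm (fun x => pderivA d δ (f n) x - D δ x) (ENNReal.ofReal p)
      (volume.restrict (cubeQ d x0 r)) + eLpNorm (D δ) (ENNReal.ofReal p)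
      (volume.restrict (cubeQ d x0 r))) ^ p, ?_, ?_⟩
  · unfold NQ
    refine tendsto_finsetSum _ fun δ hδ => ?_
    refine ENNReal.Tendsto.const_mul ?_ (Or.inr (w_ne_top hr _))
    rw [← eLpNorm_pow hp]
    refine Filter.Tendsto.ennrpow_const _ ?_
    have := ((hf.2 δ hδ).1).add (tendsto_const_nhds (x := eLpNorm (D δ) (ENNReal.ofReal p)
      (volume.restrict (cubeQ d x0 r))))
    rwa [zero_add] at this
  · intro n
    unfold NQ
    refine Finset.sum_le_sum fun δ hδ => mul_le_mul' le_rfl ?_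
    rw [← eLpNorm_pow hp]
    refine ENNReal.rpow_le_rpow ?_ hp0
    have hP1 : 1 ≤ ENNReal.ofReal p := by rw [← ENNReal.ofReal_one]; exact ENNReal.ofReal_le_ofReal hp
    have h1 : pderivA d δ (f n) = (fun x => pderivA d δ (f n) x - D δ x) + D δ := by
      funext x; simp
    conv_lhs => beta_reduce; rw [h1]
    refine eLpNorm_add_le ?_ (hD δ hδ).1 hP1
    exact ((hf.1 n).pA δ).continuous.aestronglyMeasurable.sub (hD δ hδ).1

lemma NQ_diff {d m : ℕ} {p : ℝ} (hp : 1 ≤ p) {x0 : Ed d} {r : ℝ} (hr : 0 < r)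
    {D : (Fin d → ℕ) → Ed d → ℝ} {f : ℕ → Ed d → ℝ}
    (hf : Appr d m p (cubeQ d x0 r) D f) :
    Tendsto (fun n => NQ d m p x0 r (fun δ x => D δ x - pderivA d δ (f n) x)) atTop (𝓝 0) := by
  have hp0 : 0 < p := by linarith
  have : Tendsto (fun n => ∑ δ ∈ multiIdx d m, ENNReal.ofReal r ^ (((∑ i, δ i : ℕ) : ℝ) * p) *
    (eLpNorm (fun x => pderivA d δ (f n) x - D δ x) (ENNReal.ofReal p)
      (volume.restrict (cubeQ d x0 r))) ^ p) atTop (𝓝 (∑ δ ∈ multiIdx d m,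
      ENNReal.ofReal r ^ (((∑ i, δ i : ℕ) : ℝ) * p) * 0 ^ p)) := by
    refine tendsto_finsetSum _ fun δ hδ => ?_
    refine ENNReal.Tendsto.const_mul ?_ (Or.inr (w_ne_top hr _))
    exact Filter.Tendsto.ennrpow_const _ (hf.2 δ hδ).1
  rw [ENNReal.zero_rpow_of_pos hp0] at this
  simp only [mul_zero, Finset.sum_const_zero] at this
  refine this.congr fun n => ?_
  unfold NQ
  refine Finset.sum_congr rfl fun δ hδ => ?_
  rw [eLpNorm_pow hp]
  congr 1
  refine lintegral_congr fun x => ?_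
  rw [← enorm_neg, neg_sub]

lemma Appr.sub {d m : ℕ} {p : ℝ} {K : Set (Ed d)} 
    {D : (Fin d → ℕ) → Ed d → ℝ} {f : ℕ → Ed d → ℝ} (hf : Appr d m p K D f) (k : ℕ) :
    Appr d m p K (fun δ x => D δ x - pderivA d δ (f k) x) (fun n x => f n x - f k x) := by
  refine ⟨fun n => (hf.1 n).sub (hf.1 k), fun β hβ => ⟨?_, ?_⟩⟩
  · refine (hf.2 β hβ).1.congr fun n => ?_
    rw [pderivA_sub (hf.1 n) (hf.1 k)]
    congr 1
    funext x
    ring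
  · filter_upwards [(hf.2 β hβ).2] with x hx
    refine (hx.sub_const (pderivA d β (f k) x)).congr fun n => ?_
    rw [pderivA_sub (hf.1 n) (hf.1 k)]

lemma Appr.const {d m : ℕ} {p : ℝ} {K : Set (Ed d)} {f : Ed d → ℝ} (hf : Sm d f) :
    Appr d m p K (fun δ => pderivA d δ f) (fun _ => f) := by
  refine ⟨fun n => hf, fun β hβ => ⟨?_, ?_⟩⟩
  · simp
  · exact Eventually.of_forall fun x => tendsto_const_nhds

lemma Appr.mono {d m : ℕ} {p : ℝ} {K K' : Set (Ed d)} (h : K' ⊆ K)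
    {D : (Fin d → ℕ) → Ed d → ℝ} {f : ℕ → Ed d → ℝ} (hf : Appr d m p K D f) : Appr d m p K' D f := by
  refine ⟨hf.1, fun β hβ => ⟨?_, ?_⟩⟩
  · exact tendsto_of_tendsto_of_tendsto_of_le_of_le tendsto_const_nhds (hf.2 β hβ).1
      (fun _ => zero_le) fun n => eLpNorm_mono_measure _ (Measure.restrict_mono h le_rfl)
  · exact ae_restrict_of_ae_restrict_of_subset h (hf.2 β hβ).2

lemma wlbe {d m : ℕ} {p : ℝ} (hp : 1 ≤ p) (hm : 1 ≤ m) (halg : Alg d m p) :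
    ∃ C : ℝ≥0∞, C ≠ ⊤ ∧ ∀ β γ : Fin d → ℕ, ∑ i, β i + ∑ i, γ i ≤ m →
      ∀ (x0 : Ed d) (r : ℝ), 0 < r → ∀ D E f g,
      Appr d m p (cubeQ d x0 r) D f → Appr d m p (cubeQ d x0 r) E g →
      AllLp d m p (cubeQ d x0 r) D → AllLp d m p (cubeQ d x0 r) E →
      ENNReal.ofReal r ^ (((∑ i, β i + ∑ i, γ i : ℕ) : ℝ) * p + d) *
        ∫⁻ x in cubeQ d x0 r, ‖D β x‖ₑ ^ p * ‖E γ x‖ₑ ^ p ≤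
      C * NQ d m p x0 r D * NQ d m p x0 r E := by
  obtain ⟨C, hC, h⟩ := lbeQ hp hm halg
  refine ⟨C, hC, fun β γ hβγ x0 r hr D E f g hf hg hD hE => ?_⟩
  obtain ⟨U, hU, hUn⟩ := NQ_up hp hr hD hf
  obtain ⟨V, hV, hVn⟩ := NQ_up hp hr hE hg
  have hβ : β ∈ multiIdx d m := mem_multiIdx.2 (by omega)
  have hγ : γ ∈ multiIdx d m := mem_multiIdx.2 (by omega)
  have hlim : Tendsto (fun n => C * U n * V n) atTop
      (𝓝 (C * NQ d m p x0 r D * NQ d m p x0 r E)) := by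
    have hDt := NQ_ne_top hp hr hD
    have hEt := NQ_ne_top hp hr hE
    refine ENNReal.Tendsto.mul (ENNReal.Tendsto.const_mul hU (Or.inr hC)) (Or.inr hEt) hV
      (Or.inr (ENNReal.mul_ne_top hC hDt))
  set W := ENNReal.ofReal r ^ (((∑ i, β i + ∑ i, γ i : ℕ) : ℝ) * p + d) with hW
  have hWt : W ≠ ⊤ := w_ne_top hr _
  rw [← lintegral_const_mul' _ _ hWt]
  have e1 : ∫⁻ x in cubeQ d x0 r, W * (‖D β x‖ₑ ^ p * ‖E γ x‖ₑ ^ p) =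
      ∫⁻ x in cubeQ d x0 r, liminf (fun n => W * (‖pderivA d β (f n) x‖ₑ ^ p * ‖pderivA d γ (g n) x‖ₑ ^ p)) atTop := by
    refine lintegral_congr_ae ?_
    filter_upwards [(hf.2 β hβ).2, (hg.2 γ hγ).2] with x h1 h2
    refine (Tendsto.liminf_eq ?_).symm
    refine ENNReal.Tendsto.const_mul ?_ (Or.inr hWt)
    have fin : ∀ t : ℝ, ‖t‖ₑ ^ p ≠ ⊤ := fun t => ENNReal.rpow_ne_top_of_nonneg (by linarith) enorm_ne_top
    exact ENNReal.Tendsto.mul (h1.enorm.ennrpow_const p) (Or.inr (fin _)) (h2.enorm.ennrpow_const p) (Or.inr (fin _))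
  rw [e1]
  refine (lintegral_liminf_le fun n => ?_).trans ?_
  · have m1 := ((hf.1 n).pA β).continuous.measurable
    have m2 := ((hg.1 n).pA γ).continuous.measurable
    fun_prop
  rw [← hlim.liminf_eq]
  refine liminf_le_liminf (Eventually.of_forall fun n => ?_)
  rw [lintegral_const_mul' _ _ hWt]
  refine (h β γ hβγ _ _ (hf.1 n) (hg.1 n) x0 r hr).trans ?_
  exact mul_le_mul' (mul_le_mul' le_rfl (hUn n)) (hVn n)

lemma le_inv_mul_of {W I R : ℝ≥0∞} (h0 : W ≠ 0) (ht : W ≠ ⊤) (h : W * I ≤ R) : I ≤ W⁻¹ * R := by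
  calc I = W⁻¹ * (W * I) := by rw [← mul_assoc, ENNReal.inv_mul_cancel h0 ht, one_mul]
    _ ≤ _ := mul_le_mul' le_rfl h

lemma l1_le {d : ℕ} {p : ℝ} (hp : 1 ≤ p) {K : Set (Ed d)} {h k : Ed d → ℝ}
    (hh : AEStronglyMeasurable h (volume.restrict K)) (hk : AEStronglyMeasurable k (volume.restrict K)) :
    ∫⁻ x in K, ‖h x‖ₑ * ‖k x‖ₑ ≤
      (∫⁻ x in K, ‖h x‖ₑ ^ p * ‖k x‖ₑ ^ p) ^ (1 / p) * (volume K) ^ (1 - 1 / p) := by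
  have hp0 : 0 < p := by linarith
  have hP1 : 1 ≤ ENNReal.ofReal p := by rw [← ENNReal.ofReal_one]; exact ENNReal.ofReal_le_ofReal hp
  have := eLpNorm_le_eLpNorm_mul_rpow_measure_univ (μ := volume.restrict K) hP1 (hh.mul hk)
  rw [eLpNorm_one_eq_lintegral_enorm] at this
  have e : eLpNorm (h * k) (ENNReal.ofReal p) (volume.restrict K) =
      (∫⁻ x in K, ‖h x‖ₑ ^ p * ‖k x‖ₑ ^ p) ^ (1 / p) := by
    have := eLpNorm_pow hp (h * k) (volume.restrict K)
    have e2 : ∫⁻ x in K, ‖(h * k) x‖ₑ ^ p = ∫⁻ x in K, ‖h x‖ₑ ^ p * ‖k x‖ₑ ^ p := by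
      refine lintegral_congr fun x => ?_
      rw [Pi.mul_apply, enorm_mul, ENNReal.mul_rpow_of_nonneg _ _ hp0.le]
    rw [← e2, ← this, ← ENNReal.rpow_mul, mul_one_div_cancel hp0.ne', ENNReal.rpow_one]
  rw [e, ENNReal.toReal_ofReal hp0.le] at this
  simpa [enorm_mul] using this

/-- `L_1` convergence of continuous functions on `K`. -/
def Conv1 (d : ℕ) (K : Set (Ed d)) (Fn : ℕ → Ed d → ℝ) (F : Ed d → ℝ) : Prop :=
  (∀ n, Continuous (Fn n)) ∧ IntegrableOn F K ∧ Tendsto (fun n => ∫⁻ x in K, ‖Fn n x - F x‖ₑ) atTop (𝓝 0)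

lemma Conv1.union {d : ℕ} {K K' : Set (Ed d)} {Fn : ℕ → Ed d → ℝ} {F : Ed d → ℝ}
    (h : Conv1 d K Fn F) (h' : Conv1 d K' Fn F) : Conv1 d (K ∪ K') Fn F := by
  refine ⟨h.1, h.2.1.union h'.2.1, ?_⟩
  have := h.2.2.add h'.2.2
  rw [add_zero] at this
  exact tendsto_of_tendsto_of_tendsto_of_le_of_le tendsto_const_nhds this
      (fun _ => zero_le) fun n => lintegral_union_le _ _ _

lemma Conv1.add {d : ℕ} {K : Set (Ed d)} {Fn Gn : ℕ → Ed d → ℝ} {F G : Ed d → ℝ}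
    (h : Conv1 d K Fn F) (h' : Conv1 d K Gn G) :
    Conv1 d K (fun n x => Fn n x + Gn n x) (fun x => F x + G x) := by
  refine ⟨fun n => (h.1 n).add (h'.1 n), h.2.1.add h'.2.1, ?_⟩
  have := h.2.2.add h'.2.2
  rw [add_zero] at this
  refine tendsto_of_tendsto_of_tendsto_of_le_of_le tendsto_const_nhds this
      (fun _ => zero_le) fun n => ?_
  have m1 : AEMeasurable (fun x => ‖Fn n x - F x‖ₑ) (volume.restrict K) :=
    ((h.1 n).aestronglyMeasurable.sub h.2.1.1).enorm
  rw [← lintegral_add_left' m1]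
  refine lintegral_mono fun x => ?_
  have : Fn n x + Gn n x - (F x + G x) = (Fn n x - F x) + (Gn n x - G x) := by ring
  rw [this]
  exact enorm_add_le _ _

lemma Conv1.empty {d : ℕ} {Fn : ℕ → Ed d → ℝ} {F : Ed d → ℝ} (h : ∀ n, Continuous (Fn n)) :
    Conv1 d ∅ Fn F := by
  refine ⟨h, by simp, by simp⟩

lemma Conv1.zero {d : ℕ} {K : Set (Ed d)} : Conv1 d K (fun _ _ => 0) (fun _ => 0) := by
  refine ⟨fun _ => continuous_const, by simp, by simp⟩

lemma Conv1.biUnion {d : ℕ} {ι : Type*} (t : Finset ι) {K : ι → Set (Ed d)} {Fn : ℕ → Ed d → ℝ} {F : Ed d → ℝ}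
    (hc : ∀ n, Continuous (Fn n)) (h : ∀ i ∈ t, Conv1 d (K i) Fn F) : Conv1 d (⋃ i ∈ t, K i) Fn F := by
  classical
  induction t using Finset.induction_on with
  | empty => simpa using Conv1.empty hc
  | insert a s ha ih =>
    rw [Finset.set_biUnion_insert]
    exact (h a (by simp)).union (ih fun i hi => h i (by simp [hi]))

lemma Conv1.list {d : ℕ} {ι : Type*} (L : List ι) {K : Set (Ed d)} {Fn : ι → ℕ → Ed d → ℝ} {F : ι → Ed d → ℝ}
    (h : ∀ i ∈ L, Conv1 d K (Fn i) (F i)) :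
    Conv1 d K (fun n x => (L.map fun i => Fn i n x).sum) (fun x => (L.map fun i => F i x).sum) := by
  induction L with
  | nil => simpa using Conv1.zero
  | cons a s ih =>
    simp only [List.map_cons, List.sum_cons]
    exact (h a (by simp)).add (ih fun i hi => h i (by simp [hi]))

lemma Conv1.tendsto {d : ℕ} {K Ω : Set (Ed d)} (hK : IsCompact K) (hΩ : MeasurableSet Ω) (hKΩ : K ⊆ Ω)
    {Fn : ℕ → Ed d → ℝ} {F : Ed d → ℝ}
    (h : Conv1 d K Fn F) {ψ : Ed d → ℝ} (hψ : Continuous ψ) (hs : tsupport ψ ⊆ K) :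
    Tendsto (fun n => ∫ x, Fn n x * ψ x) atTop (𝓝 (∫ x in Ω, F x * ψ x)) := by
  have hz : ∀ x, x ∉ K → ψ x = 0 := fun x hx => image_eq_zero_of_notMem_tsupport fun h' => hx (hs h')
  have e1 : ∀ n, ∫ x, Fn n x * ψ x = ∫ x in K, Fn n x * ψ x := by
    intro n
    rw [setIntegral_eq_integral_of_forall_compl_eq_zero]
    intro x hx; rw [hz x hx, mul_zero]
  have e2 : ∫ x in Ω, F x * ψ x = ∫ x in K, F x * ψ x :=
    setIntegral_eq_of_subset_of_forall_sdiff_eq_zero hΩ hKΩ fun x hx => by rw [hz x hx.2, mul_zero]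
  simp_rw [e1, e2]
  obtain ⟨M, hM⟩ := hK.exists_bound_of_continuousOn hψ.continuousOn
  refine tendsto_integral_of_L1 _ (h.2.1.1.mul hψ.aestronglyMeasurable) ?_ ?_
  · exact Eventually.of_forall fun n => (((h.1 n).mul hψ).continuousOn.integrableOn_compact hK)
  · have := ENNReal.Tendsto.const_mul (a := ENNReal.ofReal M) h.2.2 (Or.inr ENNReal.ofReal_ne_top)
    rw [mul_zero] at this
    refine tendsto_of_tendsto_of_tendsto_of_le_of_le tendsto_const_nhds this
      (fun _ => zero_le) fun n => ?_
    rw [← lintegral_const_mul' _ _ ENNReal.ofReal_ne_top]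
    refine lintegral_mono_ae ?_
    filter_upwards [ae_restrict_mem hK.measurableSet] with x hx
    rw [Pi.mul_apply, ← sub_mul, enorm_mul, mul_comm]
    refine mul_le_mul' ?_ le_rfl
    rw [← ofReal_norm]
    exact ENNReal.ofReal_le_ofReal (hM x hx)

lemma prod_int {d m : ℕ} {p : ℝ} (hp : 1 ≤ p) (hm : 1 ≤ m) (halg : Alg d m p)
    {β γ : Fin d → ℕ} (hβγ : ∑ i, β i + ∑ i, γ i ≤ m) {x0 : Ed d} {r : ℝ} (hr : 0 < r)
    {D E : (Fin d → ℕ) → Ed d → ℝ} {f g : ℕ → Ed d → ℝ}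
    (hf : Appr d m p (cubeQ d x0 r) D f) (hg : Appr d m p (cubeQ d x0 r) E g)
    (hD : AllLp d m p (cubeQ d x0 r) D) (hE : AllLp d m p (cubeQ d x0 r) E) :
    Conv1 d (cubeQ d x0 r) (fun n x => pderivA d β (f n) x * pderivA d γ (g n) x)
      (fun x => D β x * E γ x) := by
  obtain ⟨C, hC, h⟩ := wlbe hp hm halg
  have hp0 : 0 < p := by linarith
  have hβ : β ∈ multiIdx d m := mem_multiIdx.2 (by omega)
  have hγ : γ ∈ multiIdx d m := mem_multiIdx.2 (by omega)
  set Q := cubeQ d x0 r with hQ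
  have hQc : IsCompact Q := cubeQ_compact d x0 r
  have hQt : volume Q ≠ ⊤ := hQc.measure_lt_top.ne
  set W := ENNReal.ofReal r ^ (((∑ i, β i + ∑ i, γ i : ℕ) : ℝ) * p + d) with hW
  have hWt : W ≠ ⊤ := w_ne_top hr _
  have hW0 : W ≠ 0 := by
    refine (ENNReal.rpow_pos ?_ ENNReal.ofReal_ne_top).ne'
    simpa using hr
  have hWi : W⁻¹ ≠ ⊤ := ENNReal.inv_ne_top.2 hW0
  have hDt := NQ_ne_top hp hr hD
  have hEt := NQ_ne_top hp hr hE
  have hvt : (volume Q) ^ (1 - 1 / p) ≠ ⊤ := by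
    refine ENNReal.rpow_ne_top_of_nonneg ?_ hQt
    rw [sub_nonneg, div_le_one hp0]; exact hp
  have sml : ∀ n, AllLp d m p Q (fun δ => pderivA d δ (f n)) := fun n δ _ =>
    cont_memLp ((hf.1 n).pA δ).continuous hQc
  have smg : ∀ n, AllLp d m p Q (fun δ => pderivA d δ (g n)) := fun n δ _ =>
    cont_memLp ((hg.1 n).pA δ).continuous hQc
  refine ⟨fun n => ((hf.1 n).pA β).continuous.mul ((hg.1 n).pA γ).continuous, ⟨(hD β hβ).1.mul (hE γ hγ).1, ?_⟩, ?_⟩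
  · unfold HasFiniteIntegral
    simp_rw [enorm_mul]
    refine (l1_le hp (hD β hβ).1 (hE γ hγ).1).trans_lt ?_
    refine ENNReal.mul_lt_top (ENNReal.rpow_lt_top_of_nonneg (by positivity) ?_) hvt.lt_top
    refine ne_top_of_le_ne_top ?_ (le_inv_mul_of hW0 hWt (h β γ hβγ x0 r hr D E f g hf hg hD hE))
    exact ENNReal.mul_ne_top hWi (ENNReal.mul_ne_top (ENNReal.mul_ne_top hC hDt) hEt)
  · have hdD : ∀ k, AllLp d m p Q (fun δ x => D δ x - pderivA d δ (f k) x) := fun k δ hδ =>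
      (hD δ hδ).sub (sml k δ hδ)
    have hdE : ∀ k, AllLp d m p Q (fun δ x => E δ x - pderivA d δ (g k) x) := fun k δ hδ =>
      (hE δ hδ).sub (smg k δ hδ)
    obtain ⟨U, hU, hUn⟩ := NQ_up hp hr hD hf
    set R1 : ℕ → ℝ≥0∞ := fun k => W⁻¹ * (C * NQ d m p x0 r (fun δ x => D δ x - pderivA d δ (f k) x) * NQ d m p x0 r E) with hR1
    set R2 : ℕ → ℝ≥0∞ := fun k => W⁻¹ * (C * U k * NQ d m p x0 r (fun δ x => E δ x - pderivA d δ (g k) x)) with hR2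
    have t1 : Tendsto R1 atTop (𝓝 0) := by
      have : Tendsto R1 atTop (𝓝 (W⁻¹ * (C * 0 * NQ d m p x0 r E))) :=
        ENNReal.Tendsto.const_mul (ENNReal.Tendsto.mul_const (ENNReal.Tendsto.const_mul (NQ_diff hp hr hf) (Or.inr hC)) (Or.inr hEt)) (Or.inr hWi)
      simpa using this
    have t2 : Tendsto R2 atTop (𝓝 0) := by
      have : Tendsto R2 atTop (𝓝 (W⁻¹ * (C * NQ d m p x0 r D * 0))) := by
        refine ENNReal.Tendsto.const_mul (ENNReal.Tendsto.mul (ENNReal.Tendsto.const_mul hU (Or.inr hC)) (Or.inr (by simp)) (NQ_diff hp hr hg) (Or.inr (ENNReal.mul_ne_top hC hDt))) (Or.inr hWi)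
      simpa using this
    have hip : 0 < 1 / p := by positivity
    have tt : Tendsto (fun n => (R1 n) ^ (1 / p) * (volume Q) ^ (1 - 1 / p) + (R2 n) ^ (1 / p) * (volume Q) ^ (1 - 1 / p)) atTop (𝓝 0) := by
      have := (ENNReal.Tendsto.mul_const (t1.ennrpow_const (1 / p)) (Or.inr hvt)).add
        (ENNReal.Tendsto.mul_const (t2.ennrpow_const (1 / p)) (Or.inr hvt))
      rw [ENNReal.zero_rpow_of_pos hip] at this
      simpa using this
    refine tendsto_of_tendsto_of_tendsto_of_le_of_le tendsto_const_nhds tt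
      (fun _ => zero_le) fun n => ?_
    have b1 : ∫⁻ x in Q, ‖D β x - pderivA d β (f n) x‖ₑ * ‖E γ x‖ₑ ≤ (R1 n) ^ (1 / p) * (volume Q) ^ (1 - 1 / p) := by
      refine (l1_le hp (hdD n β hβ).1 (hE γ hγ).1).trans (mul_le_mul' ?_ le_rfl)
      refine ENNReal.rpow_le_rpow ?_ hip.le
      exact le_inv_mul_of hW0 hWt (h β γ hβγ x0 r hr _ E _ g (hf.sub n) hg (hdD n) hE)
    have b2 : ∫⁻ x in Q, ‖pderivA d β (f n) x‖ₑ * ‖E γ x - pderivA d γ (g n) x‖ₑ ≤ (R2 n) ^ (1 / p) * (volume Q) ^ (1 - 1 / p) := by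
      refine (l1_le hp (sml n β hβ).1 (hdE n γ hγ).1).trans (mul_le_mul' ?_ le_rfl)
      refine ENNReal.rpow_le_rpow ?_ hip.le
      refine (le_inv_mul_of hW0 hWt (h β γ hβγ x0 r hr _ _ _ _ (Appr.const (hf.1 n)) (hg.sub n) (sml n) (hdE n))).trans ?_
      exact mul_le_mul' le_rfl (mul_le_mul' (mul_le_mul' le_rfl (hUn n)) le_rfl)
    refine le_trans ?_ (add_le_add b1 b2)
    have m1 : AEMeasurable (fun x => ‖D β x - pderivA d β (f n) x‖ₑ * ‖E γ x‖ₑ) (volume.restrict Q) :=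
      (hdD n β hβ).1.enorm.mul (hE γ hγ).1.enorm
    rw [← lintegral_add_left' m1]
    refine lintegral_mono fun x => ?_
    have : pderivA d β (f n) x * pderivA d γ (g n) x - D β x * E γ x =
      -((D β x - pderivA d β (f n) x) * E γ x + pderivA d β (f n) x * (E γ x - pderivA d γ (g n) x)) := by ring
    rw [this, enorm_neg]
    refine (enorm_add_le _ _).trans ?_
    rw [enorm_mul, enorm_mul]

lemma cube_nhds {d : ℕ} {Ω : Set (Ed d)} (hΩ : IsOpen Ω) {x : Ed d} (hx : x ∈ Ω) :
    ∃ (x0 : Ed d) (r : ℝ), 0 < r ∧ cubeQ d x0 r ⊆ Ω ∧ cubeQ d x0 r ∈ 𝓝 x := by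
  obtain ⟨ε, hε, hb⟩ := Metric.isOpen_iff.1 hΩ x hx
  set s : ℝ := ε / (4 * d + 4) / 2 with hs
  have hs0 : 0 < s := by positivity
  set x0 : Ed d := WithLp.toLp 2 (fun i => x i - s) with hx0
  have hxi : ∀ i, x0 i = x i - s := fun i => rfl
  have hmem : x ∈ cubeQ d x0 (2 * s) := by
    intro i; rw [hxi]; constructor <;> linarith
  refine ⟨x0, 2 * s, by positivity, fun y hy => hb ?_, ?_⟩
  · rw [Metric.mem_ball]
    have h1 := cubeQ_dist hy
    have h2 := cubeQ_dist hmem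
    have h3 := dist_triangle_right y x x0
    have h4 : (4 * (d:ℝ) + 4) * (2 * s) = ε := by
      rw [hs]; field_simp
    nlinarith [(Nat.cast_nonneg d : (0:ℝ) ≤ d)]
  · refine mem_of_superset (Metric.ball_mem_nhds x hs0) fun y hy i => ?_
    have h1 : dist (y i) (x i) ≤ dist y x := by
      rw [dist_eq_norm, dist_eq_norm]
      exact PiLp.norm_apply_le (y - x) i
    have h2 := h1.trans_lt (Metric.mem_ball.1 hy)
    rw [Real.dist_eq, abs_lt] at h2
    rw [hxi]; constructor <;> linarith [h2.1, h2.2]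

lemma weak_unique {d : ℕ} {Ω : Set (Ed d)} (hΩ : IsOpen Ω) {α : Fin d → ℕ} {u v v' : Ed d → ℝ}
    (h : HasWeakDerivOn d Ω α u v) (h' : HasWeakDerivOn d Ω α u v') :
    v =ᵐ[volume.restrict Ω] v' := by
  have hl : LocallyIntegrableOn (v - v') Ω := h.2.1.sub h'.2.1
  have := hΩ.ae_eq_zero_of_integral_contDiff_smul_eq_zero hl (fun g h1 h2 h3 => ?_)
  · rw [EventuallyEq, ae_restrict_iff' hΩ.measurableSet]
    filter_upwards [this] with x hx hxΩ
    exact sub_eq_zero.1 (hx hxΩ)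
  · have e1 := h.2.2 g ⟨h1, h2, h3⟩
    have e2 := h'.2.2 g ⟨h1, h2, h3⟩
    rw [e1] at e2
    have hne : ((-1 : ℝ) ^ (∑ i, α i)) ≠ 0 := by positivity
    have e3 := mul_left_cancel₀ hne e2
    have hz : ∀ x, x ∉ Ω → g x = 0 := fun x hx => image_eq_zero_of_notMem_tsupport fun h' => hx (h3 h')
    have e4 : ∫ x, g x • (v - v') x = ∫ x in Ω, g x • (v - v') x := by
      rw [setIntegral_eq_integral_of_forall_compl_eq_zero]
      intro x hx; simp [hz x hx]
    have ii : ∀ w : Ed d → ℝ, LocallyIntegrableOn w Ω → IntegrableOn (fun x => w x * g x) Ω := by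
      intro w hw
      have hi : IntegrableOn (fun x => w x * g x) (tsupport g) :=
        (hw.integrableOn_compact_subset h3 h2).mul_continuousOn h1.continuous.continuousOn h2
      refine hi.of_forall_sdiff_eq_zero hΩ.measurableSet fun x hx => ?_
      rw [image_eq_zero_of_notMem_tsupport hx.2, mul_zero]
    rw [e4]
    have e5 : ∀ x, g x • (v - v') x = v x * g x - v' x * g x := by
      intro x; simp only [smul_eq_mul, Pi.sub_apply]; ring
    simp_rw [e5]
    rw [integral_sub (ii v h.2.1) (ii v' h'.2.1), e3, sub_self]

lemma weak_zero {d m : ℕ} {Ω : Set (Ed d)} (hΩ : IsOpen Ω) {u : Ed d → ℝ} {D : (Fin d → ℕ) → Ed d → ℝ}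
    (hD : IsWeakDerivFamily d Ω m u D) : u =ᵐ[volume.restrict Ω] D 0 := by
  have h0 := hD 0 (by rw [mem_multiIdx]; simp)
  refine weak_unique hΩ (α := 0) (u := u) ⟨h0.1, h0.1, fun φ hφ => ?_⟩ h0
  simp [pderivA_zero]

/-- The multi-index pairs appearing in the Leibniz rule. -/
def Lz (d : ℕ) (α : Fin d → ℕ) : List ((Fin d → ℕ) × (Fin d → ℕ)) := (leibniz d α).choose

/-- The Leibniz expression. -/
def Wz (d : ℕ) (D E : (Fin d → ℕ) → Ed d → ℝ) (α : Fin d → ℕ) : Ed d → ℝ :=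
  fun x => ((Lz d α).map fun b => D b.1 x * E b.2 x).sum

lemma Lz_sum {d : ℕ} {α : Fin d → ℕ} {b : (Fin d → ℕ) × (Fin d → ℕ)} (hb : b ∈ Lz d α) :
    ∑ i, b.1 i + ∑ i, b.2 i = ∑ i, α i := (leibniz d α).choose_spec.1 b hb

lemma Lz_eq {d : ℕ} {α : Fin d → ℕ} {f g : Ed d → ℝ} (hf : Sm d f) (hg : Sm d g) :
    pderivA d α (fun x => f x * g x) =
      fun x => ((Lz d α).map (fun b => pderivA d b.1 f x * pderivA d b.2 g x)).sum :=
  (leibniz d α).choose_spec.2 f g hf hg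

lemma AllLp_of {d m : ℕ} {p : ℝ} {Ω K : Set (Ed d)} (hK : IsCompact K) (hKΩ : K ⊆ Ω)
    {D : (Fin d → ℕ) → Ed d → ℝ} (hL : LocLp d m p Ω D) : AllLp d m p K D := hL K hKΩ hK

lemma weak_prod {d m : ℕ} {p : ℝ} (hp : 1 ≤ p) (hm : 1 ≤ m) (halg : Alg d m p) {Ω : Set (Ed d)}
    (hΩ : IsOpen Ω) {u v : Ed d → ℝ} {D E : (Fin d → ℕ) → Ed d → ℝ}
    (hD : IsWeakDerivFamily d Ω m u D) (hE : IsWeakDerivFamily d Ω m v E)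
    (hDL : LocLp d m p Ω D) (hEL : LocLp d m p Ω E) :
    IsWeakDerivFamily d Ω m (u * v) (Wz d D E) := by
  have hu := weak_zero hΩ hD
  have hv := weak_zero hΩ hE
  have huv : u * v =ᵐ[volume.restrict Ω] fun x => D 0 x * E 0 x := by
    filter_upwards [hu, hv] with x h1 h2
    rw [Pi.mul_apply, h1, h2]
  have conv : ∀ (x0 : Ed d) (r : ℝ), 0 < r → cubeQ d x0 r ⊆ Ω → ∀ f g,
      Appr d m p (cubeQ d x0 r) D f → Appr d m p (cubeQ d x0 r) E g → ∀ β γ : Fin d → ℕ,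
      ∑ i, β i + ∑ i, γ i ≤ m →
      Conv1 d (cubeQ d x0 r) (fun n x => pderivA d β (f n) x * pderivA d γ (g n) x)
      (fun x => D β x * E γ x) := fun x0 r hr hQ f g hf hg β γ hβγ =>
    prod_int hp hm halg hβγ hr hf hg (AllLp_of (cubeQ_compact d x0 r) hQ hDL)
      (AllLp_of (cubeQ_compact d x0 r) hQ hEL)
  have z0 : ∑ i, (0 : Fin d → ℕ) i + ∑ i, (0 : Fin d → ℕ) i ≤ m := by simp
  intro α hα
  have hα' := mem_multiIdx.1 hα
  have hb : ∀ b ∈ Lz d α, ∑ i, b.1 i + ∑ i, b.2 i ≤ m := fun b hb => (Lz_sum hb).trans_le hα'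
  refine ⟨?_, ?_, ?_⟩
  · intro x hx
    obtain ⟨x0, r, hr, hQ, hn⟩ := cube_nhds hΩ hx
    refine ⟨cubeQ d x0 r, mem_nhdsWithin_of_mem_nhds hn, ?_⟩
    obtain ⟨f, hf⟩ := appr hp hΩ (cubeQ_compact d x0 r) hQ hD hDL
    obtain ⟨g, hg⟩ := appr hp hΩ (cubeQ_compact d x0 r) hQ hE hEL
    have := (conv x0 r hr hQ f g hf hg 0 0 z0).2.1
    exact this.congr (EventuallyEq.symm (ae_restrict_of_ae_restrict_of_subset hQ huv))
  · intro x hx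
    obtain ⟨x0, r, hr, hQ, hn⟩ := cube_nhds hΩ hx
    refine ⟨cubeQ d x0 r, mem_nhdsWithin_of_mem_nhds hn, ?_⟩
    obtain ⟨f, hf⟩ := appr hp hΩ (cubeQ_compact d x0 r) hQ hD hDL
    obtain ⟨g, hg⟩ := appr hp hΩ (cubeQ_compact d x0 r) hQ hE hEL
    exact (Conv1.list (Lz d α) fun b hb' => conv x0 r hr hQ f g hf hg b.1 b.2 (hb b hb')).2.1
  · rintro φ ⟨hφ, hc, hs⟩
    choose! X R hR hQ hn using fun x (hx : x ∈ Ω) => cube_nhds hΩ hx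
    obtain ⟨t, ht, hcov⟩ := hc.isCompact.elim_nhds_subcover (fun x => cubeQ d (X x) (R x))
      (fun x hx => hn x (hs hx))
    set K : Set (Ed d) := ⋃ x ∈ t, cubeQ d (X x) (R x) with hK
    have hKc : IsCompact K := t.isCompact_biUnion fun x _ => cubeQ_compact d _ _
    have hKΩ : K ⊆ Ω := iUnion₂_subset fun x hx => hQ x (hs (ht x hx))
    have hsub : ∀ x ∈ t, cubeQ d (X x) (R x) ⊆ K := fun x hx => subset_biUnion_of_mem (u := fun x => cubeQ d (X x) (R x)) hx
    obtain ⟨f, hf⟩ := appr hp hΩ hKc hKΩ hD hDL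
    obtain ⟨g, hg⟩ := appr hp hΩ hKc hKΩ hE hEL
    have convK : ∀ β γ : Fin d → ℕ, ∑ i, β i + ∑ i, γ i ≤ m →
      Conv1 d K (fun n x => pderivA d β (f n) x * pderivA d γ (g n) x) (fun x => D β x * E γ x) := by
      intro β γ hβγ
      refine Conv1.biUnion t (fun n => ((hf.1 n).pA β).continuous.mul ((hg.1 n).pA γ).continuous) fun x hx => ?_
      exact conv _ _ (hR x (hs (ht x hx))) (hQ x (hs (ht x hx))) f g (hf.mono (hsub x hx)) (hg.mono (hsub x hx)) β γ hβγ
    have hφs : Sm d φ := hφ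
    have T1 := (convK 0 0 z0).tendsto hKc hΩ.measurableSet hKΩ (hφs.pA α).continuous
      ((pderivA_tsupport hφs α).trans hcov)
    have T2 := (Conv1.list (Lz d α) fun b hb' => convK b.1 b.2 (hb b hb')).tendsto hKc hΩ.measurableSet hKΩ
      hφs.continuous hcov
    have T3 := T2.const_mul ((-1 : ℝ) ^ (∑ i, α i))
    have e : ∫ x in Ω, (u * v) x * pderivA d α φ x = ∫ x in Ω, D 0 x * E 0 x * pderivA d α φ x := by
      refine integral_congr_ae ?_
      filter_upwards [huv] with x hx
      rw [hx]
    rw [e]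
    refine tendsto_nhds_unique T1 (T3.congr fun n => ?_)
    have h1 := ibp_A ((hf.1 n).mul (hg.1 n)) hφs hc α
    rw [Lz_eq (hf.1 n) (hg.1 n)] at h1
    simp only [pderivA_zero]
    exact h1.symm

/-- `ρ` is 1-Lipschitz. -/
def Lip1 (d : ℕ) (ρ : Ed d → ℝ) : Prop := ∀ x y, |ρ x - ρ y| ≤ dist x y

lemma Lip1.continuous {d : ℕ} {ρ : Ed d → ℝ} (h : Lip1 d ρ) : Continuous ρ := by
  have : LipschitzWith 1 ρ := LipschitzWith.of_dist_le_mul fun x y => by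
    rw [Real.dist_eq, NNReal.coe_one, one_mul]; exact h x y
  exact this.continuous

lemma Q_rho {d : ℕ} (hd : 1 ≤ d) {ρ : Ed d → ℝ} (h : Lip1 d ρ) {x0 x : Ed d}
    (hx : x ∈ cubeQ d x0 (1 / (4 * d) * ρ x0)) : 3 / 4 * ρ x0 ≤ ρ x ∧ ρ x ≤ 5 / 4 * ρ x0 := by
  have h1 := cubeQ_dist hx
  have h2 := h x x0
  have hd' : (0:ℝ) < d := by exact_mod_cast hd
  have e : (d:ℝ) * (1 / (4 * d) * ρ x0) = ρ x0 / 4 := by field_simp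
  rw [e] at h1
  have h3 := abs_le.1 (h2.trans h1)
  constructor <;> linarith [h3.1, h3.2]

/-- the incidence set -/
def SS (d : ℕ) (ρ : Ed d → ℝ) : Set (Ed d × Ed d) :=
  {z | 0 < ρ z.1 ∧ z.2 ∈ cubeQ d z.1 (1 / (4 * d) * ρ z.1)}

lemma SS_meas {d : ℕ} {ρ : Ed d → ℝ} (h : Lip1 d ρ) : MeasurableSet (SS d ρ) := by
  have hc := h.continuous
  have e : SS d ρ = {z | 0 < ρ z.1} ∩ ⋂ i : Fin d, ({z | z.1 i ≤ z.2 i} ∩ {z | z.2 i ≤ z.1 i + 1 / (4 * d) * ρ z.1}) := by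
    ext z; simp [SS, cubeQ]
  rw [e]
  refine (measurableSet_lt measurable_const (hc.comp continuous_fst).measurable).inter
    (MeasurableSet.iInter fun i => MeasurableSet.inter ?_ ?_)
  · refine (isClosed_le ?_ ?_).measurableSet <;> fun_prop
  · refine (isClosed_le ?_ ?_).measurableSet <;> fun_prop

/-- kernel -/
def kk (d : ℕ) (ρ : Ed d → ℝ) (x0 : Ed d) : ℝ≥0∞ := (ENNReal.ofReal (ρ x0) ^ d)⁻¹

lemma kk_meas {d : ℕ} {ρ : Ed d → ℝ} (h : Lip1 d ρ) : Measurable (kk d ρ) := by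
  have := h.continuous.measurable
  unfold kk
  fun_prop

/-- inner integral -/
def JJ (d : ℕ) (ρ : Ed d → ℝ) (x : Ed d) : ℝ≥0∞ := ∫⁻ x0, (SS d ρ).indicator (fun z => kk d ρ z.1) (x0, x)

lemma ofReal_quot {d : ℕ} {s t : ℝ} (hs : 0 < s) (ht : 0 < t) :
    (ENNReal.ofReal s ^ d)⁻¹ * ENNReal.ofReal t ^ d = ENNReal.ofReal ((t / s) ^ d) := by
  rw [← ENNReal.ofReal_pow hs.le, ← ENNReal.ofReal_pow ht.le, ← ENNReal.ofReal_inv_of_pos (by positivity),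
    ← ENNReal.ofReal_mul (by positivity)]
  congr 1
  rw [div_pow]; field_simp

lemma cubeQ_shift {d : ℕ} {x x0 : Ed d} {s : ℝ} :
    x0 ∈ cubeQ d (WithLp.toLp 2 (fun i => x i - s)) s ↔ x ∈ cubeQ d x0 s := by
  simp only [cubeQ, mem_ofPred_eq, mem_Icc]
  refine forall_congr' fun i => ?_
  constructor
  · rintro ⟨h1, h2⟩; constructor <;> linarith
  · rintro ⟨h1, h2⟩; constructor <;> linarith

lemma JJ_lower {d : ℕ} (hd : 1 ≤ d) {ρ : Ed d → ℝ} (h : Lip1 d ρ) {x : Ed d} (hx : 0 < ρ x) :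
    ENNReal.ofReal ((1 / (16 * d)) ^ d) ≤ JJ d ρ x := by
  have hd' : (0:ℝ) < d := by exact_mod_cast hd
  set s : ℝ := 1 / (8 * d) * ρ x with hs
  have hs0 : 0 < s := by positivity
  set B := cubeQ d (WithLp.toLp 2 (fun i => x i - s)) s with hB
  have key : ∀ x0 ∈ B, (ENNReal.ofReal (2 * ρ x) ^ d)⁻¹ ≤ (SS d ρ).indicator (fun z => kk d ρ z.1) (x0, x) := by
    intro x0 hx0
    rw [hB, cubeQ_shift] at hx0
    have h1 := cubeQ_dist hx0
    have e : (d:ℝ) * s = ρ x / 8 := by rw [hs]; field_simp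
    rw [e] at h1
    have h3 := abs_le.1 ((h x x0).trans h1)
    have hm : (x0, x) ∈ SS d ρ := by
      refine ⟨by simp only; linarith [h3.2], fun i => ?_⟩
      have hi := hx0 i
      refine ⟨hi.1, hi.2.trans ?_⟩
      have : s ≤ 1 / (4 * d) * ρ x0 := by
        have : s = 1 / (4 * d) * (ρ x / 2) := by rw [hs]; field_simp; norm_num
        rw [this]
        gcongr
        linarith [h3.2]
      simp only
      linarith
    rw [indicator_of_mem hm]
    unfold kk
    refine ENNReal.inv_le_inv.2 (pow_le_pow_left' (ENNReal.ofReal_le_ofReal ?_) d)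
    simp only
    linarith [h3.1]
  calc ENNReal.ofReal ((1 / (16 * d)) ^ d) = (ENNReal.ofReal (2 * ρ x) ^ d)⁻¹ * volume B := by
        rw [hB, cubeQ_vol _ hs0, ofReal_quot (by positivity) hs0]
        congr 2
        rw [hs]; field_simp; norm_num
    _ = ∫⁻ x0 in B, (ENNReal.ofReal (2 * ρ x) ^ d)⁻¹ := by rw [setLIntegral_const]
    _ ≤ ∫⁻ x0 in B, (SS d ρ).indicator (fun z => kk d ρ z.1) (x0, x) :=
        setLIntegral_mono' (cubeQ_meas _ _ _) key
    _ ≤ _ := setLIntegral_le_lintegral _ _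

lemma JJ_upper {d : ℕ} (hd : 1 ≤ d) {ρ : Ed d → ℝ} (h : Lip1 d ρ) (x : Ed d) :
    JJ d ρ x ≤ {x | 0 < ρ x}.indicator (fun _ => 1) x := by
  have hd' : (0:ℝ) < d := by exact_mod_cast hd
  by_cases hx : 0 < ρ x
  swap
  · have : JJ d ρ x = 0 := by
      unfold JJ
      refine (lintegral_congr fun x0 => ?_).trans lintegral_zero
      refine indicator_of_notMem (fun hm => hx ?_) _
      have h1 : 0 < ρ x0 := hm.1
      have := (Q_rho hd h hm.2).1
      simp only at this
      linarith
    rw [this]; exact zero_le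
  rw [indicator_of_mem (by exact hx)]
  set s : ℝ := 1 / (2 * d) * ρ x with hs
  have hs0 : 0 < s := by positivity
  set B := cubeQ d (WithLp.toLp 2 (fun i => x i - s)) s with hB
  have key : ∀ x0, (SS d ρ).indicator (fun z => kk d ρ z.1) (x0, x) ≤
      B.indicator (fun _ => (ENNReal.ofReal (ρ x / 2) ^ d)⁻¹) x0 := by
    intro x0
    by_cases hm : (x0, x) ∈ SS d ρ
    swap
    · rw [indicator_of_notMem hm]; exact zero_le
    have h0 : 0 < ρ x0 := hm.1
    have hq : x ∈ cubeQ d x0 (1 / (4 * d) * ρ x0) := hm.2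
    have hr := Q_rho hd h hq
    have hxB : x0 ∈ B := by
      rw [hB, cubeQ_shift]
      intro i
      refine ⟨(hq i).1, (hq i).2.trans ?_⟩
      have : 1 / (4 * d) * ρ x0 ≤ s := by
        have : s = 1 / (4 * d) * (2 * ρ x) := by rw [hs]; field_simp; norm_num
        rw [this]
        gcongr
        linarith [hr.1]
      linarith
    rw [indicator_of_mem hm, indicator_of_mem hxB]
    unfold kk
    refine ENNReal.inv_le_inv.2 (pow_le_pow_left' (ENNReal.ofReal_le_ofReal ?_) d)
    simp only
    linarith [hr.2]
  calc JJ d ρ x ≤ ∫⁻ x0, B.indicator (fun _ => (ENNReal.ofReal (ρ x / 2) ^ d)⁻¹) x0 := lintegral_mono key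
    _ = (ENNReal.ofReal (ρ x / 2) ^ d)⁻¹ * volume B := by
        rw [lintegral_indicator (cubeQ_meas _ _ _), setLIntegral_const]
    _ = ENNReal.ofReal ((1 / d) ^ d) := by
        rw [hB, cubeQ_vol _ hs0, ofReal_quot (by positivity) hs0]
        congr 2
        rw [hs]; field_simp
    _ ≤ 1 := by
        rw [ENNReal.ofReal_le_one]
        refine pow_le_one₀ (by positivity) ?_
        rw [div_le_one hd']
        exact_mod_cast hd

lemma tonelli {d : ℕ} {ρ : Ed d → ℝ} (h : Lip1 d ρ) {H : Ed d → ℝ≥0∞} (hH : AEMeasurable H) :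
    ∫⁻ x0 in {x | 0 < ρ x}, kk d ρ x0 * ∫⁻ x in cubeQ d x0 (1 / (4 * d) * ρ x0), H x =
      ∫⁻ x, H x * JJ d ρ x := by
  have hO : MeasurableSet {x | 0 < ρ x} := measurableSet_lt measurable_const h.continuous.measurable
  have e1 : ∀ x0, {x | 0 < ρ x}.indicator (fun x0 => kk d ρ x0 * ∫⁻ x in cubeQ d x0 (1 / (4 * d) * ρ x0), H x) x0 =
      ∫⁻ x, H x * (SS d ρ).indicator (fun z => kk d ρ z.1) (x0, x) := by
    intro x0
    by_cases hx0 : 0 < ρ x0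
    · rw [indicator_of_mem (by exact hx0), ← lintegral_indicator (cubeQ_meas _ _ _)]
      have kt : kk d ρ x0 ≠ ⊤ := by
        unfold kk
        refine ENNReal.inv_ne_top.2 (pow_ne_zero _ ?_)
        simpa using hx0
      rw [← lintegral_const_mul' _ _ kt]
      refine lintegral_congr fun x => ?_
      by_cases hx : x ∈ cubeQ d x0 (1 / (4 * d) * ρ x0)
      · rw [indicator_of_mem hx, indicator_of_mem (show (x0, x) ∈ SS d ρ from ⟨hx0, hx⟩), mul_comm]
      · rw [indicator_of_notMem hx, indicator_of_notMem (fun hm : (x0, x) ∈ SS d ρ => hx hm.2)]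
        simp
    · rw [indicator_of_notMem (by exact hx0)]
      symm
      refine (lintegral_congr fun x => ?_).trans lintegral_zero
      rw [indicator_of_notMem (fun hm : (x0, x) ∈ SS d ρ => hx0 hm.1), mul_zero]
  rw [← lintegral_indicator hO]
  simp_rw [e1]
  have hind : Measurable ((SS d ρ).indicator (fun z => kk d ρ z.1)) :=
    ((kk_meas h).comp measurable_fst).indicator (SS_meas h)
  rw [lintegral_lintegral_swap]
  · refine lintegral_congr fun x => ?_
    unfold JJ
    rw [lintegral_const_mul]
    exact hind.comp (measurable_id.prodMk measurable_const)
  · exact (hH.comp_snd).mul hind.aemeasurable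

lemma G1 {d : ℕ} (hd : 1 ≤ d) {ρ : Ed d → ℝ} (h : Lip1 d ρ) {H : Ed d → ℝ≥0∞} (hH : AEMeasurable H) :
    ∫⁻ x in {x | 0 < ρ x}, H x ≤ (ENNReal.ofReal ((1 / (16 * d)) ^ d))⁻¹ *
    ∫⁻ x0 in {x | 0 < ρ x}, kk d ρ x0 * ∫⁻ x in cubeQ d x0 (1 / (4 * d) * ρ x0), H x := by
  have hO : MeasurableSet {x | 0 < ρ x} := measurableSet_lt measurable_const h.continuous.measurable
  have hd' : (0:ℝ) < d := by exact_mod_cast hd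
  refine le_inv_mul_of ?_ ENNReal.ofReal_ne_top ?_
  · have : 0 < ((1:ℝ) / (16 * d)) ^ d := by positivity
    exact (ENNReal.ofReal_pos.2 this).ne'
  rw [tonelli h hH, ← lintegral_const_mul' _ _ ENNReal.ofReal_ne_top]
  refine (setLIntegral_mono' hO fun x hx => ?_).trans (setLIntegral_le_lintegral _ _)
  rw [mul_comm]
  exact mul_le_mul' le_rfl (JJ_lower hd h hx)

lemma G2 {d : ℕ} (hd : 1 ≤ d) {ρ : Ed d → ℝ} (h : Lip1 d ρ) {H : Ed d → ℝ≥0∞} (hH : AEMeasurable H) :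
    ∫⁻ x0 in {x | 0 < ρ x}, kk d ρ x0 * ∫⁻ x in cubeQ d x0 (1 / (4 * d) * ρ x0), H x ≤
    ∫⁻ x in {x | 0 < ρ x}, H x := by
  have hO : MeasurableSet {x | 0 < ρ x} := measurableSet_lt measurable_const h.continuous.measurable
  rw [tonelli h hH, ← lintegral_indicator hO]
  refine lintegral_mono fun x => ?_
  refine (mul_le_mul' le_rfl (JJ_upper hd h x)).trans ?_
  by_cases hx : x ∈ {x | 0 < ρ x}
  · rw [indicator_of_mem hx, indicator_of_mem hx, mul_one]
  · rw [indicator_of_notMem hx, indicator_of_notMem hx, mul_zero]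

lemma pw_real {x y A : ℝ} (hx : 0 < x) (hy : 0 < y) (hA : 0 < A) (h1 : x ≤ A * y) (h2 : y ≤ A * x) (s : ℝ) :
    x ^ s ≤ A ^ |s| * y ^ s := by
  rcases le_total 0 s with hs | hs
  · rw [abs_of_nonneg hs, ← Real.mul_rpow hA.le hy.le]
    exact Real.rpow_le_rpow hx.le h1 hs
  · rw [abs_of_nonpos hs, Real.rpow_neg hA.le, ← Real.inv_rpow hA.le, ← Real.mul_rpow (by positivity) hy.le]
    refine Real.rpow_le_rpow_of_nonpos (by positivity) ?_ hs
    rw [inv_mul_le_iff₀ hA]; exact h2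

lemma pw {x y A : ℝ} (hx : 0 < x) (hy : 0 < y) (hA : 1 ≤ A) (h1 : x ≤ A * y) (h2 : y ≤ A * x) {s M : ℝ}
    (hs : |s| ≤ M) :
    ENNReal.ofReal x ^ s ≤ ENNReal.ofReal (A ^ M) * ENNReal.ofReal y ^ s := by
  rw [ENNReal.ofReal_rpow_of_pos hx, ENNReal.ofReal_rpow_of_pos hy, ← ENNReal.ofReal_mul (by positivity)]
  refine ENNReal.ofReal_le_ofReal ((pw_real hx hy (by linarith) h1 h2 s).trans ?_)
  gcongr

/-- weight -/
def ew (d : ℕ) (ρ : Ed d → ℝ) (s : ℝ) (x : Ed d) : ℝ≥0∞ := ENNReal.ofReal (ρ x) ^ s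

lemma ew_meas {d : ℕ} {ρ : Ed d → ℝ} (h : Lip1 d ρ) (s : ℝ) : Measurable (ew d ρ s) := by
  have := h.continuous.measurable
  unfold ew
  fun_prop

/-- the sum of all integrands -/
def HD (d m : ℕ) (ρ : Ed d → ℝ) (a p : ℝ) (D : (Fin d → ℕ) → Ed d → ℝ) (x : Ed d) : ℝ≥0∞ :=
  ∑ δ ∈ multiIdx d m, ew d ρ ((((∑ i, δ i : ℕ) : ℝ) - a) * p) x * ‖D δ x‖ₑ ^ p

lemma Q_comp {d : ℕ} (hd : 1 ≤ d) {ρ : Ed d → ℝ} (h : Lip1 d ρ) {x0 x : Ed d} (h0 : 0 < ρ x0)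
    (hx : x ∈ cubeQ d x0 (1 / (4 * d) * ρ x0)) {s M : ℝ} (hs : |s| ≤ M) :
    ew d ρ s x ≤ ENNReal.ofReal ((8 * d) ^ M) * ENNReal.ofReal (1 / (4 * d) * ρ x0) ^ s ∧
    ENNReal.ofReal (1 / (4 * d) * ρ x0) ^ s ≤ ENNReal.ofReal ((8 * d) ^ M) * ew d ρ s x := by
  have hr := Q_rho hd h hx
  have hd1 : (1:ℝ) ≤ d := by exact_mod_cast hd
  have hd' : (0:ℝ) < d := by linarith
  have hx0 : 0 < ρ x := by linarith
  have hA : (1:ℝ) ≤ 8 * d := by linarith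
  have a1 : ρ x ≤ 8 * d * (1 / (4 * d) * ρ x0) := by
    have : 8 * d * (1 / (4 * d) * ρ x0) = 2 * ρ x0 := by field_simp; norm_num
    rw [this]; linarith
  have a2 : 1 / (4 * d) * ρ x0 ≤ 8 * d * ρ x := by
    have : 1 / (4 * d) * ρ x0 ≤ 1 * ρ x0 := by
      gcongr
      rw [div_le_one (by positivity)]; linarith
    nlinarith
  exact ⟨pw hx0 (by positivity) hA a1 a2 hs, pw (by positivity) hx0 hA a2 a1 hs⟩

lemma Q_sub {d : ℕ} (hd : 1 ≤ d) {ρ : Ed d → ℝ} (h : Lip1 d ρ) {x0 : Ed d} (h0 : 0 < ρ x0) :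
    cubeQ d x0 (1 / (4 * d) * ρ x0) ⊆ {x | 0 < ρ x} := by
  intro x hx
  have := (Q_rho hd h hx).1
  change 0 < ρ x
  linarith

lemma ew_ne {d : ℕ} {ρ : Ed d → ℝ} {x : Ed d} (hx : 0 < ρ x) (s : ℝ) : ew d ρ s x ≠ ⊤ := w_ne_top hx s

lemma NQ_le_HD {d m : ℕ} (hd : 1 ≤ d) {ρ : Ed d → ℝ} (h : Lip1 d ρ) {a p : ℝ} (hp : 1 ≤ p) {x0 : Ed d} (h0 : 0 < ρ x0)
    {D : (Fin d → ℕ) → Ed d → ℝ} (hD : AllLp d m p (cubeQ d x0 (1 / (4 * d) * ρ x0)) D) :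
    ENNReal.ofReal (1 / (4 * d) * ρ x0) ^ (- (a * p)) * NQ d m p x0 (1 / (4 * d) * ρ x0) D ≤
      ENNReal.ofReal ((8 * d) ^ ((m + |a|) * p)) * ∫⁻ x in cubeQ d x0 (1 / (4 * d) * ρ x0), HD d m ρ a p D x := by
  have hd' : (0:ℝ) < d := by exact_mod_cast hd
  have hr : 0 < 1 / (4 * d) * ρ x0 := by positivity
  unfold NQ HD
  rw [lintegral_finsetSum', Finset.mul_sum, Finset.mul_sum]
  · refine Finset.sum_le_sum fun δ hδ => ?_
    rw [← mul_assoc, ← ENNReal.rpow_add _ _ (ENNReal.ofReal_pos.2 hr).ne' ENNReal.ofReal_ne_top,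
      ← lintegral_const_mul' _ _ (w_ne_top hr _), ← lintegral_const_mul' _ _ ENNReal.ofReal_ne_top]
    refine setLIntegral_mono' (cubeQ_meas _ _ _) fun x hx => ?_
    rw [← mul_assoc]
    refine mul_le_mul' ?_ le_rfl
    have e : -(a * p) + ((∑ i, δ i : ℕ) : ℝ) * p = (((∑ i, δ i : ℕ) : ℝ) - a) * p := by ring
    rw [e]
    refine (Q_comp hd h h0 hx ?_).2
    rw [abs_mul, abs_of_nonneg (by linarith : 0 ≤ p)]
    refine mul_le_mul_of_nonneg_right ?_ (by linarith)
    have h1 : ((∑ i, δ i : ℕ) : ℝ) ≤ m := by exact_mod_cast mem_multiIdx.1 hδ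
    refine (abs_sub _ _).trans ?_
    rw [abs_of_nonneg (Nat.cast_nonneg _)]
    linarith
  · intro δ hδ
    exact (ew_meas h _).aemeasurable.mul ((hD δ hδ).1.enorm.pow_const p)

lemma local_est {d m : ℕ} {p : ℝ} (hd : 1 ≤ d) (hp : 1 ≤ p) (hm : 1 ≤ m) (halg : Alg d m p) (a : ℝ) :
    ∃ C : ℝ≥0∞, C ≠ ⊤ ∧ ∀ ρ : Ed d → ℝ, Lip1 d ρ → ∀ u v D E,
      IsWeakDerivFamily d {x | 0 < ρ x} m u D → IsWeakDerivFamily d {x | 0 < ρ x} m v E →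
      LocLp d m p {x | 0 < ρ x} D → LocLp d m p {x | 0 < ρ x} E → ∀ β γ : Fin d → ℕ,
      ∑ i, β i + ∑ i, γ i ≤ m → ∀ x0, 0 < ρ x0 →
      ∫⁻ x in cubeQ d x0 (1 / (4 * d) * ρ x0),
        ew d ρ ((((∑ i, β i + ∑ i, γ i : ℕ) : ℝ) - (2 * a - d / p)) * p) x * (‖D β x‖ₑ ^ p * ‖E γ x‖ₑ ^ p) ≤
      C * (∫⁻ x in cubeQ d x0 (1 / (4 * d) * ρ x0), HD d m ρ a p D x) *
        ∫⁻ x in cubeQ d x0 (1 / (4 * d) * ρ x0), HD d m ρ a p E x := by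
  obtain ⟨C, hC, hw⟩ := wlbe hp hm halg
  have hp0 : 0 < p := by linarith
  set K := ENNReal.ofReal ((8 * d) ^ ((m + |a|) * p)) with hK
  set K2 := ENNReal.ofReal ((8 * d : ℝ) ^ ((m + |2 * a - d / p|) * p)) with hK2
  have hKt : K ≠ ⊤ := ENNReal.ofReal_ne_top
  have hKt2 : K2 ≠ ⊤ := ENNReal.ofReal_ne_top
  refine ⟨K2 * C * K * K, by finiteness, fun ρ h u v D E hD hE hDL hEL β γ hβγ x0 h0 => ?_⟩
  have hd' : (0:ℝ) < d := by exact_mod_cast hd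
  set r := 1 / (4 * d) * ρ x0 with hr
  have hr0 : 0 < r := by positivity
  set Q := cubeQ d x0 r with hQ
  have hO : IsOpen {x | 0 < ρ x} := isOpen_lt continuous_const h.continuous
  have hQc : IsCompact Q := cubeQ_compact _ _ _
  have hQs : Q ⊆ {x | 0 < ρ x} := Q_sub hd h h0
  obtain ⟨f, hf⟩ := appr hp hO hQc hQs hD hDL
  obtain ⟨g, hg⟩ := appr hp hO hQc hQs hE hEL
  have h1 := hw β γ hβγ x0 r hr0 D E f g hf hg (AllLp_of hQc hQs hDL) (AllLp_of hQc hQs hEL)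
  have hN1 := NQ_le_HD hd h (a := a) hp h0 (AllLp_of hQc hQs hDL)
  have hN2 := NQ_le_HD hd h (a := a) hp h0 (AllLp_of hQc hQs hEL)
  rw [← hr, ← hQ, ← hK] at hN1 hN2
  set n := ∑ i, β i + ∑ i, γ i with hn
  have w0 : ENNReal.ofReal r ≠ 0 := by simpa using hr0
  have hnm : (n : ℝ) ≤ m := by exact_mod_cast hβγ
  calc ∫⁻ x in Q, ew d ρ (((n : ℝ) - (2 * a - d / p)) * p) x * (‖D β x‖ₑ ^ p * ‖E γ x‖ₑ ^ p)
      ≤ ∫⁻ x in Q, K2 * ENNReal.ofReal r ^ (((n : ℝ) - (2 * a - d / p)) * p) * (‖D β x‖ₑ ^ p * ‖E γ x‖ₑ ^ p) := by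
        refine setLIntegral_mono' (cubeQ_meas _ _ _) fun x hx => mul_le_mul' ?_ le_rfl
        refine (Q_comp hd h h0 hx ?_).1
        rw [abs_mul, abs_of_nonneg hp0.le]
        refine mul_le_mul_of_nonneg_right ?_ hp0.le
        refine (abs_sub _ _).trans ?_
        rw [abs_of_nonneg (Nat.cast_nonneg _)]
        linarith
    _ = K2 * (ENNReal.ofReal r ^ (- (a * p)) * ENNReal.ofReal r ^ (- (a * p))) * (ENNReal.ofReal r ^ ((n : ℝ) * p + d) *
          ∫⁻ x in Q, ‖D β x‖ₑ ^ p * ‖E γ x‖ₑ ^ p) := by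
        rw [lintegral_const_mul' _ _ (ENNReal.mul_ne_top hKt2 (w_ne_top hr0 _))]
        have e : ((n : ℝ) - (2 * a - d / p)) * p = -(a * p) + -(a * p) + (n * p + d) := by
          field_simp; ring
        rw [e, ENNReal.rpow_add _ _ w0 ENNReal.ofReal_ne_top, ENNReal.rpow_add (-(a * p)) _ w0 ENNReal.ofReal_ne_top]
        ring
    _ ≤ K2 * (ENNReal.ofReal r ^ (- (a * p)) * ENNReal.ofReal r ^ (- (a * p))) *
          (C * NQ d m p x0 r D * NQ d m p x0 r E) := mul_le_mul' le_rfl h1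
    _ = K2 * C * (ENNReal.ofReal r ^ (- (a * p)) * NQ d m p x0 r D) * (ENNReal.ofReal r ^ (- (a * p)) * NQ d m p x0 r E) := by ring
    _ ≤ K2 * C * (K * ∫⁻ x in Q, HD d m ρ a p D x) * (K * ∫⁻ x in Q, HD d m ρ a p E x) :=
        mul_le_mul' (mul_le_mul' le_rfl hN1) hN2
    _ = _ := by ring

lemma global_est {d m : ℕ} {p : ℝ} (hd : 1 ≤ d) (hp : 1 ≤ p) (hm : 1 ≤ m) (halg : Alg d m p) (a : ℝ) :
    ∃ C : ℝ≥0∞, C ≠ ⊤ ∧ ∀ ρ : Ed d → ℝ, Lip1 d ρ → ∀ u v D E,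
      IsWeakDerivFamily d {x | 0 < ρ x} m u D → IsWeakDerivFamily d {x | 0 < ρ x} m v E →
      LocLp d m p {x | 0 < ρ x} D → LocLp d m p {x | 0 < ρ x} E → 
      ∫⁻ x in {x | 0 < ρ x}, HD d m ρ a p E x ≠ ⊤ → ∀ β γ : Fin d → ℕ,
      ∑ i, β i + ∑ i, γ i ≤ m → 
      ∫⁻ x in {x | 0 < ρ x},
        ew d ρ ((((∑ i, β i + ∑ i, γ i : ℕ) : ℝ) - (2 * a - d / p)) * p) x * (‖D β x‖ₑ ^ p * ‖E γ x‖ₑ ^ p) ≤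
      C * (∫⁻ x in {x | 0 < ρ x}, HD d m ρ a p D x) * ∫⁻ x in {x | 0 < ρ x}, HD d m ρ a p E x := by
  obtain ⟨C, hC, hl⟩ := local_est hd hp hm halg a
  have hd' : (0:ℝ) < d := by exact_mod_cast hd
  set c1 := (ENNReal.ofReal ((1 / (16 * d)) ^ d))⁻¹ with hc1
  have hc1t : c1 ≠ ⊤ := by
    refine ENNReal.inv_ne_top.2 ?_
    have : 0 < ((1:ℝ) / (16 * d)) ^ d := by positivity
    exact (ENNReal.ofReal_pos.2 this).ne'
  refine ⟨c1 * C, by finiteness, fun ρ h u v D E hD hE hDL hEL hEt β γ hβγ => ?_⟩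
  set Ω := {x | 0 < ρ x} with hΩ
  have hO : IsOpen Ω := isOpen_lt continuous_const h.continuous
  have mD : ∀ δ ∈ multiIdx d m, AEStronglyMeasurable (D δ) (volume.restrict Ω) := fun δ hδ =>
    (hD δ hδ).2.1.aestronglyMeasurable
  have mE : ∀ δ ∈ multiIdx d m, AEStronglyMeasurable (E δ) (volume.restrict Ω) := fun δ hδ =>
    (hE δ hδ).2.1.aestronglyMeasurable
  have hβ : β ∈ multiIdx d m := mem_multiIdx.2 (by omega)
  have hγ : γ ∈ multiIdx d m := mem_multiIdx.2 (by omega)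
  have mHD : AEMeasurable (HD d m ρ a p D) (volume.restrict Ω) := by
    unfold HD
    refine Finset.aemeasurable_fun_sum _ fun δ hδ => ?_
    exact (ew_meas h _).aemeasurable.mul ((mD δ hδ).enorm.pow_const p)
  set F := fun x => ew d ρ ((((∑ i, β i + ∑ i, γ i : ℕ) : ℝ) - (2 * a - d / p)) * p) x * (‖D β x‖ₑ ^ p * ‖E γ x‖ₑ ^ p) with hF
  have mF : AEMeasurable F (volume.restrict Ω) :=
    (ew_meas h _).aemeasurable.mul (((mD β hβ).enorm.pow_const p).mul ((mE γ hγ).enorm.pow_const p))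
  have mF' : AEMeasurable (Ω.indicator F) := (aemeasurable_indicator_iff hO.measurableSet).2 mF
  have mH' : AEMeasurable (Ω.indicator (HD d m ρ a p D)) := (aemeasurable_indicator_iff hO.measurableSet).2 mHD
  have onQ : ∀ (G : Ed d → ℝ≥0∞) (x0 : Ed d), x0 ∈ Ω → ∫⁻ x in cubeQ d x0 (1 / (4 * d) * ρ x0), Ω.indicator G x =
      ∫⁻ x in cubeQ d x0 (1 / (4 * d) * ρ x0), G x := fun G x0 hx0 =>
    setLIntegral_congr_fun (cubeQ_meas _ _ _) fun x hx => indicator_of_mem (Q_sub hd h hx0 hx) _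
  have onO : ∀ (G : Ed d → ℝ≥0∞), ∫⁻ x in Ω, Ω.indicator G x = ∫⁻ x in Ω, G x := fun G =>
    setLIntegral_congr_fun hO.measurableSet fun x hx => indicator_of_mem hx _
  have g1 := G1 hd h mF'
  have g2 := G2 hd h mH'
  rw [← hΩ, onO] at g1 g2
  rw [← hc1] at g1
  set GE := ∫⁻ x in Ω, HD d m ρ a p E x with hGE
  refine g1.trans ?_
  have step : ∫⁻ x0 in Ω, kk d ρ x0 * ∫⁻ x in cubeQ d x0 (1 / (4 * d) * ρ x0), Ω.indicator F x ≤
      ∫⁻ x0 in Ω, (C * GE) * (kk d ρ x0 * ∫⁻ x in cubeQ d x0 (1 / (4 * d) * ρ x0), Ω.indicator (HD d m ρ a p D) x) := by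
    refine setLIntegral_mono' hO.measurableSet fun x0 hx0 => ?_
    rw [onQ _ _ hx0, onQ _ _ hx0]
    have l1 := hl ρ h u v D E hD hE hDL hEL β γ hβγ x0 hx0
    have l2 : ∫⁻ x in cubeQ d x0 (1 / (4 * d) * ρ x0), HD d m ρ a p E x ≤ GE :=
      lintegral_mono_set (Q_sub hd h hx0)
    calc _ ≤ kk d ρ x0 * (C * (∫⁻ x in cubeQ d x0 (1 / (4 * d) * ρ x0), HD d m ρ a p D x) * GE) :=
          mul_le_mul' le_rfl (l1.trans (mul_le_mul' le_rfl l2))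
      _ = _ := by ring
  refine (mul_le_mul' le_rfl step).trans ?_
  rw [lintegral_const_mul' _ _ (ENNReal.mul_ne_top hC hEt)]
  calc _ ≤ c1 * (C * GE * ∫⁻ x in Ω, HD d m ρ a p D x) := mul_le_mul' le_rfl (mul_le_mul' le_rfl g2)
    _ = _ := by ring

lemma list_rpow {p : ℝ} (hp : 1 ≤ p) {ι : Type*} (L : List ι) :
    ∃ C : ℝ≥0∞, C ≠ ⊤ ∧ ∀ f : ι → ℝ, ‖(L.map f).sum‖ₑ ^ p ≤ C * (L.map fun i => ‖f i‖ₑ ^ p).sum := by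
  have hp0 : 0 < p := by linarith
  induction L with
  | nil => exact ⟨0, by simp, fun f => by simp [hp0]⟩
  | cons b L ih =>
    obtain ⟨C, hC, h⟩ := ih
    have h2 : (2 : ℝ≥0∞) ^ (p - 1) ≠ ⊤ := ENNReal.rpow_ne_top_of_nonneg (by linarith) (by simp)
    refine ⟨2 ^ (p - 1) * (1 + C), by finiteness, fun f => ?_⟩
    simp only [List.map_cons, List.sum_cons]
    calc ‖f b + (L.map f).sum‖ₑ ^ p ≤ (‖f b‖ₑ + ‖(L.map f).sum‖ₑ) ^ p :=
          ENNReal.rpow_le_rpow (enorm_add_le _ _) hp0.le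
      _ ≤ 2 ^ (p - 1) * (‖f b‖ₑ ^ p + ‖(L.map f).sum‖ₑ ^ p) := ENNReal.rpow_add_le_mul_rpow_add_rpow _ _ hp
      _ ≤ 2 ^ (p - 1) * ((1 + C) * ‖f b‖ₑ ^ p + (1 + C) * (L.map fun i => ‖f i‖ₑ ^ p).sum) := by
          refine mul_le_mul' le_rfl (add_le_add ?_ ((h f).trans (mul_le_mul' le_add_self le_rfl)))
          exact le_mul_of_one_le_left' le_self_add
      _ = _ := by ring

lemma list_lint {d : ℕ} {μ : Measure (Ed d)} {ι : Type*} (L : List ι) {F : ι → Ed d → ℝ≥0∞} {B : ℝ≥0∞}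
    (hF : ∀ b ∈ L, AEMeasurable (F b) μ) (hB : ∀ b ∈ L, ∫⁻ x, F b x ∂μ ≤ B) :
    ∫⁻ x, (L.map fun b => F b x).sum ∂μ ≤ L.length * B := by
  induction L with
  | nil => simp
  | cons b L ih =>
    simp only [List.map_cons, List.sum_cons, List.length_cons, Nat.cast_add, Nat.cast_one]
    rw [lintegral_add_left' (hF b (by simp)), add_mul, one_mul, add_comm]
    exact add_le_add (ih (fun i hi => hF i (by simp [hi])) (fun i hi => hB i (by simp [hi]))) (hB b (by simp))

lemma prod_est {d m : ℕ} {p : ℝ} (hd : 1 ≤ d) (hp : 1 ≤ p) (hm : 1 ≤ m) (halg : Alg d m p) (a : ℝ) :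
    ∃ C : ℝ≥0∞, C ≠ ⊤ ∧ ∀ ρ : Ed d → ℝ, Lip1 d ρ → ∀ u v D E,
      IsWeakDerivFamily d {x | 0 < ρ x} m u D → IsWeakDerivFamily d {x | 0 < ρ x} m v E →
      LocLp d m p {x | 0 < ρ x} D → LocLp d m p {x | 0 < ρ x} E → 
      ∫⁻ x in {x | 0 < ρ x}, HD d m ρ a p E x ≠ ⊤ →
      ∑ α ∈ multiIdx d m, ∫⁻ x in {x | 0 < ρ x},
        ew d ρ ((((∑ i, α i : ℕ) : ℝ) - (2 * a - d / p)) * p) x * ‖Wz d D E α x‖ₑ ^ p ≤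
      C * (∫⁻ x in {x | 0 < ρ x}, HD d m ρ a p D x) * ∫⁻ x in {x | 0 < ρ x}, HD d m ρ a p E x := by
  obtain ⟨C, hC, hg⟩ := global_est hd hp hm halg a
  choose c hc hcl using fun α : Fin d → ℕ => list_rpow hp (Lz d α)
  refine ⟨∑ α ∈ multiIdx d m, c α * ((Lz d α).length * C), ?_, fun ρ h u v D E hD hE hDL hEL hEt => ?_⟩
  · refine ENNReal.sum_ne_top.2 fun α _ => ENNReal.mul_ne_top (hc α) (ENNReal.mul_ne_top (by simp) hC)
  rw [mul_assoc, Finset.sum_mul]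
  refine Finset.sum_le_sum fun α hα => ?_
  have hα' := mem_multiIdx.1 hα
  set Ω := {x | 0 < ρ x} with hΩ
  have hO : IsOpen Ω := isOpen_lt continuous_const h.continuous
  have mD : ∀ δ ∈ multiIdx d m, AEStronglyMeasurable (D δ) (volume.restrict Ω) := fun δ hδ =>
    (hD δ hδ).2.1.aestronglyMeasurable
  have mE : ∀ δ ∈ multiIdx d m, AEStronglyMeasurable (E δ) (volume.restrict Ω) := fun δ hδ =>
    (hE δ hδ).2.1.aestronglyMeasurable
  set F : ((Fin d → ℕ) × (Fin d → ℕ)) → Ed d → ℝ≥0∞ := fun b x =>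
    ew d ρ ((((∑ i, α i : ℕ) : ℝ) - (2 * a - d / p)) * p) x * (‖D b.1 x‖ₑ ^ p * ‖E b.2 x‖ₑ ^ p) with hF
  have mF : ∀ b ∈ Lz d α, AEMeasurable (F b) (volume.restrict Ω) := by
    intro b hb
    have hs := Lz_sum hb
    exact (ew_meas h _).aemeasurable.mul (((mD b.1 (mem_multiIdx.2 (by omega))).enorm.pow_const p).mul
      ((mE b.2 (mem_multiIdx.2 (by omega))).enorm.pow_const p))
  have bF := list_lint (μ := volume.restrict Ω) (Lz d α) mF (B := C * (∫⁻ x in Ω, HD d m ρ a p D x) * ∫⁻ x in Ω, HD d m ρ a p E x)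
    (fun b hb => by
      have hs := Lz_sum hb
      have := hg ρ h u v D E hD hE hDL hEL hEt b.1 b.2 (hs.trans_le hα')
      rw [hs] at this
      exact this)
  calc ∫⁻ x in Ω, ew d ρ ((((∑ i, α i : ℕ) : ℝ) - (2 * a - d / p)) * p) x * ‖Wz d D E α x‖ₑ ^ p
      ≤ ∫⁻ x in Ω, c α * ((Lz d α).map fun b => F b x).sum := by
        refine lintegral_mono fun x => ?_
        have h1 := hcl α (fun b => D b.1 x * E b.2 x)
        simp_rw [enorm_mul, ENNReal.mul_rpow_of_nonneg _ _ (by linarith : 0 ≤ p)] at h1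
        refine (mul_le_mul' le_rfl h1).trans (le_of_eq ?_)
        rw [hF]
        simp only [List.sum_map_mul_left]
        ring
    _ = c α * ∫⁻ x in Ω, ((Lz d α).map fun b => F b x).sum := lintegral_const_mul' _ _ (hc α)
    _ ≤ c α * ((Lz d α).length * (C * (∫⁻ x in Ω, HD d m ρ a p D x) * ∫⁻ x in Ω, HD d m ρ a p E x)) :=
        mul_le_mul' le_rfl bF
    _ = _ := by ring

lemma kI_eq {d : ℕ} {ρ : Ed d → ℝ} {a p : ℝ} (hp : 1 ≤ p) (α : Fin d → ℕ) (v : Ed d → ℝ) {x : Ed d} (hx : 0 < ρ x) :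
    ENNReal.ofReal (kIntegrand d ρ a p α v x) = ew d ρ ((((∑ i, α i : ℕ) : ℝ) - a) * p) x * ‖v x‖ₑ ^ p := by
  have hp0 : 0 ≤ p := by linarith
  unfold kIntegrand ew
  rw [← ENNReal.ofReal_rpow_of_nonneg (by positivity) hp0, ENNReal.ofReal_mul (by positivity),
    ENNReal.mul_rpow_of_nonneg _ _ hp0, ← ENNReal.ofReal_rpow_of_pos hx, ← ENNReal.rpow_mul, ← Real.norm_eq_abs, ofReal_norm]

lemma kI_nonneg {d : ℕ} {ρ : Ed d → ℝ} {a p : ℝ} (α : Fin d → ℕ) (v : Ed d → ℝ) {x : Ed d} (hx : 0 < ρ x) :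
    0 ≤ kIntegrand d ρ a p α v x := by
  unfold kIntegrand
  positivity

lemma kI_meas {d : ℕ} {ρ : Ed d → ℝ} (h : Lip1 d ρ) {a p : ℝ} (α : Fin d → ℕ) {v : Ed d → ℝ} {μ : Measure (Ed d)}
    (hv : AEStronglyMeasurable v μ) : AEStronglyMeasurable (kIntegrand d ρ a p α v) μ := by
  have m1 := h.continuous.measurable
  have m2 := hv.aemeasurable
  unfold kIntegrand
  refine AEMeasurable.aestronglyMeasurable ?_
  have m3 : AEMeasurable (fun x => |v x|) μ := hv.norm.aemeasurable
  have m4 : AEMeasurable (fun x => ρ x ^ (((∑ i, α i : ℕ) : ℝ) - a)) μ := (m1.pow_const _).aemeasurable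
  exact (m4.mul m3).pow_const p

lemma kI_lint {d : ℕ} {ρ : Ed d → ℝ} (h : Lip1 d ρ) {a p : ℝ} (hp : 1 ≤ p) (α : Fin d → ℕ) (v : Ed d → ℝ) :
    ∫⁻ x in {x | 0 < ρ x}, ENNReal.ofReal (kIntegrand d ρ a p α v x) =
      ∫⁻ x in {x | 0 < ρ x}, ew d ρ ((((∑ i, α i : ℕ) : ℝ) - a) * p) x * ‖v x‖ₑ ^ p :=
  setLIntegral_congr_fun (isOpen_lt continuous_const h.continuous).measurableSet fun _ hx => kI_eq hp α v hx

lemma kI_int {d : ℕ} {ρ : Ed d → ℝ} (h : Lip1 d ρ) {a p : ℝ} (hp : 1 ≤ p) (α : Fin d → ℕ) {v : Ed d → ℝ}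
    (hv : AEStronglyMeasurable v (volume.restrict {x | 0 < ρ x})) :
    ∫ x in {x | 0 < ρ x}, kIntegrand d ρ a p α v x =
      (∫⁻ x in {x | 0 < ρ x}, ew d ρ ((((∑ i, α i : ℕ) : ℝ) - a) * p) x * ‖v x‖ₑ ^ p).toReal := by
  rw [← kI_lint h hp, integral_eq_lintegral_of_nonneg_ae _ (kI_meas h α hv)]
  filter_upwards [ae_restrict_mem (isOpen_lt continuous_const h.continuous).measurableSet] with x hx
  exact kI_nonneg α v hx

lemma kI_integrable {d : ℕ} {ρ : Ed d → ℝ} (h : Lip1 d ρ) {a p : ℝ} (hp : 1 ≤ p) (α : Fin d → ℕ) {v : Ed d → ℝ}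
    (hv : AEStronglyMeasurable v (volume.restrict {x | 0 < ρ x})) :
    IntegrableOn (kIntegrand d ρ a p α v) {x | 0 < ρ x} ↔
      ∫⁻ x in {x | 0 < ρ x}, ew d ρ ((((∑ i, α i : ℕ) : ℝ) - a) * p) x * ‖v x‖ₑ ^ p ≠ ⊤ := by
  have hn : 0 ≤ᵐ[volume.restrict {x | 0 < ρ x}] kIntegrand d ρ a p α v := by
    filter_upwards [ae_restrict_mem (isOpen_lt continuous_const h.continuous).measurableSet] with x hx
    exact kI_nonneg α v hx
  rw [← kI_lint h hp, ← lt_top_iff_ne_top, ← hasFiniteIntegral_iff_ofReal hn]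
  exact ⟨fun H => H.2, fun H => ⟨kI_meas h α hv, H⟩⟩

lemma kI_locLp {d m : ℕ} {ρ : Ed d → ℝ} (h : Lip1 d ρ) {a p : ℝ} (hp : 1 ≤ p) {u : Ed d → ℝ}
    {D : (Fin d → ℕ) → Ed d → ℝ} (hD : KMemData d {x | 0 < ρ x} ρ m a p u D) :
    LocLp d m p {x | 0 < ρ x} D := by
  intro K hK hKc β hβ
  have hp0 : 0 < p := by linarith
  have mD : AEStronglyMeasurable (D β) (volume.restrict {x | 0 < ρ x}) := (hD.1 β hβ).2.1.aestronglyMeasurable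
  refine ⟨mD.mono_measure (Measure.restrict_mono hK le_rfl), ?_⟩
  have hfin := (kI_integrable h hp β mD).1 (hD.2 β hβ)
  set s := (((∑ i, β i : ℕ) : ℝ) - a) * p with hs
  have hcont : ContinuousOn (fun x => ρ x ^ (-s)) K :=
    h.continuous.continuousOn.rpow_const fun x hx => Or.inl (ne_of_gt (hK hx))
  obtain ⟨B, hB⟩ := hKc.exists_bound_of_continuousOn hcont
  have key : ∫⁻ x in K, ‖D β x‖ₑ ^ p ≤ ENNReal.ofReal B * ∫⁻ x in {x | 0 < ρ x}, ew d ρ s x * ‖D β x‖ₑ ^ p := by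
    refine le_trans ?_ (mul_le_mul' le_rfl (lintegral_mono_set hK))
    rw [← lintegral_const_mul' _ _ ENNReal.ofReal_ne_top]
    refine setLIntegral_mono' hKc.measurableSet fun x hx => ?_
    have hx0 : 0 < ρ x := hK hx
    have e : ENNReal.ofReal (ρ x ^ (-s)) * ew d ρ s x = 1 := by
      unfold ew
      rw [← ENNReal.ofReal_rpow_of_pos hx0, ← ENNReal.rpow_add _ _ (ENNReal.ofReal_pos.2 hx0).ne' ENNReal.ofReal_ne_top]
      simp
    calc ‖D β x‖ₑ ^ p = ENNReal.ofReal (ρ x ^ (-s)) * ew d ρ s x * ‖D β x‖ₑ ^ p := by rw [e, one_mul]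
      _ ≤ ENNReal.ofReal B * ew d ρ s x * ‖D β x‖ₑ ^ p := by
          refine mul_le_mul' (mul_le_mul' (ENNReal.ofReal_le_ofReal ?_) le_rfl) le_rfl
          exact (le_abs_self _).trans (hB x hx)
      _ = _ := by ring
  rw [← eLpNorm_pow hp] at key
  have hlt := key.trans_lt (ENNReal.mul_lt_top ENNReal.ofReal_lt_top hfin.lt_top)
  by_contra hcon
  rw [not_lt, top_le_iff] at hcon
  rw [hcon, ENNReal.top_rpow_of_pos hp0] at hlt
  exact lt_irrefl _ hlt

lemma KnormP_eq {d m : ℕ} {ρ : Ed d → ℝ} (h : Lip1 d ρ) {a p : ℝ} (hp : 1 ≤ p) {u : Ed d → ℝ}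
    {D : (Fin d → ℕ) → Ed d → ℝ} (hD : KMemData d {x | 0 < ρ x} ρ m a p u D) :
    KnormP d {x | 0 < ρ x} ρ m a p D = (∑ α ∈ multiIdx d m, ∫⁻ x in {x | 0 < ρ x},
      ew d ρ ((((∑ i, α i : ℕ) : ℝ) - a) * p) x * ‖D α x‖ₑ ^ p).toReal ^ (1 / p) := by
  unfold KnormP
  congr 1
  have mD : ∀ δ ∈ multiIdx d m, AEStronglyMeasurable (D δ) (volume.restrict {x | 0 < ρ x}) := fun δ hδ =>
    (hD.1 δ hδ).2.1.aestronglyMeasurable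
  rw [ENNReal.toReal_sum fun α hα => (kI_integrable h hp α (mD α hα)).1 (hD.2 α hα)]
  exact Finset.sum_congr rfl fun α hα => kI_int h hp α (mD α hα)

lemma HD_eq {d m : ℕ} {ρ : Ed d → ℝ} (h : Lip1 d ρ) {a p : ℝ} {u : Ed d → ℝ}
    {D : (Fin d → ℕ) → Ed d → ℝ} (hD : KMemData d {x | 0 < ρ x} ρ m a p u D) :
    ∫⁻ x in {x | 0 < ρ x}, HD d m ρ a p D x = ∑ α ∈ multiIdx d m, ∫⁻ x in {x | 0 < ρ x},
      ew d ρ ((((∑ i, α i : ℕ) : ℝ) - a) * p) x * ‖D α x‖ₑ ^ p := by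
  unfold HD
  rw [lintegral_finsetSum']
  intro δ hδ
  exact (ew_meas h _).aemeasurable.mul (((hD.1 δ hδ).2.1.aestronglyMeasurable).enorm.pow_const p)

lemma Knorm_eq {d m : ℕ} {ρ : Ed d → ℝ} (h : Lip1 d ρ) {a p : ℝ} {u : Ed d → ℝ}
    {D : (Fin d → ℕ) → Ed d → ℝ} (hD : KMemData d {x | 0 < ρ x} ρ m a p u D) :
    Knorm d {x | 0 < ρ x} ρ m a p u = KnormP d {x | 0 < ρ x} ρ m a p D := by
  have hM : MemK d {x | 0 < ρ x} ρ m a p u := ⟨D, hD⟩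
  unfold Knorm
  rw [dif_pos hM]
  unfold KnormP
  congr 1
  refine Finset.sum_congr rfl fun α hα => integral_congr_ae ?_
  have := weak_unique (isOpen_lt continuous_const h.continuous) (hM.choose_spec.1 α hα) (hD.1 α hα)
  filter_upwards [this] with x hx
  unfold kIntegrand
  rw [hx]

lemma main_gen {d m : ℕ} {p : ℝ} (hd : 1 ≤ d) (hp : 1 ≤ p) (hm : 1 ≤ m) (halg : Alg d m p) (a : ℝ) :
    ∃ c : ℝ, 0 < c ∧ ∀ ρ : Ed d → ℝ, Lip1 d ρ → ∀ u v : Ed d → ℝ,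
      MemK d {x | 0 < ρ x} ρ m a p u → MemK d {x | 0 < ρ x} ρ m a p v →
      MemK d {x | 0 < ρ x} ρ m (2 * a - d / p) p (u * v) ∧
      Knorm d {x | 0 < ρ x} ρ m (2 * a - d / p) p (u * v) ≤
        c * Knorm d {x | 0 < ρ x} ρ m a p u * Knorm d {x | 0 < ρ x} ρ m a p v := by
  obtain ⟨C, hC, hmain⟩ := prod_est hd hp hm halg a
  have hp0 : 0 < p := by linarith
  refine ⟨C.toReal ^ (1 / p) + 1, by positivity, ?_⟩
  rintro ρ h u v ⟨D, hD⟩ ⟨E, hE⟩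
  have hO : IsOpen {x | 0 < ρ x} := isOpen_lt continuous_const h.continuous
  have hDL := kI_locLp h hp hD
  have hEL := kI_locLp h hp hE
  have fin : ∀ {w : Ed d → ℝ} {G : (Fin d → ℕ) → Ed d → ℝ}, KMemData d {x | 0 < ρ x} ρ m a p w G →
      ∫⁻ x in {x | 0 < ρ x}, HD d m ρ a p G x ≠ ⊤ := by
    intro w G hG
    rw [HD_eq h hG]
    exact ENNReal.sum_ne_top.2 fun α hα => (kI_integrable h hp α (hG.1 α hα).2.1.aestronglyMeasurable).1 (hG.2 α hα)
  have hW := weak_prod hp hm halg hO hD.1 hE.1 hDL hEL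
  have hest := hmain ρ h u v D E hD.1 hE.1 hDL hEL (fin hE)
  have htop : C * (∫⁻ x in {x | 0 < ρ x}, HD d m ρ a p D x) * ∫⁻ x in {x | 0 < ρ x}, HD d m ρ a p E x ≠ ⊤ :=
    ENNReal.mul_ne_top (ENNReal.mul_ne_top hC (fin hD)) (fin hE)
  have hsum := ne_top_of_le_ne_top htop hest
  have hKW : KMemData d {x | 0 < ρ x} ρ m (2 * a - d / p) p (u * v) (Wz d D E) := by
    refine ⟨hW, fun α hα => ?_⟩
    rw [kI_integrable h hp α (hW α hα).2.1.aestronglyMeasurable]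
    exact ENNReal.sum_ne_top.1 hsum α hα
  refine ⟨⟨_, hKW⟩, ?_⟩
  rw [Knorm_eq h hKW, Knorm_eq h hD, Knorm_eq h hE, KnormP_eq h hp hKW, KnormP_eq h hp hD, KnormP_eq h hp hE,
    ← HD_eq h hD, ← HD_eq h hE]
  have h1 := ENNReal.toReal_mono htop hest
  rw [ENNReal.toReal_mul, ENNReal.toReal_mul] at h1
  have h2 := Real.rpow_le_rpow ENNReal.toReal_nonneg h1 (by positivity : 0 ≤ 1 / p)
  rw [Real.mul_rpow (by positivity) (by positivity), Real.mul_rpow (by positivity) (by positivity)] at h2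
  refine h2.trans ?_
  gcongr
  linarith

lemma rho_lip (d ℓ : ℕ) : Lip1 d (rhoModel d ℓ) := by
  intro x y
  let P : Ed d → Ed d := fun x => WithLp.toLp 2 (fun i => if (i : ℕ) < d - ℓ then x i else 0)
  have hP : ∀ x : Ed d, Real.sqrt (∑ i ∈ Finset.univ.filter (fun i : Fin d => (i : ℕ) < d - ℓ), (x i) ^ 2) = ‖P x‖ := by
    intro x
    rw [EuclideanSpace.norm_eq, Finset.sum_filter]
    congr 1
    refine Finset.sum_congr rfl fun i _ => ?_
    change _ = ‖if (i : ℕ) < d - ℓ then x i else 0‖ ^ 2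
    split_ifs <;> simp
  unfold rhoModel
  rw [hP, hP]
  refine (abs_min_sub_min_le_max _ _ _ _).trans ?_
  rw [sub_self, abs_zero, max_eq_right (abs_nonneg _)]
  refine (abs_norm_sub_norm_le _ _).trans ?_
  rw [dist_eq_norm, EuclideanSpace.norm_eq, EuclideanSpace.norm_eq]
  refine Real.sqrt_le_sqrt (Finset.sum_le_sum fun i _ => ?_)
  change ‖(if (i : ℕ) < d - ℓ then x i else 0) - (if (i : ℕ) < d - ℓ then y i else 0)‖ ^ 2 ≤ ‖x i - y i‖ ^ 2
  split_ifs
  · exact le_rfl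
  · simp only [sub_self, norm_zero]; rw [zero_pow two_ne_zero]; positivity

lemma model_eq (d ℓ : ℕ) : ModelDomain d ℓ = {x | 0 < rhoModel d ℓ x} := by
  ext x
  simp only [ModelDomain, RStar, mem_compl_iff, mem_ofPred_eq, rhoModel, lt_min_iff, zero_lt_one, true_and]
  rw [Real.sqrt_pos, ← not_le, not_iff_not]
  constructor
  · intro hx
    refine le_of_eq (Finset.sum_eq_zero fun i hi => ?_)
    rw [hx i (Finset.mem_filter.1 hi).2]; simp
  · intro hx i hi
    have h0 : ∑ i ∈ Finset.univ.filter (fun i : Fin d => (i : ℕ) < d - ℓ), (x i) ^ 2 = 0 :=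
      le_antisymm hx (Finset.sum_nonneg fun i _ => sq_nonneg _)
    have := (Finset.sum_eq_zero_iff_of_nonneg fun i _ => sq_nonneg _).1 h0 i (by simp [hi])
    exact pow_eq_zero_iff (two_ne_zero) |>.1 this

/-- Theorem `mult1`: if `W^m_p(ℝ^d)` is an algebra with respect to pointwise multiplication
(i.e. either `1 < p < ∞` and `m > d/p`, or `p = 1` and `m ≥ d`), then there is a constant `c`
with `‖u·v|𝒦^m_{2a-d/p,p}(ℝ^d,ℝ^ℓ_*)‖ ≤ c ‖u|𝒦^m_{a,p}‖ ‖v|𝒦^m_{a,p}‖` for all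
`u, v ∈ 𝒦^m_{a,p}(ℝ^d, ℝ^ℓ_*)`. -/
theorem statement9 (d ℓ m : ℕ) (hd : 2 ≤ d) (hl : ℓ < d) (hm : 1 ≤ m)
    (a p : ℝ) (hp : 1 ≤ p)
    (halg : (1 < p ∧ (d : ℝ) / p < m) ∨ (p = 1 ∧ d ≤ m)) :
    ∃ c : ℝ, 0 < c ∧ ∀ u v : Ed d → ℝ, MemKM d ℓ m a p u → MemKM d ℓ m a p v →
      MemKM d ℓ m (2 * a - d / p) p (u * v) ∧
      KnormM d ℓ m (2 * a - d / p) p (u * v) ≤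
        c * KnormM d ℓ m a p u * KnormM d ℓ m a p v := by
  obtain ⟨c, hc, h⟩ := main_gen (by omega : 1 ≤ d) hp hm halg a
  refine ⟨c, hc, fun u v hu hv => ?_⟩
  unfold MemKM at *
  unfold KnormM
  rw [model_eq] at *
  exact h _ (rho_lip d ℓ) u v hu hv

end
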